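/- Let Δ = (T, 𝒮, ℬ) be a strong triangle blocking arrangement with vertices x₁, x₂, x₃ of T. Suppose there are vertices a₁, b₁ ∈ x₁x₂ and a₂, b₂ ∈ x₂x₃ such that x₁, b₁, a₁, x₂ appear in this order on the edge x₁x₂, x₃, a₂, b₂, x₂ appear in this order on the edge x₂x₃, and a₁a₂, b₁b₂ are proper initial segments intersecting at a point c. Then the subsegment a₂c of a₁a₂ and the subsegment b₁c of b₁b₂ are minimal. -/

import Mathlib

open Set

noncomputable section

/-- Points of the real plane. -/
abbrev Pt := ℝ × ℝ

/-- The boundary of the triangle with vertices `x1`, `x2`, `x3`: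
the union of its three edges. -/
def triBdry (x1 x2 x3 : Pt) : Set Pt :=
  segment ℝ x1 x2 ∪ segment ℝ x2 x3 ∪ segment ℝ x3 x1

/-- The three edges of the triangle with vertices `x1`, `x2`, `x3`. -/
def triEdges (x1 x2 x3 : Pt) : Set (Set Pt) :=
  {segment ℝ x1 x2, segment ℝ x2 x3, segment ℝ x3 x1}

/-- A triangle blocking arrangement: a nondegenerate triangle `x1 x2 x3` together with two
finite collections `S` (proper initial segments) and `B` (blocking segments) of closed
segments with endpoints on the boundary of the triangle and no interior point on the
boundary, satisfying the intersection conditions (i) and (ii). `S ∪ triEdges x1 x2 x3`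
is the collection of initial segments `𝒮̄`. -/
structure TBA where
  x1 : Pt
  x2 : Pt
  x3 : Pt
  S : Set (Set Pt)
  B : Set (Set Pt)
  indep : AffineIndependent ℝ ![x1, x2, x3]
  finS : S.Finite
  finB : B.Finite
  seg_wf : ∀ s ∈ S ∪ B, ∃ a b : Pt, a ≠ b ∧ s = segment ℝ a b ∧
    a ∈ triBdry x1 x2 x3 ∧ b ∈ triBdry x1 x2 x3 ∧
    ∀ p ∈ openSegment ℝ a b, p ∉ triBdry x1 x2 x3
  /- (i) no three initial segments are concurrent … -/
  no_three_concurrent : ∀ s₁ ∈ S ∪ triEdges x1 x2 x3, ∀ s₂ ∈ S ∪ triEdges x1 x2 x3,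
    ∀ s₃ ∈ S ∪ triEdges x1 x2 x3, s₁ ≠ s₂ → s₁ ≠ s₃ → s₂ ≠ s₃ →
    ¬ ∃ p : Pt, p ∈ s₁ ∧ p ∈ s₂ ∧ p ∈ s₃
  /- … and through every intersection point of two initial segments, not both edges,
  there is a unique blocking segment … -/
  block_exists : ∀ s₁ ∈ S ∪ triEdges x1 x2 x3, ∀ s₂ ∈ S ∪ triEdges x1 x2 x3, s₁ ≠ s₂ →
    ¬ (s₁ ∈ triEdges x1 x2 x3 ∧ s₂ ∈ triEdges x1 x2 x3) →
    ∀ p : Pt, p ∈ s₁ → p ∈ s₂ → ∃! b, b ∈ B ∧ p ∈ b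
  /- … while through an intersection point of two edges there is at most one
  blocking segment. -/
  block_unique : ∀ s₁ ∈ S ∪ triEdges x1 x2 x3, ∀ s₂ ∈ S ∪ triEdges x1 x2 x3, s₁ ≠ s₂ →
    ∀ p : Pt, p ∈ s₁ → p ∈ s₂ → ∀ b₁ ∈ B, ∀ b₂ ∈ B, p ∈ b₁ → p ∈ b₂ → b₁ = b₂
  /- (ii) through every intersection point of an initial segment and a blocking segment
  there is a unique second initial segment. -/
  second_segment : ∀ s ∈ S ∪ triEdges x1 x2 x3, ∀ b ∈ B, ∀ p : Pt, p ∈ s → p ∈ b →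
    ∃! s', s' ∈ S ∪ triEdges x1 x2 x3 ∧ s' ≠ s ∧ p ∈ s'

namespace TBA

variable (Δ : TBA)

/-- The collection `𝒮̄` of initial segments. -/
def Sbar : Set (Set Pt) := Δ.S ∪ triEdges Δ.x1 Δ.x2 Δ.x3

/-- The (closed) triangle `T`. -/
def tri : Set Pt := convexHull ℝ {Δ.x1, Δ.x2, Δ.x3}

/-- The boundary `∂T`. -/
def bdry : Set Pt := triBdry Δ.x1 Δ.x2 Δ.x3

/-- A vertex of the arrangement: an intersection point of two initial segments. -/
def IsVertex (p : Pt) : Prop :=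
  ∃ s₁ ∈ Δ.Sbar, ∃ s₂ ∈ Δ.Sbar, s₁ ≠ s₂ ∧ p ∈ s₁ ∧ p ∈ s₂

/-- The segment `xy` is minimal if no vertex of the arrangement lies in its interior. -/
def MinimalSeg (x y : Pt) : Prop :=
  ∀ p ∈ openSegment ℝ x y, ¬ Δ.IsVertex p

/-- An `𝒮̄`-region: the closure of a connected component of `T \ ⋃ L` for some
subset `L` of `𝒮̄`. -/
def IsRegion (R : Set Pt) : Prop :=
  ∃ L ⊆ Δ.Sbar, ∃ p ∈ Δ.tri \ ⋃₀ L,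
    R = closure (connectedComponentIn (Δ.tri \ ⋃₀ L) p)

/-- A minimal `𝒮̄`-region: the closure of a connected component of `T \ ⋃ 𝒮̄`. -/
def IsMinRegion (R : Set Pt) : Prop :=
  ∃ p ∈ Δ.tri \ ⋃₀ Δ.Sbar,
    R = closure (connectedComponentIn (Δ.tri \ ⋃₀ Δ.Sbar) p)

/-- The set `s` contains an edge of the region `R`: it contains a nondegenerate
segment lying on the boundary of `R`. -/
def ContainsEdgeOf (_Δ : TBA) (s R : Set Pt) : Prop :=
  ∃ q₁ q₂ : Pt, q₁ ≠ q₂ ∧ segment ℝ q₁ q₂ ⊆ s ∩ frontier R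

/-- A vertex of the region `R`: a point of `R` that is the intersection of two initial
segments, each containing an edge of `R`. -/
def IsRegionVertex (R : Set Pt) (p : Pt) : Prop :=
  p ∈ R ∧ ∃ s₁ ∈ Δ.Sbar, ∃ s₂ ∈ Δ.Sbar, s₁ ≠ s₂ ∧ p ∈ s₁ ∧ p ∈ s₂ ∧
    Δ.ContainsEdgeOf s₁ R ∧ Δ.ContainsEdgeOf s₂ R

/-- A vertex `p` is internally blocked in the region `R` if the blocking segment
through `p` exists and meets the interior of `R`.  (Externally blocked means not
internally blocked.) -/
def InternallyBlocked (R : Set Pt) (p : Pt) : Prop :=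
  ∃ b ∈ Δ.B, p ∈ b ∧ (b ∩ interior R).Nonempty

/-- Two consecutive vertices of a region `R`: distinct vertices joined by an edge
lying on the boundary of `R`. -/
def Consec (R : Set Pt) (u v : Pt) : Prop :=
  u ≠ v ∧ Δ.IsRegionVertex R u ∧ Δ.IsRegionVertex R v ∧ segment ℝ u v ⊆ frontier R

/-- Condition (A): the arrangement is strong when for every minimal `𝒮̄`-region `R` and
consecutive vertices `v₁, v₂, v₃, v₄, v₅` in this order along `∂R`, if the line
`l(v₁v₂)` and the blocking segment `β(v₃)` intersect inside `T`, and `β(v₃)` meets the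
interior of `R`, then `l(v₁v₂)`, `β(v₃)` and `l(v₄v₅)` are concurrent. -/
def Strong : Prop :=
  ∀ R : Set Pt, Δ.IsMinRegion R →
  ∀ v₁ v₂ v₃ v₄ v₅ : Pt, List.Pairwise (· ≠ ·) [v₁, v₂, v₃, v₄, v₅] →
    Δ.Consec R v₁ v₂ → Δ.Consec R v₂ v₃ → Δ.Consec R v₃ v₄ → Δ.Consec R v₄ v₅ →
    ∀ b ∈ Δ.B, v₃ ∈ b → (b ∩ interior R).Nonempty →
    (∃ q ∈ Δ.tri, q ∈ affineSpan ℝ ({v₁, v₂} : Set Pt) ∧ q ∈ b) →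
    ∃ q : Pt, q ∈ b ∧ q ∈ affineSpan ℝ ({v₁, v₂} : Set Pt) ∧
      q ∈ affineSpan ℝ ({v₄, v₅} : Set Pt)

end TBA

namespace TBA

/-! Affine functionals on the plane. -/

/-- Twice the signed area of the triangle `p q r`, as an affine function of `r`. -/
def area (p q : Pt) : Pt →ᵃ[ℝ] ℝ :=
  ((q.1 - p.1) • LinearMap.snd ℝ ℝ ℝ - (q.2 - p.2) • LinearMap.fst ℝ ℝ ℝ).toAffineMap +
    AffineMap.const ℝ Pt ((q.2 - p.2) * p.1 - (q.1 - p.1) * p.2)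

theorem area_apply (p q r : Pt) :
    area p q r = (q.1 - p.1) * (r.2 - p.2) - (q.2 - p.2) * (r.1 - p.1) := by
  simp [area]; ring

theorem aff_coord (f : Pt →ᵃ[ℝ] ℝ) :
    ∃ a b c : ℝ, ∀ p : Pt, f p = a * p.1 + b * p.2 + c := by
  refine ⟨f.linear (1, 0), f.linear (0, 1), f 0, fun p => ?_⟩
  have h : f p = f.linear p + f 0 := by
    have := f.map_vadd 0 p
    simpa using this
  rw [h]
  have h2 : p = p.1 • ((1 : ℝ), (0 : ℝ)) + p.2 • ((0 : ℝ), (1 : ℝ)) := by ext <;> simp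
  conv_lhs => rw [h2]
  rw [map_add, map_smul, map_smul]
  simp [mul_comm]

theorem aff_comb (f : Pt →ᵃ[ℝ] ℝ) {p q : Pt} {s t : ℝ} (h : s + t = 1) :
    f (s • p + t • q) = s * f p + t * f q := by
  simpa using Convex.combo_affine_apply (f := f) (x := p) (y := q) h

theorem aff_eq_area {f : Pt →ᵃ[ℝ] ℝ} {p q : Pt} (hpq : p ≠ q) (hp : f p = 0) (hq : f q = 0) :
    ∃ k : ℝ, ∀ r, f r = k * area p q r := by
  obtain ⟨a, b, c, h⟩ := aff_coord f
  have hd : (q.1 - p.1) ^ 2 + (q.2 - p.2) ^ 2 ≠ 0 := by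
    intro h0
    apply hpq
    have h1 : q.1 - p.1 = 0 := by nlinarith [sq_nonneg (q.1 - p.1), sq_nonneg (q.2 - p.2)]
    have h2 : q.2 - p.2 = 0 := by nlinarith [sq_nonneg (q.1 - p.1), sq_nonneg (q.2 - p.2)]
    ext <;> linarith
  refine ⟨(b * (q.1 - p.1) - a * (q.2 - p.2)) / ((q.1 - p.1) ^ 2 + (q.2 - p.2) ^ 2), fun r => ?_⟩
  rw [h] at hp hq
  rw [h, area_apply]
  have e : a * (q.1 - p.1) + b * (q.2 - p.2) = 0 := by linarith
  have hc : c = -(a * p.1 + b * p.2) := by linarith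
  rw [div_mul_eq_mul_div, eq_div_iff hd, hc]
  linear_combination
    ((r.1 - p.1) * (q.1 - p.1) + (r.2 - p.2) * (q.2 - p.2)) * e

theorem aff_zero_transfer {f g : Pt →ᵃ[ℝ] ℝ} {p q r z : Pt} (hpq : p ≠ q) (hp : f p = 0)
    (hq : f q = 0) (hz : f z ≠ 0) (gp : g p = 0) (gq : g q = 0) (hr : f r = 0) : g r = 0 := by
  obtain ⟨k, hk⟩ := aff_eq_area hpq hp hq
  obtain ⟨k', hk'⟩ := aff_eq_area hpq gp gq
  have hk0 : k ≠ 0 := by rintro rfl; exact hz (by simp [hk])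
  have : area p q r = 0 := by
    have := hk r; rw [hr] at this
    exact (mul_eq_zero.mp this.symm).resolve_left hk0
  rw [hk', this, mul_zero]

theorem area_eq_zero {p q r : Pt} (hpq : p ≠ q) (h : area p q r = 0) :
    ∃ t : ℝ, r = (1 - t) • p + t • q := by
  rw [area_apply] at h
  have hd : (q.1 - p.1) ^ 2 + (q.2 - p.2) ^ 2 ≠ 0 := by
    intro h0
    apply hpq
    have h1 : q.1 - p.1 = 0 := by nlinarith [sq_nonneg (q.1 - p.1), sq_nonneg (q.2 - p.2)]
    have h2 : q.2 - p.2 = 0 := by nlinarith [sq_nonneg (q.1 - p.1), sq_nonneg (q.2 - p.2)]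
    ext <;> linarith
  refine ⟨((r.1 - p.1) * (q.1 - p.1) + (r.2 - p.2) * (q.2 - p.2)) /
    ((q.1 - p.1) ^ 2 + (q.2 - p.2) ^ 2), ?_⟩
  ext
  · simp
    field_simp
    linear_combination (-(q.2 - p.2)) * h
  · simp
    field_simp
    linear_combination ((q.1 - p.1)) * h

/-! Signs along open segments. -/

section OpenSegment

variable {f : Pt →ᵃ[ℝ] ℝ} {p q r : Pt}

theorem os_comb (h : r ∈ openSegment ℝ p q) :
    ∃ s t : ℝ, 0 < s ∧ 0 < t ∧ s + t = 1 ∧ ∀ f : Pt →ᵃ[ℝ] ℝ, f r = s * f p + t * f q := by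
  obtain ⟨s, t, hs, ht, hst, rfl⟩ := h
  exact ⟨s, t, hs, ht, hst, fun f => aff_comb f hst⟩

theorem os_pos_left (h : r ∈ openSegment ℝ p q) (hp : 0 < f p) (hq : 0 ≤ f q) : 0 < f r := by
  obtain ⟨s, t, hs, ht, -, e⟩ := os_comb h
  rw [e]; positivity

theorem os_pos_right (h : r ∈ openSegment ℝ p q) (hp : 0 ≤ f p) (hq : 0 < f q) : 0 < f r := by
  obtain ⟨s, t, hs, ht, -, e⟩ := os_comb h
  rw [e]; positivity

theorem os_nonneg (h : r ∈ openSegment ℝ p q) (hp : 0 ≤ f p) (hq : 0 ≤ f q) : 0 ≤ f r := by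
  obtain ⟨s, t, hs, ht, -, e⟩ := os_comb h
  rw [e]; positivity

theorem os_zero (h : r ∈ openSegment ℝ p q) (hp : f p = 0) (hq : f q = 0) : f r = 0 := by
  obtain ⟨s, t, hs, ht, -, e⟩ := os_comb h
  rw [e, hp, hq]; ring

theorem os_sep (h : r ∈ openSegment ℝ p q) (hr : f r = 0) (hp : f p ≠ 0) : f p * f q < 0 := by
  obtain ⟨s, t, hs, ht, -, e⟩ := os_comb h
  rw [e] at hr
  have h1 : t * (f p * f q) = -(s * (f p) ^ 2) := by linear_combination f p * hr
  have h2 : 0 < s * (f p) ^ 2 := by positivity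
  by_contra hc
  push Not at hc
  nlinarith [mul_nonneg ht.le hc]

theorem os_exists_zero (h : f p * f q < 0) : ∃ r ∈ openSegment ℝ p q, f r = 0 := by
  have hne : f p - f q ≠ 0 := by
    intro h0
    have : f p = f q := by linarith
    rw [this] at h; nlinarith [mul_self_nonneg (f q)]
  have hs : 0 < -f q / (f p - f q) := by
    rcases mul_neg_iff.mp h with ⟨a, b⟩ | ⟨a, b⟩
    · exact div_pos (by linarith) (by linarith)
    · exact div_pos_of_neg_of_neg (by linarith) (by linarith)
  have ht : 0 < f p / (f p - f q) := by
    rcases mul_neg_iff.mp h with ⟨a, b⟩ | ⟨a, b⟩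
    · exact div_pos (by linarith) (by linarith)
    · exact div_pos_of_neg_of_neg (by linarith) (by linarith)
  have hst : -f q / (f p - f q) + f p / (f p - f q) = 1 := by field_simp; ring
  refine ⟨_, ⟨_, _, hs, ht, hst, rfl⟩, ?_⟩
  rw [aff_comb f hst]; field_simp; ring

theorem os_ne_left (hpq : p ≠ q) (h : r ∈ openSegment ℝ p q) : r ≠ p := by
  rintro rfl
  exact hpq (left_mem_openSegment_iff.mp h)

theorem os_ne_right (hpq : p ≠ q) (h : r ∈ openSegment ℝ p q) : r ≠ q := by
  rintro rfl
  exact hpq (right_mem_openSegment_iff.mp h)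

theorem os_symm (h : r ∈ openSegment ℝ p q) : r ∈ openSegment ℝ q p :=
  openSegment_symm ℝ p q ▸ h

end OpenSegment

end TBA

namespace TBA

variable (Δ : TBA)

theorem mem_tri {r : Pt} (h : r ∈ Δ.tri) :
    ∃ a b c : ℝ, 0 ≤ a ∧ 0 ≤ b ∧ 0 ≤ c ∧ a + b + c = 1 ∧
      r = a • Δ.x1 + b • Δ.x2 + c • Δ.x3 := by
  rw [tri, convexHull_insert (by simp), convexHull_pair, convexJoin_singleton_left] at h
  simp only [mem_iUnion] at h
  obtain ⟨z, ⟨s, t, hs, ht, hst, rfl⟩, u, v, hu, hv, huv, rfl⟩ := h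
  refine ⟨u, v * s, v * t, hu, by positivity, by positivity, ?_, ?_⟩
  · linear_combination huv + v * hst
  · simp [mul_smul, add_assoc]

theorem tri_convex : Convex ℝ Δ.tri := convex_convexHull ℝ _

theorem x1_mem : Δ.x1 ∈ Δ.tri := subset_convexHull ℝ _ (by simp)
theorem x2_mem : Δ.x2 ∈ Δ.tri := subset_convexHull ℝ _ (by simp)
theorem x3_mem : Δ.x3 ∈ Δ.tri := subset_convexHull ℝ _ (by simp)

theorem area_self_left (p q : Pt) : area p q p = 0 := by rw [area_apply]; ring
theorem area_self_right (p q : Pt) : area p q q = 0 := by rw [area_apply]; ring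

theorem area_rotate (p q r : Pt) : area q r p = area p q r := by
  rw [area_apply, area_apply]; ring

theorem area_ne_zero : area Δ.x1 Δ.x2 Δ.x3 ≠ 0 := by
  intro h
  have hne : Δ.x1 ≠ Δ.x2 := by
    intro h'
    have := Δ.indep.injective.ne (show (0 : Fin 3) ≠ 1 by decide)
    simp [h'] at this
  obtain ⟨t, ht⟩ := area_eq_zero hne h
  have hcol := affineIndependent_iff_not_collinear_set.mp Δ.indep
  apply hcol
  rw [collinear_iff_of_mem (p₀ := Δ.x1) (by simp)]
  refine ⟨Δ.x2 - Δ.x1, ?_⟩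
  intro p hp
  simp only [mem_insert_iff, mem_singleton_iff] at hp
  rcases hp with rfl | rfl | rfl
  · exact ⟨0, by simp⟩
  · exact ⟨1, by simp⟩
  · refine ⟨t, ?_⟩
    rw [ht]; ext <;> simp <;> ring

/-- The side `e` of the triangle is the zero set of an affine functional nonnegative on it. -/
theorem edge_rep {e : Set Pt} (he : e ∈ triEdges Δ.x1 Δ.x2 Δ.x3) :
    ∃ g : Pt →ᵃ[ℝ] ℝ, (∀ p ∈ Δ.tri, 0 ≤ g p) ∧ (∀ p ∈ Δ.tri, (p ∈ e ↔ g p = 0)) ∧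
      ∃ z ∈ Δ.tri, g z ≠ 0 := by
  have hD := Δ.area_ne_zero
  have key : ∀ p q r : Pt, area p q r = area Δ.x1 Δ.x2 Δ.x3 →
      (∀ z ∈ Δ.tri, ∃ a b c : ℝ, 0 ≤ a ∧ 0 ≤ b ∧ 0 ≤ c ∧ a + b + c = 1 ∧
        z = a • p + b • q + c • r) → r ∈ Δ.tri →
      ∃ g : Pt →ᵃ[ℝ] ℝ, (∀ z ∈ Δ.tri, 0 ≤ g z) ∧
        (∀ z ∈ Δ.tri, (z ∈ segment ℝ p q ↔ g z = 0)) ∧ ∃ z ∈ Δ.tri, g z ≠ 0 := by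
    intro p q r hpqr hz hr
    have val : ∀ a b c : ℝ, a + b + c = 1 →
        area p q (a • p + b • q + c • r) = c * area p q r := by
      intro a b c h
      have : a = 1 - b - c := by linarith
      subst this
      simp only [area_apply, Prod.fst_add, Prod.snd_add, Prod.smul_fst, Prod.smul_snd, smul_eq_mul]
      ring
    rw [← hpqr] at hD
    refine ⟨(area p q r)⁻¹ • area p q, fun z hzt => ?_, fun z hzt => ?_, r, hr, ?_⟩
    · obtain ⟨a, b, c, ha, hb, hc, h1, rfl⟩ := hz z hzt
      simp only [AffineMap.coe_smul, Pi.smul_apply, smul_eq_mul]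
      rw [val a b c h1]
      field_simp
      exact hc
    · obtain ⟨a, b, c, ha, hb, hc, h1, e⟩ := hz z hzt
      have hv : ((area p q r)⁻¹ • area p q) z = c := by
        simp only [AffineMap.coe_smul, Pi.smul_apply, smul_eq_mul]
        rw [e, val a b c h1]
        field_simp
      rw [hv]
      constructor
      · rintro ⟨s, t, hs, ht, hst, rfl⟩
        rw [← hv]
        rw [aff_comb _ hst]
        simp [area_self_left, area_self_right]
      · rintro rfl
        exact ⟨a, b, ha, hb, by linarith, by rw [e]; simp⟩
    · simp [hD]
  have hz := fun z (h : z ∈ Δ.tri) => Δ.mem_tri h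
  simp only [triEdges, mem_insert_iff, mem_singleton_iff] at he
  rcases he with rfl | rfl | rfl
  · exact key _ _ _ rfl hz Δ.x3_mem
  · refine key _ _ Δ.x1 (area_rotate _ _ _) (fun z h => ?_) Δ.x1_mem
    obtain ⟨a, b, c, ha, hb, hc, h1, e⟩ := hz z h
    exact ⟨b, c, a, hb, hc, ha, by linarith, by rw [e]; abel⟩
  · refine key _ _ Δ.x2 ((area_rotate _ _ _).trans (area_rotate _ _ _)) (fun z h => ?_) Δ.x2_mem
    obtain ⟨a, b, c, ha, hb, hc, h1, e⟩ := hz z h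
    exact ⟨c, a, b, hc, ha, hb, by linarith, by rw [e]; abel⟩

theorem mem_triBdry {x1 x2 x3 p : Pt} : p ∈ triBdry x1 x2 x3 ↔ ∃ e ∈ triEdges x1 x2 x3, p ∈ e := by
  simp [triBdry, triEdges, or_assoc]

theorem edge_sub {e : Set Pt} (he : e ∈ triEdges Δ.x1 Δ.x2 Δ.x3) : e ⊆ Δ.tri := by
  simp only [triEdges, mem_insert_iff, mem_singleton_iff] at he
  rcases he with rfl | rfl | rfl
  · exact Δ.tri_convex.segment_subset Δ.x1_mem Δ.x2_mem
  · exact Δ.tri_convex.segment_subset Δ.x2_mem Δ.x3_mem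
  · exact Δ.tri_convex.segment_subset Δ.x3_mem Δ.x1_mem

theorem chord_rep {a b : Pt} (hab : a ≠ b) (ha : a ∈ Δ.bdry) (hb : b ∈ Δ.bdry)
    (h : ∀ p ∈ openSegment ℝ a b, p ∉ Δ.bdry) {p : Pt} (hp : p ∈ Δ.tri) :
    p ∈ segment ℝ a b ↔ area a b p = 0 := by
  have aux : ∀ u v : Pt, u ≠ v → u ∈ Δ.bdry → v ∈ Δ.bdry →
      (∀ p ∈ openSegment ℝ u v, p ∉ Δ.bdry) → ∀ p ∈ Δ.tri, v ∉ openSegment ℝ u p := by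
    intro u v huv hu hv hn p hp hvp
    obtain ⟨e, he, hve⟩ := mem_triBdry.mp hv
    obtain ⟨eu, heu, hue⟩ := mem_triBdry.mp hu
    obtain ⟨g, hg0, hg, -⟩ := Δ.edge_rep he
    have hut := Δ.edge_sub heu hue
    have hvt := Δ.edge_sub he hve
    have gv : g v = 0 := (hg v hvt).mp hve
    have gu : g u = 0 := by
      by_contra hne
      have := os_pos_left hvp (lt_of_le_of_ne (hg0 u hut) (Ne.symm hne)) (hg0 p hp)
      linarith
    have hm : midpoint ℝ u v ∈ openSegment ℝ u v := midpoint_mem_openSegment u v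
    have hmt : midpoint ℝ u v ∈ Δ.tri :=
      Δ.tri_convex.segment_subset hut hvt (openSegment_subset_segment ℝ _ _ hm)
    exact hn _ hm (mem_triBdry.mpr ⟨e, he, (hg _ hmt).mpr (os_zero hm gu gv)⟩)
  constructor
  · rintro ⟨s, t, hs, ht, hst, rfl⟩
    rw [aff_comb _ hst, area_self_left, area_self_right]; ring
  · intro h0
    obtain ⟨t, rfl⟩ := area_eq_zero hab h0
    rcases lt_or_ge t 0 with ht | ht
    · exfalso
      refine aux b a hab.symm hb ha (fun p hp => h p (os_symm hp)) _ hp ?_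
      refine ⟨-t / (1 - t), 1 / (1 - t), div_pos (by linarith) (by linarith),
        div_pos (by linarith) (by linarith), ?_, ?_⟩
      · have : (1 - t) ≠ 0 := by linarith
        field_simp; ring
      · have : (1 - t) ≠ 0 := by linarith
        ext <;> simp <;> field_simp <;> ring
    · rcases le_or_gt t 1 with ht1 | ht1
      · exact ⟨1 - t, t, by linarith, ht, by ring, rfl⟩
      · exfalso
        refine aux a b hab ha hb h _ hp ?_
        refine ⟨(t - 1) / t, 1 / t, div_pos (by linarith) (by linarith),
          div_pos (by linarith) (by linarith), ?_, ?_⟩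
        · have : t ≠ 0 := by linarith
          field_simp; ring
        · have : t ≠ 0 := by linarith
          ext <;> simp <;> field_simp <;> ring

theorem exists_rep {s : Set Pt} (hs : s ∈ Δ.Sbar ∪ Δ.B) :
    ∃ f : Pt →ᵃ[ℝ] ℝ, (∀ p ∈ Δ.tri, (p ∈ s ↔ f p = 0)) ∧ ∃ z, f z ≠ 0 := by
  have hSB : s ∈ Δ.S ∪ Δ.B ∨ s ∈ triEdges Δ.x1 Δ.x2 Δ.x3 := by
    rcases hs with (h | h) | h
    · exact Or.inl (Or.inl h)
    · exact Or.inr h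
    · exact Or.inl (Or.inr h)
  rcases hSB with h | h
  · obtain ⟨a, b, hab, rfl, ha, hb, hn⟩ := Δ.seg_wf s h
    refine ⟨area a b, fun p hp => Δ.chord_rep hab ha hb hn hp, ?_⟩
    by_contra hz
    push Not at hz
    have h1 := hz (a.1, a.2 + 1)
    have h2 := hz (a.1 + 1, a.2)
    rw [area_apply] at h1 h2
    apply hab
    ext <;> simp at h1 h2 <;> linarith
  · obtain ⟨g, -, h1, z, -, hz⟩ := Δ.edge_rep h
    exact ⟨g, h1, z, hz⟩

open Classical in
/-- An affine functional cutting out the segment `s` in the triangle. -/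
def fn (s : Set Pt) : Pt →ᵃ[ℝ] ℝ :=
  if h : s ∈ Δ.Sbar ∪ Δ.B then (Δ.exists_rep h).choose else 0

variable {Δ}

theorem mem_iff' {s : Set Pt} (hs : s ∈ Δ.Sbar ∪ Δ.B) {p : Pt} (hp : p ∈ Δ.tri) :
    p ∈ s ↔ Δ.fn s p = 0 := by
  rw [fn, dif_pos hs]
  exact (Δ.exists_rep hs).choose_spec.1 p hp

theorem fn_ne' {s : Set Pt} (hs : s ∈ Δ.Sbar ∪ Δ.B) : ∃ z, Δ.fn s z ≠ 0 := by
  rw [fn, dif_pos hs]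
  exact (Δ.exists_rep hs).choose_spec.2

theorem sub_tri' {s : Set Pt} (hs : s ∈ Δ.Sbar ∪ Δ.B) : s ⊆ Δ.tri := by
  have hSB : s ∈ Δ.S ∪ Δ.B ∨ s ∈ triEdges Δ.x1 Δ.x2 Δ.x3 := by
    rcases hs with (h | h) | h
    · exact Or.inl (Or.inl h)
    · exact Or.inr h
    · exact Or.inl (Or.inr h)
  rcases hSB with h | h
  · obtain ⟨a, b, hab, rfl, ha, hb, hn⟩ := Δ.seg_wf s h
    obtain ⟨e, he, hve⟩ := mem_triBdry.mp ha
    obtain ⟨eu, heu, hue⟩ := mem_triBdry.mp hb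
    exact Δ.tri_convex.segment_subset (Δ.edge_sub he hve) (Δ.edge_sub heu hue)
  · exact Δ.edge_sub h

theorem mem_iff {s : Set Pt} (hs : s ∈ Δ.Sbar) {p : Pt} (hp : p ∈ Δ.tri) :
    p ∈ s ↔ Δ.fn s p = 0 := mem_iff' (Or.inl hs) hp

theorem sub_tri {s : Set Pt} (hs : s ∈ Δ.Sbar) : s ⊆ Δ.tri := sub_tri' (Or.inl hs)

theorem fn_zero {s : Set Pt} (hs : s ∈ Δ.Sbar) {p : Pt} (hp : p ∈ s) : Δ.fn s p = 0 :=
  (mem_iff hs (sub_tri hs hp)).mp hp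

theorem fn_ne_zero {s : Set Pt} (hs : s ∈ Δ.Sbar) {p : Pt} (hpt : p ∈ Δ.tri) (hp : p ∉ s) :
    Δ.fn s p ≠ 0 := fun h => hp ((mem_iff hs hpt).mpr h)

theorem tri_of_os {p q r : Pt} (hp : p ∈ Δ.tri) (hq : q ∈ Δ.tri) (h : r ∈ openSegment ℝ p q) :
    r ∈ Δ.tri := Δ.tri_convex.segment_subset hp hq (openSegment_subset_segment ℝ _ _ h)

theorem eq_of_two {s s' : Set Pt} (hs : s ∈ Δ.Sbar ∪ Δ.B) (hs' : s' ∈ Δ.Sbar ∪ Δ.B) {p q : Pt}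
    (hpq : p ≠ q) (hp : p ∈ s) (hq : q ∈ s) (hp' : p ∈ s') (hq' : q ∈ s') : s = s' := by
  have pt := sub_tri' hs hp
  have qt := sub_tri' hs hq
  ext r
  constructor
  · intro h
    have rt := sub_tri' hs h
    rw [mem_iff' hs' rt]
    obtain ⟨z, hz⟩ := fn_ne' hs
    exact aff_zero_transfer hpq ((mem_iff' hs pt).mp hp) ((mem_iff' hs qt).mp hq) hz
      ((mem_iff' hs' pt).mp hp') ((mem_iff' hs' qt).mp hq') ((mem_iff' hs rt).mp h)
  · intro h
    have rt := sub_tri' hs' h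
    rw [mem_iff' hs rt]
    obtain ⟨z, hz⟩ := fn_ne' hs'
    exact aff_zero_transfer hpq ((mem_iff' hs' pt).mp hp') ((mem_iff' hs' qt).mp hq') hz
      ((mem_iff' hs pt).mp hp) ((mem_iff' hs qt).mp hq) ((mem_iff' hs' rt).mp h)

theorem inter_eq {s s' : Set Pt} (hs : s ∈ Δ.Sbar) (hs' : s' ∈ Δ.Sbar) (hne : s ≠ s') {p q : Pt}
    (hp : p ∈ s) (hp' : p ∈ s') (hq : q ∈ s) (hq' : q ∈ s') : p = q := by
  by_contra hpq
  exact hne (eq_of_two (Or.inl hs) (Or.inl hs') hpq hp hq hp' hq')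

theorem three {s₁ s₂ s₃ : Set Pt} (h₁ : s₁ ∈ Δ.Sbar) (h₂ : s₂ ∈ Δ.Sbar) (h₃ : s₃ ∈ Δ.Sbar)
    (h12 : s₁ ≠ s₂) {p : Pt} (hp₁ : p ∈ s₁) (hp₂ : p ∈ s₂) (hp₃ : p ∈ s₃) : s₃ = s₁ ∨ s₃ = s₂ := by
  by_contra h
  push Not at h
  exact Δ.no_three_concurrent s₁ h₁ s₂ h₂ s₃ h₃ h12 h.1.symm h.2.symm ⟨p, hp₁, hp₂, hp₃⟩

variable (Δ)

theorem finEdges : (triEdges Δ.x1 Δ.x2 Δ.x3).Finite := by simp [triEdges]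

theorem finSbar : Δ.Sbar.Finite := Δ.finS.union Δ.finEdges

/-- The initial segment `s` is proper. -/
def Proper (s : Set Pt) : Prop := s ∈ Δ.Sbar ∧ s ∉ triEdges Δ.x1 Δ.x2 Δ.x3

variable {Δ}

theorem x_ne : Δ.x1 ≠ Δ.x2 ∧ Δ.x2 ≠ Δ.x3 ∧ Δ.x3 ≠ Δ.x1 := by
  refine ⟨?_, ?_, ?_⟩ <;> intro h <;> apply Δ.area_ne_zero <;> rw [area_apply]
  · rw [h]; ring
  · rw [h]; ring
  · rw [h]; ring

theorem proper_of_mem_S {s : Set Pt} (h : s ∈ Δ.S) : Δ.Proper s := by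
  refine ⟨Or.inl h, fun he => ?_⟩
  obtain ⟨a, b, hab, rfl, ha, hb, hn⟩ := Δ.seg_wf s (Or.inl h)
  have hm : midpoint ℝ a b ∈ openSegment ℝ a b := midpoint_mem_openSegment a b
  exact hn _ hm (mem_triBdry.mpr ⟨_, he, openSegment_subset_segment ℝ _ _ hm⟩)

theorem edge_mem {e : Set Pt} (he : e ∈ triEdges Δ.x1 Δ.x2 Δ.x3) : e ∈ Δ.Sbar := Or.inr he

theorem edge_sign {e : Set Pt} (he : e ∈ triEdges Δ.x1 Δ.x2 Δ.x3) {p q : Pt} (hp : p ∈ Δ.tri)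
    (hq : q ∈ Δ.tri) : 0 ≤ Δ.fn e p * Δ.fn e q := by
  by_contra h
  push Not at h
  obtain ⟨r, hr, h0⟩ := os_exists_zero h
  have rt := tri_of_os hp hq hr
  obtain ⟨g, hg0, hg, -⟩ := Δ.edge_rep he
  have := (mem_iff (edge_mem he) rt).mpr h0
  have gr := (hg r rt).mp this
  have : g p = 0 := by
    by_contra hne
    have := os_pos_left hr (lt_of_le_of_ne (hg0 p hp) (Ne.symm hne)) (hg0 q hq)
    linarith
  have := (mem_iff (edge_mem he) hp).mp ((hg p hp).mpr this)
  rw [this] at h; simp at h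

theorem proper_of_sep {s : Set Pt} (hs : s ∈ Δ.Sbar) {p q : Pt} (hp : p ∈ Δ.tri)
    (hq : q ∈ Δ.tri) (h : Δ.fn s p * Δ.fn s q < 0) : Δ.Proper s :=
  ⟨hs, fun he => absurd (edge_sign he hp hq) (not_le.mpr h)⟩

theorem endpoints {s : Set Pt} (hs : s ∈ Δ.Sbar) :
    ∃ z₁ z₂, z₁ ≠ z₂ ∧ s = segment ℝ z₁ z₂ ∧
      (∃ e ∈ triEdges Δ.x1 Δ.x2 Δ.x3, e ≠ s ∧ z₁ ∈ e) ∧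
      (∃ e ∈ triEdges Δ.x1 Δ.x2 Δ.x3, e ≠ s ∧ z₂ ∈ e) := by
  by_cases he : s ∈ triEdges Δ.x1 Δ.x2 Δ.x3
  · have hD := Δ.area_ne_zero
    have distinct : ∀ p q r : Pt, area p q r ≠ 0 → segment ℝ p q ≠ segment ℝ q r := by
      intro p q r h heq
      apply h
      have hr : r ∈ segment ℝ p q := heq ▸ right_mem_segment ℝ q r
      obtain ⟨s, t, -, -, hst, rfl⟩ := hr
      rw [aff_comb _ hst, area_self_left, area_self_right]; ring
    have d12 := distinct _ _ _ hD
    have d23 := distinct Δ.x2 Δ.x3 Δ.x1 (by rwa [area_rotate])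
    have d31 := distinct Δ.x3 Δ.x1 Δ.x2 (by rwa [area_rotate, area_rotate])
    obtain ⟨n1, n2, n3⟩ := Δ.x_ne
    simp only [triEdges, mem_insert_iff, mem_singleton_iff] at he
    rcases he with rfl | rfl | rfl
    · exact ⟨_, _, n1, rfl, ⟨_, by simp [triEdges], d31, right_mem_segment ℝ _ _⟩,
        ⟨_, by simp [triEdges], d12.symm, left_mem_segment ℝ _ _⟩⟩
    · exact ⟨_, _, n2, rfl, ⟨segment ℝ Δ.x1 Δ.x2, by simp [triEdges], d12, right_mem_segment ℝ _ _⟩,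
        ⟨segment ℝ Δ.x3 Δ.x1, by simp [triEdges], d23.symm, left_mem_segment ℝ _ _⟩⟩
    · exact ⟨_, _, n3, rfl, ⟨segment ℝ Δ.x2 Δ.x3, by simp [triEdges], d23, right_mem_segment ℝ _ _⟩,
        ⟨segment ℝ Δ.x1 Δ.x2, by simp [triEdges], d31.symm, left_mem_segment ℝ _ _⟩⟩
  · obtain ⟨a, b, hab, rfl, ha, hb, hn⟩ := Δ.seg_wf s (Or.inl (hs.resolve_right he))
    obtain ⟨e1, he1, h1⟩ := mem_triBdry.mp ha
    obtain ⟨e2, he2, h2⟩ := mem_triBdry.mp hb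
    exact ⟨a, b, hab, rfl, ⟨e1, he1, fun h => he (h ▸ he1), h1⟩,
      ⟨e2, he2, fun h => he (h ▸ he2), h2⟩⟩

theorem blocker {s s' : Set Pt} (hs : s ∈ Δ.Sbar) (hs' : Δ.Proper s') (hne : s ≠ s') {p : Pt}
    (hp : p ∈ s) (hp' : p ∈ s') : ∃ b ∈ Δ.B, p ∈ b := by
  obtain ⟨b, h, -⟩ := Δ.block_exists s hs s' hs'.1 hne (fun h => hs'.2 h.2) p hp hp'
  exact ⟨b, h.1, h.2⟩

theorem second {s b : Set Pt} (hs : s ∈ Δ.Sbar) (hb : b ∈ Δ.B) {p : Pt} (hp : p ∈ s)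
    (hpb : p ∈ b) : ∃ s' ∈ Δ.Sbar, s' ≠ s ∧ p ∈ s' := by
  obtain ⟨s', h, -⟩ := Δ.second_segment s hs b hb p hp hpb
  exact ⟨s', h.1, h.2.1, h.2.2⟩

theorem blocker_ne {s b : Set Pt} (hs : s ∈ Δ.Sbar) (hb : b ∈ Δ.B) : b ≠ s := by
  rintro rfl
  obtain ⟨z₁, z₂, hz, e, -⟩ := endpoints hs
  have hinf : b.Infinite := by
    rw [e]
    have : (openSegment ℝ z₁ z₂).Infinite := by
      rw [openSegment_eq_image_lineMap]
      exact (Set.Ioo_infinite zero_lt_one).image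
        ((AffineMap.lineMap_injective ℝ hz).injOn)
    exact this.mono (openSegment_subset_segment ℝ _ _)
  apply hinf
  have hcov : b ⊆ ⋃ s' ∈ {s' ∈ Δ.Sbar | s' ≠ b}, (b ∩ s') := by
    intro p hp
    obtain ⟨s', h1, h2, h3⟩ := second hs hb hp hp
    simp only [mem_iUnion]
    exact ⟨s', ⟨h1, h2⟩, hp, h3⟩
  refine Set.Finite.subset (Set.Finite.biUnion (Δ.finSbar.subset (sep_subset _ _)) ?_) hcov
  rintro s' ⟨h1, h2⟩
  apply Set.Subsingleton.finite
  intro p hp q hq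
  exact inter_eq hs h1 h2.symm hp.1 hp.2 hq.1 hq.2

theorem inter_eq_B {s b : Set Pt} (hs : s ∈ Δ.Sbar) (hb : b ∈ Δ.B) {p q : Pt}
    (hp : p ∈ s) (hp' : p ∈ b) (hq : q ∈ s) (hq' : q ∈ b) : p = q := by
  by_contra hpq
  exact blocker_ne hs hb (eq_of_two (Or.inr hb) (Or.inl hs) hpq hp' hq' hp hq)

/-- The crossing point of two proper initial segments is interior to its blocking segment. -/
theorem blocker_ends {s s' b : Set Pt} (hs : Δ.Proper s) (hs' : Δ.Proper s') (hne : s ≠ s')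
    (hb : b ∈ Δ.B) {p : Pt} (hp : p ∈ s) (hp' : p ∈ s') (hpb : p ∈ b) :
    ∃ z₁ ∈ b, ∃ z₂ ∈ b, z₁ ≠ z₂ ∧ p ∈ openSegment ℝ z₁ z₂ := by
  obtain ⟨z₁, z₂, hz, rfl, h1, h2, -⟩ := Δ.seg_wf b (Or.inr hb)
  have hn : p ∉ triBdry Δ.x1 Δ.x2 Δ.x3 := by
    intro h
    obtain ⟨e, he, hpe⟩ := mem_triBdry.mp h
    rcases three hs.1 hs'.1 (edge_mem he) hne hp hp' hpe with rfl | rfl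
    exacts [hs.2 he, hs'.2 he]
  refine ⟨z₁, left_mem_segment ℝ _ _, z₂, right_mem_segment ℝ _ _, hz,
    mem_openSegment_of_ne_left_right ?_ ?_ hpb⟩
  · rintro rfl; exact hn h1
  · rintro rfl; exact hn h2

end TBA

namespace TBA

section Signs

variable {a b c : ℝ}

theorem pos_pos_trans (h : 0 < a * b) (h' : 0 < c * b) : 0 < a * c := by
  rcases pos_and_pos_or_neg_and_neg_of_mul_pos h with ⟨h1, h2⟩ | ⟨h1, h2⟩ <;>
  rcases pos_and_pos_or_neg_and_neg_of_mul_pos h' with ⟨h3, h4⟩ | ⟨h3, h4⟩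
  · positivity
  · linarith
  · linarith
  · exact mul_pos_of_neg_of_neg h1 h3

theorem neg_neg_trans (h : a * b < 0) (h' : c * b < 0) : 0 < a * c :=
  pos_pos_trans (b := -b) (by linarith) (by linarith)

theorem pos_neg_trans (h : 0 < a * b) (h' : c * b < 0) : a * c < 0 := by
  have := pos_pos_trans (a := a) (b := b) (c := -c) h (by linarith)
  linarith

theorem neg_pos_trans (h : a * b < 0) (h' : 0 < c * b) : a * c < 0 := by
  have := pos_neg_trans h' h
  linarith

end Signs

variable {Δ : TBA}

variable (Δ) in
/-- No initial segment strictly separates `p` and `q`. -/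
def NoSep (p q : Pt) : Prop := ∀ s ∈ Δ.Sbar, 0 ≤ Δ.fn s p * Δ.fn s q

theorem NoSep.symm {p q : Pt} (h : Δ.NoSep p q) : Δ.NoSep q p := fun s hs => by
  rw [mul_comm]; exact h s hs

theorem NoSep.eq_of_mem {m s : Set Pt} (hm : m ∈ Δ.Sbar) (hs : s ∈ Δ.Sbar) {p q r : Pt}
    (h : Δ.NoSep p q) (hpq : p ≠ q) (hp : p ∈ m) (hq : q ∈ m) (hr : r ∈ openSegment ℝ p q)
    (hrs : r ∈ s) : s = m := by
  by_contra hne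
  have hrm : r ∈ m := by
    rw [mem_iff hm (tri_of_os (sub_tri hm hp) (sub_tri hm hq) hr)]
    exact os_zero hr (fn_zero hm hp) (fn_zero hm hq)
  have hps : p ∉ s := fun h' => os_ne_left hpq hr (inter_eq hs hm hne hrs hrm h' hp)
  have := os_sep hr (fn_zero hs hrs) (fn_ne_zero hs (sub_tri hm hp) hps)
  linarith [h s hs]

theorem os_mem {m : Set Pt} (hm : m ∈ Δ.Sbar) {p q r : Pt} (hp : p ∈ m) (hq : q ∈ m)
    (hr : r ∈ openSegment ℝ p q) : r ∈ m := by
  rw [mem_iff hm (tri_of_os (sub_tri hm hp) (sub_tri hm hq) hr)]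
  exact os_zero hr (fn_zero hm hp) (fn_zero hm hq)

/-- A blocking segment does not cross a subsegment without arrangement vertices. -/
theorem NoSep.blocker {m b : Set Pt} (hm : m ∈ Δ.Sbar) (hb : b ∈ Δ.B) {p q : Pt}
    (h : Δ.NoSep p q) (hpq : p ≠ q) (hp : p ∈ m) (hq : q ∈ m) :
    0 ≤ Δ.fn b p * Δ.fn b q := by
  by_contra hn
  push Not at hn
  obtain ⟨w, hw, h0⟩ := os_exists_zero hn
  have hwt := tri_of_os (sub_tri hm hp) (sub_tri hm hq) hw
  have hwb : w ∈ b := (mem_iff' (Or.inr hb) hwt).mpr h0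
  obtain ⟨s', h1, h2, h3⟩ := second hm hb (os_mem hm hp hq hw) hwb
  exact h2 (h.eq_of_mem hm h1 hpq hp hq hw h3)

/-- Coordinates with respect to two lines crossing at `v`. -/
theorem aff_bary {f g : Pt →ᵃ[ℝ] ℝ} {v p q : Pt} (fv : f v = 0) (fp : f p = 0) (gv : g v = 0)
    (gq : g q = 0) (fq : f q ≠ 0) (gp : g p ≠ 0) (h : Pt →ᵃ[ℝ] ℝ) (y : Pt) :
    h y = (1 - g y / g p - f y / f q) * h v + g y / g p * h p + f y / f q * h q := by
  obtain ⟨a, b, c, hf⟩ := aff_coord f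
  obtain ⟨a', b', c', hg⟩ := aff_coord g
  obtain ⟨A, B, C, hh⟩ := aff_coord h
  set s := g y / g p with hs
  set t := f y / f q with ht
  have hs' : s * g p = g y := by rw [hs]; field_simp
  have ht' : t * f q = f y := by rw [ht]; field_simp
  set u := y.1 - ((1 - s - t) * v.1 + s * p.1 + t * q.1) with hu
  set w := y.2 - ((1 - s - t) * v.2 + s * p.2 + t * q.2) with hw
  have e1 : a * u + b * w = 0 := by
    rw [hu, hw]
    rw [hf] at fv fp
    rw [hf, hf] at ht'
    linear_combination (-(1 - s - t)) * fv - s * fp - ht'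
  have e2 : a' * u + b' * w = 0 := by
    rw [hu, hw]
    rw [hg] at gv gq
    rw [hg, hg] at hs'
    linear_combination (-(1 - s - t)) * gv - t * gq - hs'
  have hdet : a * b' - a' * b ≠ 0 := by
    intro h0
    have : (a * b' - a' * b) * ((p.1 - v.1) * (q.2 - v.2) - (q.1 - v.1) * (p.2 - v.2)) =
        (f p - f v) * (g q - g v) - (f q - f v) * (g p - g v) := by
      simp only [hf, hg]; ring
    rw [h0, fv, fp, gv, gq] at this
    have : f q * g p = 0 := by linarith
    rcases mul_eq_zero.mp this with h1 | h1
    exacts [fq h1, gp h1]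
  have hu0 : u = 0 := by
    have : (a * b' - a' * b) * u = 0 := by linear_combination b' * e1 - b * e2
    exact (mul_eq_zero.mp this).resolve_left hdet
  have hw0 : w = 0 := by
    have : (a * b' - a' * b) * w = 0 := by linear_combination a * e2 - a' * e1
    exact (mul_eq_zero.mp this).resolve_left hdet
  simp only [hh]
  rw [hu] at hu0
  rw [hw] at hw0
  linear_combination A * hu0 + B * hw0

variable (Δ) in
/-- The point `y` lies in the open sector at the crossing point of `s₁` and `s₂` spanned by
`p₁` (on `s₁`) and `p₂` (on `s₂`). -/
def InSec (s₁ s₂ : Set Pt) (p₁ p₂ y : Pt) : Prop :=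
  0 < Δ.fn s₁ y * Δ.fn s₁ p₂ ∧ 0 < Δ.fn s₂ y * Δ.fn s₂ p₁

theorem InSec.swap {s₁ s₂ : Set Pt} {p₁ p₂ y : Pt} (h : Δ.InSec s₁ s₂ p₁ p₂ y) :
    Δ.InSec s₂ s₁ p₂ p₁ y := ⟨h.2, h.1⟩

/-- A blocking segment through `v` entering the sector spanned by `p₁` and `p₂` separates
`p₁` from `p₂`. -/
theorem InSec.blocker_sep {s₁ s₂ b : Set Pt} (h₁ : s₁ ∈ Δ.Sbar) (h₂ : s₂ ∈ Δ.Sbar) (hb : b ∈ Δ.B)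
    {v p₁ p₂ y : Pt} (hv₁ : v ∈ s₁) (hv₂ : v ∈ s₂) (hp₁ : p₁ ∈ s₁) (hp₂ : p₂ ∈ s₂)
    (hvb : v ∈ b) (hyb : y ∈ b) (h : Δ.InSec s₁ s₂ p₁ p₂ y) : Δ.fn b p₁ * Δ.fn b p₂ < 0 := by
  have hvt := sub_tri h₁ hv₁
  have f1p2 : Δ.fn s₁ p₂ ≠ 0 := fun h0 => by have := h.1; rw [h0] at this; simp at this
  have f2p1 : Δ.fn s₂ p₁ ≠ 0 := fun h0 => by have := h.2; rw [h0] at this; simp at this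
  have e := aff_bary (fn_zero h₁ hv₁) (fn_zero h₁ hp₁) (fn_zero h₂ hv₂) (fn_zero h₂ hp₂) f1p2 f2p1
    (Δ.fn b) y
  rw [(mem_iff' (Or.inr hb) hvt).mp hvb,
    (mem_iff' (Or.inr hb) (sub_tri' (Or.inr hb) hyb)).mp hyb] at e
  have hs : 0 < Δ.fn s₂ y / Δ.fn s₂ p₁ := by
    rcases pos_and_pos_or_neg_and_neg_of_mul_pos h.2 with ⟨h1, h2⟩ | ⟨h1, h2⟩
    exacts [div_pos h1 h2, div_pos_of_neg_of_neg h1 h2]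
  have ht : 0 < Δ.fn s₁ y / Δ.fn s₁ p₂ := by
    rcases pos_and_pos_or_neg_and_neg_of_mul_pos h.1 with ⟨h1, h2⟩ | ⟨h1, h2⟩
    exacts [div_pos h1 h2, div_pos_of_neg_of_neg h1 h2]
  have hbp : Δ.fn b p₁ ≠ 0 := fun h0 => by
    have hpb : p₁ ∈ b := (mem_iff' (Or.inr hb) (sub_tri h₁ hp₁)).mpr h0
    have := inter_eq_B h₁ hb hp₁ hpb hv₁ hvb
    rw [this] at f2p1
    exact f2p1 (fn_zero h₂ hv₂)
  set s := Δ.fn s₂ y / Δ.fn s₂ p₁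
  set t := Δ.fn s₁ y / Δ.fn s₁ p₂
  have h1 : t * (Δ.fn b p₁ * Δ.fn b p₂) = -(s * (Δ.fn b p₁) ^ 2) := by
    linear_combination (-Δ.fn b p₁) * e
  have h2 : 0 < s * (Δ.fn b p₁) ^ 2 := by positivity
  by_contra hc
  push Not at hc
  nlinarith [mul_nonneg ht.le hc]

theorem InSec.ne {s₁ s₂ : Set Pt} (h₁ : s₁ ∈ Δ.Sbar)
    {p₁ p₂ y : Pt} (hp₁ : p₁ ∈ s₁) (h : Δ.InSec s₁ s₂ p₁ p₂ y) : p₁ ≠ p₂ := by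
  rintro rfl
  have := h.1
  rw [fn_zero h₁ hp₁] at this
  simp at this

/-- The blocking segment of an apex of a triangle does not enter a triangle whose opposite side
contains no vertices. -/
theorem triangle_blocked {s₁ s₂ b m : Set Pt} (h₁ : s₁ ∈ Δ.Sbar) (h₂ : s₂ ∈ Δ.Sbar) (hb : b ∈ Δ.B)
    (hm : m ∈ Δ.Sbar) {v p₁ p₂ y : Pt} (hv₁ : v ∈ s₁) (hv₂ : v ∈ s₂) (hp₁ : p₁ ∈ s₁)
    (hp₂ : p₂ ∈ s₂) (hvb : v ∈ b) (hyb : y ∈ b) (hpm₁ : p₁ ∈ m) (hpm₂ : p₂ ∈ m)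
    (hns : Δ.NoSep p₁ p₂) : ¬ Δ.InSec s₁ s₂ p₁ p₂ y := fun h => by
  have h1 := h.blocker_sep h₁ h₂ hb hv₁ hv₂ hp₁ hp₂ hvb hyb
  have h2 := hns.blocker hm hb (h.ne h₁ hp₁) hpm₁ hpm₂
  linarith

/-- A blocking segment entering a quadrilateral at `v` leaves it through the opposite corner `z`
if the two sides at `z` contain no vertices. -/
theorem quad_exit {s₁ s₂ b m₁ m₂ : Set Pt} (h₁ : s₁ ∈ Δ.Sbar) (h₂ : s₂ ∈ Δ.Sbar) (hb : b ∈ Δ.B)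
    (hm₁ : m₁ ∈ Δ.Sbar) (hm₂ : m₂ ∈ Δ.Sbar) {v p₁ p₂ y z : Pt} (hv₁ : v ∈ s₁) (hv₂ : v ∈ s₂)
    (hp₁ : p₁ ∈ s₁) (hp₂ : p₂ ∈ s₂) (hvb : v ∈ b) (hyb : y ∈ b) (hpm₁ : p₁ ∈ m₁) (hzm₁ : z ∈ m₁)
    (hpm₂ : p₂ ∈ m₂) (hzm₂ : z ∈ m₂) (hz₁ : p₁ ≠ z) (hz₂ : p₂ ≠ z) (hn₁ : Δ.NoSep p₁ z)
    (hn₂ : Δ.NoSep p₂ z) (h : Δ.InSec s₁ s₂ p₁ p₂ y) : z ∈ b := by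
  have h1 := h.blocker_sep h₁ h₂ hb hv₁ hv₂ hp₁ hp₂ hvb hyb
  rw [mem_iff' (Or.inr hb) (sub_tri hm₁ hzm₁)]
  have a1 := hn₁.blocker hm₁ hb hz₁ hpm₁ hzm₁
  have a2 := hn₂.blocker hm₂ hb hz₂ hpm₂ hzm₂
  by_contra hne
  have q := mul_self_pos.mpr hne
  nlinarith [mul_nonneg a1 a2,
    mul_pos_of_neg_of_neg (show -(Δ.fn b z * Δ.fn b z) < 0 by linarith) h1]

/-- If the blocking segment at a crossing of proper segments avoids a sector, then it enters the
adjacent one. -/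
theorem enters_adjacent {s₁ s₂ b : Set Pt} (h₁ : Δ.Proper s₁) (h₂ : Δ.Proper s₂) (hne : s₁ ≠ s₂)
    (hb : b ∈ Δ.B) {v p₁ p₂ q₂ : Pt} (hv₁ : v ∈ s₁) (hv₂ : v ∈ s₂) (hp₁ : p₁ ∈ s₁)
    (hp₂ : p₂ ∈ s₂) (hvb : v ∈ b) (hp₁v : p₁ ≠ v) (hp₂v : p₂ ≠ v)
    (hq : Δ.fn s₁ q₂ * Δ.fn s₁ p₂ < 0) (hn : ∀ y ∈ b, ¬ Δ.InSec s₁ s₂ p₁ p₂ y) :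
    ∃ y ∈ b, Δ.InSec s₁ s₂ p₁ q₂ y := by
  obtain ⟨z₁, hz₁, z₂, hz₂, hz, hvz⟩ := blocker_ends h₁ h₂ hne hb hv₁ hv₂ hvb
  have off : ∀ s ∈ Δ.Sbar, v ∈ s → ∀ z ∈ b, z ≠ v → Δ.fn s z ≠ 0 := fun s hs hvs z hzb hzv =>
    fn_ne_zero hs (sub_tri' (Or.inr hb) hzb) fun hzs => hzv (inter_eq_B hs hb hzs hzb hvs hvb)
  have n1 : z₁ ≠ v := (os_ne_left hz hvz).symm
  have f1p2 : Δ.fn s₁ p₂ ≠ 0 := fn_ne_zero h₁.1 (sub_tri h₂.1 hp₂) fun h =>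
    hp₂v (inter_eq h₁.1 h₂.1 hne h hp₂ hv₁ hv₂)
  have f2p1 : Δ.fn s₂ p₁ ≠ 0 := fn_ne_zero h₂.1 (sub_tri h₁.1 hp₁) fun h =>
    hp₁v (inter_eq h₁.1 h₂.1 hne hp₁ h hv₁ hv₂)
  have a1 := off s₁ h₁.1 hv₁ z₁ hz₁ n1
  have a2 := off s₂ h₂.1 hv₂ z₁ hz₁ n1
  have c1 := os_sep hvz (fn_zero h₁.1 hv₁) a1
  have c2 := os_sep hvz (fn_zero h₂.1 hv₂) a2
  rcases lt_or_gt_of_ne (mul_ne_zero a1 f1p2) with x | x <;>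
  rcases lt_or_gt_of_ne (mul_ne_zero a2 f2p1) with y | y
  · refine absurd ⟨?_, ?_⟩ (hn z₂ hz₂)
    · exact neg_neg_trans (b := Δ.fn s₁ z₁) (by linarith) (by linarith)
    · exact neg_neg_trans (b := Δ.fn s₂ z₁) (by linarith) (by linarith)
  · exact ⟨z₁, hz₁, neg_neg_trans x hq, y⟩
  · refine ⟨z₂, hz₂, ?_, ?_⟩
    · have : Δ.fn s₁ z₂ * Δ.fn s₁ p₂ < 0 :=
        neg_pos_trans (b := Δ.fn s₁ z₁) (by linarith) (by linarith)
      exact neg_neg_trans this hq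
    · exact neg_neg_trans (b := Δ.fn s₂ z₁) (by linarith) (by linarith)
  · exact absurd ⟨x, y⟩ (hn z₁ hz₁)

/-- The next vertex on `m` after `p`, on a given side of another segment `l` through `p`. -/
theorem next_of_vertex {m l : Set Pt} (hm : m ∈ Δ.Sbar) {p z : Pt}
    (hpm : p ∈ m) (hpl : Δ.fn l p = 0) (hz : z ∈ m) (hzv : ∃ s ∈ Δ.Sbar, s ≠ m ∧ z ∈ s)
    (hzl : Δ.fn l z ≠ 0) :
    ∃ v ∈ m, ∃ s ∈ Δ.Sbar, s ≠ m ∧ v ∈ s ∧ Δ.NoSep p v ∧ 0 < Δ.fn l v * Δ.fn l z := by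
  set V : Set Pt := {v | v ∈ m ∧ (∃ s ∈ Δ.Sbar, s ≠ m ∧ v ∈ s) ∧ 0 < Δ.fn l v * Δ.fn l z} with hV
  have hfin : V.Finite := by
    refine Set.Finite.subset (Set.Finite.biUnion (s := {s ∈ Δ.Sbar | s ≠ m})
      (t := fun s => m ∩ s) (Δ.finSbar.subset (sep_subset _ _)) ?_) ?_
    · rintro s' ⟨h1, h2⟩
      apply Set.Subsingleton.finite
      intro p hp q hq
      exact inter_eq hm h1 h2.symm hp.1 hp.2 hq.1 hq.2
    · rintro v ⟨h1, ⟨s, h2, h3, h4⟩, -⟩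
      simp only [mem_iUnion]
      exact ⟨s, ⟨h2, h3⟩, h1, h4⟩
  obtain ⟨v, ⟨hvm, ⟨s, hs, hsm, hvs⟩, hv⟩, hmin⟩ := Set.exists_min_image V
    (fun v => Δ.fn l v * Δ.fn l z) hfin ⟨z, hz, hzv, mul_self_pos.mpr hzl⟩
  refine ⟨v, hvm, s, hs, hsm, hvs, fun s' hs' => ?_, hv⟩
  by_contra hc
  push Not at hc
  obtain ⟨r, hr, h0⟩ := os_exists_zero hc
  have hrm := os_mem hm hpm hvm hr
  have hrs : r ∈ s' := (mem_iff hs' (sub_tri hm hrm)).mpr h0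
  have hne : s' ≠ m := by
    rintro rfl
    rw [fn_zero hs' hpm] at hc; simp at hc
  obtain ⟨a, t, ha, ht, hat, e⟩ := os_comb hr
  have e1 := e (Δ.fn l)
  rw [hpl] at e1
  have e2 : Δ.fn l r * Δ.fn l z = t * (Δ.fn l v * Δ.fn l z) := by rw [e1]; ring
  have := hmin r ⟨hrm, ⟨s', hs', hne, hrs⟩, by rw [e2]; positivity⟩
  rw [e2] at this
  nlinarith

/-- The endpoints of `m` lie on both sides of a proper segment crossing it. -/
theorem ends_sep {m l : Set Pt} (hm : m ∈ Δ.Sbar) (hl : Δ.Proper l) (hne : m ≠ l) {p : Pt}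
    (hpm : p ∈ m) (hpl : p ∈ l) :
    ∃ z₁ ∈ m, ∃ z₂ ∈ m, (∃ s ∈ Δ.Sbar, s ≠ m ∧ z₁ ∈ s) ∧ (∃ s ∈ Δ.Sbar, s ≠ m ∧ z₂ ∈ s) ∧
      Δ.fn l z₁ * Δ.fn l z₂ < 0 := by
  obtain ⟨z₁, z₂, hz, e, ⟨e₁, he₁, hn₁, hz₁⟩, ⟨e₂, he₂, hn₂, hz₂⟩⟩ := endpoints hm
  have m1 : z₁ ∈ m := e ▸ left_mem_segment ℝ _ _
  have m2 : z₂ ∈ m := e ▸ right_mem_segment ℝ _ _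
  have off : ∀ e' ∈ triEdges Δ.x1 Δ.x2 Δ.x3, e' ≠ m → p ∉ e' := by
    intro e' he' hn hp
    rcases three hm hl.1 (edge_mem he') hne hpm hpl hp with h | h
    exacts [hn h, hl.2 (h ▸ he')]
  have hpo : p ∈ openSegment ℝ z₁ z₂ := by
    refine mem_openSegment_of_ne_left_right ?_ ?_ (e ▸ hpm)
    · rintro rfl; exact off _ he₁ hn₁ hz₁
    · rintro rfl; exact off _ he₂ hn₂ hz₂
  refine ⟨z₁, m1, z₂, m2, ⟨e₁, edge_mem he₁, hn₁, hz₁⟩, ⟨e₂, edge_mem he₂, hn₂, hz₂⟩,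
    os_sep hpo (fn_zero hl.1 hpl) ?_⟩
  refine fn_ne_zero hl.1 (sub_tri hm m1) fun h => ?_
  exact os_ne_left hz hpo (inter_eq hm hl.1 hne hpm hpl m1 h)

theorem next_vertex {m l : Set Pt} (hm : m ∈ Δ.Sbar) (hl : l ∈ Δ.Sbar) (hne : m ≠ l) {p o : Pt}
    (hpm : p ∈ m) (hpl : p ∈ l) (ho : o ∈ Δ.tri) (hol : Δ.fn l o ≠ 0) :
    ∃ v ∈ m, ∃ s ∈ Δ.Sbar, s ≠ m ∧ v ∈ s ∧ Δ.NoSep p v ∧ 0 < Δ.fn l v * Δ.fn l o := by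
  have key : ∃ z ∈ m, (∃ s ∈ Δ.Sbar, s ≠ m ∧ z ∈ s) ∧ 0 < Δ.fn l z * Δ.fn l o := by
    by_cases hp : Δ.Proper l
    · obtain ⟨z₁, m1, z₂, m2, v1, v2, h⟩ := ends_sep hm hp hne hpm hpl
      have h1 : Δ.fn l z₁ ≠ 0 := fun h0 => by rw [h0] at h; simp at h
      rcases lt_or_gt_of_ne (mul_ne_zero h1 hol) with x | x
      · exact ⟨z₂, m2, v2, neg_neg_trans (b := Δ.fn l z₁) (by linarith) (by linarith)⟩
      · exact ⟨z₁, m1, v1, x⟩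
    · have hle : l ∈ triEdges Δ.x1 Δ.x2 Δ.x3 := by
        by_contra h; exact hp ⟨hl, h⟩
      obtain ⟨z₁, z₂, hz, e, ⟨e₁, he₁, hn₁, hz₁⟩, ⟨e₂, he₂, hn₂, hz₂⟩⟩ := endpoints hm
      have m1 : z₁ ∈ m := e ▸ left_mem_segment ℝ _ _
      have m2 : z₂ ∈ m := e ▸ right_mem_segment ℝ _ _
      have : ∀ z ∈ m, z ≠ p → 0 < Δ.fn l z * Δ.fn l o := by
        intro z hzm hzp
        have h0 : Δ.fn l z ≠ 0 := fn_ne_zero hl (sub_tri hm hzm) fun h =>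
          hzp (inter_eq hm hl hne hzm h hpm hpl)
        exact lt_of_le_of_ne (edge_sign hle (sub_tri hm hzm) ho) (mul_ne_zero h0 hol).symm
      by_cases h1 : z₁ = p
      · exact ⟨z₂, m2, ⟨e₂, edge_mem he₂, hn₂, hz₂⟩, this z₂ m2 (h1 ▸ hz.symm)⟩
      · exact ⟨z₁, m1, ⟨e₁, edge_mem he₁, hn₁, hz₁⟩, this z₁ m1 h1⟩
  obtain ⟨z, hzm, hzv, hz⟩ := key
  have h1 : Δ.fn l z ≠ 0 := fun h0 => by rw [h0] at hz; simp at hz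
  obtain ⟨v, hv, s, hs, hsm, hvs, hns, hvl⟩ := next_of_vertex hm hpm (fn_zero hl hpl) hzm hzv h1
  exact ⟨v, hv, s, hs, hsm, hvs, hns, pos_pos_trans hvl (by linarith)⟩

theorem next_away {m l : Set Pt} (hm : m ∈ Δ.Sbar) (hl : Δ.Proper l) (hne : m ≠ l) {p u : Pt}
    (hpm : p ∈ m) (hpl : p ∈ l) (hul : Δ.fn l u ≠ 0) :
    ∃ v ∈ m, ∃ s ∈ Δ.Sbar, s ≠ m ∧ v ∈ s ∧ Δ.NoSep p v ∧ Δ.fn l v * Δ.fn l u < 0 := by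
  obtain ⟨z₁, m1, z₂, m2, v1, v2, h⟩ := ends_sep hm hl hne hpm hpl
  have h1 : Δ.fn l z₁ ≠ 0 := fun h0 => by rw [h0] at h; simp at h
  have h2 : Δ.fn l z₂ ≠ 0 := fun h0 => by rw [h0] at h; simp at h
  have key : ∃ o ∈ m, Δ.fn l o * Δ.fn l u < 0 := by
    rcases lt_or_gt_of_ne (mul_ne_zero h1 hul) with x | x
    · exact ⟨z₁, m1, x⟩
    · exact ⟨z₂, m2, neg_pos_trans (b := Δ.fn l z₁) (by linarith) (by linarith)⟩
  obtain ⟨o, hom, ho⟩ := key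
  have h3 : Δ.fn l o ≠ 0 := fun h0 => by rw [h0] at ho; simp at ho
  obtain ⟨v, hv, s, hs, hsm, hvs, hns, hvl⟩ := next_vertex hm hl.1 hne hpm hpl (sub_tri hm hom) h3
  exact ⟨v, hv, s, hs, hsm, hvs, hns, pos_neg_trans (b := Δ.fn l o) hvl (by linarith)⟩

end TBA

namespace TBA

variable {Δ : TBA}

theorem mem_tri_of_comb {a b c : ℝ} (ha : 0 ≤ a) (hb : 0 ≤ b) (hc : 0 ≤ c) (h : a + b + c = 1) :
    a • Δ.x1 + b • Δ.x2 + c • Δ.x3 ∈ Δ.tri := by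
  have := Δ.tri_convex.sum_mem (t := Finset.univ) (w := ![a, b, c]) (z := ![Δ.x1, Δ.x2, Δ.x3])
    (by intro i _; fin_cases i <;> simpa) (by simpa [Fin.sum_univ_three] using h)
    (by intro i _; fin_cases i <;> simp [x1_mem, x2_mem, x3_mem])
  simpa [Fin.sum_univ_three] using this

theorem mem_tri_of_sign {o q : Pt} (ho : o ∈ Δ.tri)
    (h0 : ∀ e ∈ triEdges Δ.x1 Δ.x2 Δ.x3, Δ.fn e o ≠ 0)
    (h : ∀ e ∈ triEdges Δ.x1 Δ.x2 Δ.x3, 0 ≤ Δ.fn e q * Δ.fn e o) : q ∈ Δ.tri := by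
  have hD := Δ.area_ne_zero
  obtain ⟨a, b, c, ha, hb, hc, h1, ho'⟩ := Δ.mem_tri ho
  obtain ⟨n1, n2, n3⟩ := Δ.x_ne
  set D := area Δ.x1 Δ.x2 Δ.x3 with hDdef
  have key : ∀ x y : Pt, ∀ t : ℝ, x ≠ y → segment ℝ x y ∈ triEdges Δ.x1 Δ.x2 Δ.x3 → 0 ≤ t →
      area x y o = t * D → 0 ≤ area x y q / D := by
    intro x y t hxy he ht hat
    obtain ⟨k, hk⟩ := aff_eq_area hxy (fn_zero (edge_mem he) (left_mem_segment ℝ x y))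
      (fn_zero (edge_mem he) (right_mem_segment ℝ x y))
    have hne := h0 _ he
    have hq := h _ he
    rw [hk, hat] at hne
    rw [hk, hk, hat] at hq
    have ht0 : t ≠ 0 := by rintro rfl; simp at hne
    have hk0 : k ≠ 0 := by rintro rfl; simp at hne
    have hpos : 0 < k ^ 2 * t * D ^ 2 := by positivity
    have e : k * area x y q * (k * (t * D)) = (k ^ 2 * t * D ^ 2) * (area x y q / D) := by
      field_simp
    rw [e] at hq
    exact nonneg_of_mul_nonneg_right hq hpos
  have v3 : area Δ.x1 Δ.x2 o = c * D := by
    have : a = 1 - b - c := by linarith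
    rw [ho', hDdef, this]
    simp only [area_apply, Prod.fst_add, Prod.snd_add, Prod.smul_fst, Prod.smul_snd, smul_eq_mul]
    ring
  have v1 : area Δ.x2 Δ.x3 o = a * D := by
    have : b = 1 - a - c := by linarith
    rw [ho', hDdef, this]
    simp only [area_apply, Prod.fst_add, Prod.snd_add, Prod.smul_fst, Prod.smul_snd, smul_eq_mul]
    ring
  have v2 : area Δ.x3 Δ.x1 o = b * D := by
    have : c = 1 - a - b := by linarith
    rw [ho', hDdef, this]
    simp only [area_apply, Prod.fst_add, Prod.snd_add, Prod.smul_fst, Prod.smul_snd, smul_eq_mul]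
    ring
  have k3 := key _ _ c n1 (by simp [triEdges]) hc v3
  have k1 := key _ _ a n2 (by simp [triEdges]) ha v1
  have k2 := key _ _ b n3 (by simp [triEdges]) hb v2
  have e1 : area Δ.x2 Δ.x3 q / D + area Δ.x3 Δ.x1 q / D + area Δ.x1 Δ.x2 q / D = 1 := by
    field_simp
    rw [hDdef]
    simp only [area_apply]; ring
  have := mem_tri_of_comb (Δ := Δ) k1 k2 k3 e1
  convert this using 1
  have hx : ∀ u v : ℝ, u * D = v → u = v / D := fun u v h => by field_simp; exact h
  ext
  · have : q.1 * D = area Δ.x2 Δ.x3 q * Δ.x1.1 + area Δ.x3 Δ.x1 q * Δ.x2.1 +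
        area Δ.x1 Δ.x2 q * Δ.x3.1 := by
      rw [hDdef]; simp only [area_apply]; ring
    rw [hx _ _ this]; simp; ring
  · have : q.2 * D = area Δ.x2 Δ.x3 q * Δ.x1.2 + area Δ.x3 Δ.x1 q * Δ.x2.2 +
        area Δ.x1 Δ.x2 q * Δ.x3.2 := by
      rw [hDdef]; simp only [area_apply]; ring
    rw [hx _ _ this]; simp; ring

theorem fn_continuous (s : Set Pt) : Continuous (Δ.fn s) :=
  AffineMap.continuous_of_finiteDimensional _

variable (Δ) in
/-- The open cell of the arrangement containing `o`. -/
def cell (o : Pt) : Set Pt := {q | ∀ s ∈ Δ.Sbar, 0 < Δ.fn s q * Δ.fn s o}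

variable (Δ) in
/-- The closed cell of the arrangement containing `o`. -/
def closedCell (o : Pt) : Set Pt := {q | ∀ s ∈ Δ.Sbar, 0 ≤ Δ.fn s q * Δ.fn s o}

variable (Δ) in
/-- The point `o` of the triangle lies on no initial segment. -/
def Generic (o : Pt) : Prop := o ∈ Δ.tri ∧ ∀ s ∈ Δ.Sbar, Δ.fn s o ≠ 0

theorem Generic.closedCell_sub {o : Pt} (ho : Δ.Generic o) : Δ.closedCell o ⊆ Δ.tri :=
  fun _ hq => mem_tri_of_sign ho.1 (fun _ he => ho.2 _ (edge_mem he)) fun _ he => hq _ (edge_mem he)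

theorem cell_sub (o : Pt) : Δ.cell o ⊆ Δ.closedCell o := fun _ h s hs => (h s hs).le

theorem cell_isOpen (o : Pt) : IsOpen (Δ.cell o) := by
  have : Δ.cell o = ⋂ s ∈ Δ.Sbar, {q | 0 < Δ.fn s q * Δ.fn s o} := by
    ext q; simp [cell]
  rw [this]
  exact Δ.finSbar.isOpen_biInter fun s _ =>
    isOpen_lt continuous_const ((fn_continuous s).mul continuous_const)

theorem closedCell_isClosed (o : Pt) : IsClosed (Δ.closedCell o) := by
  have : Δ.closedCell o = ⋂ s ∈ Δ.Sbar, {q | 0 ≤ Δ.fn s q * Δ.fn s o} := by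
    ext q; simp [closedCell]
  rw [this]
  exact isClosed_biInter fun s _ =>
    isClosed_le continuous_const ((fn_continuous s).mul continuous_const)

theorem cell_convex (o : Pt) : Convex ℝ (Δ.cell o) := by
  intro p hp q hq s t hs ht hst l hl
  rw [aff_comb _ hst]
  have h1 := hp l hl
  have h2 := hq l hl
  rcases hs.eq_or_lt with rfl | hs
  · obtain rfl : t = 1 := by linarith
    simpa using h2
  · nlinarith [mul_pos hs h1, mul_nonneg ht h2.le]

theorem closedCell_convex (o : Pt) : Convex ℝ (Δ.closedCell o) := by
  intro p hp q hq s t hs ht hst l hl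
  rw [aff_comb _ hst]
  nlinarith [mul_nonneg hs (hp l hl), mul_nonneg ht (hq l hl)]

theorem Generic.mem_cell {o : Pt} (ho : Δ.Generic o) : o ∈ Δ.cell o := fun s hs =>
  mul_self_pos.mpr (ho.2 s hs)

theorem Generic.component_eq {o : Pt} (ho : Δ.Generic o) :
    connectedComponentIn (Δ.tri \ ⋃₀ Δ.Sbar) o = Δ.cell o := by
  have hsub : Δ.cell o ⊆ Δ.tri \ ⋃₀ Δ.Sbar := by
    intro q hq
    refine ⟨ho.closedCell_sub (cell_sub o hq), ?_⟩
    rintro ⟨s, hs, hqs⟩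
    have := hq s hs
    rw [fn_zero hs hqs] at this; simp at this
  refine subset_antisymm ?_ ((cell_convex o).isPreconnected.subset_connectedComponentIn
    ho.mem_cell hsub)
  intro q hq s hs
  by_contra hc
  push Not at hc
  have hK := isPreconnected_connectedComponentIn (x := o) (F := Δ.tri \ ⋃₀ Δ.Sbar)
  have hoK := mem_connectedComponentIn (hsub ho.mem_cell)
  have := hK.intermediate_value hq hoK
    (f := fun q => Δ.fn s q * Δ.fn s o) ((fn_continuous s).mul continuous_const).continuousOn
  obtain ⟨r, hr, h0⟩ := this ⟨hc, mul_self_nonneg _⟩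
  have hr' := connectedComponentIn_subset _ _ hr
  apply hr'.2
  exact ⟨s, hs, (mem_iff hs hr'.1).mpr ((mul_eq_zero.mp h0).resolve_right (ho.2 s hs))⟩

theorem Generic.closure_cell {o : Pt} (ho : Δ.Generic o) :
    closure (Δ.cell o) = Δ.closedCell o := by
  refine subset_antisymm (closure_minimal (cell_sub o) (closedCell_isClosed o)) ?_
  intro q hq
  have h1 : openSegment ℝ o q ⊆ Δ.cell o := by
    intro r hr s hs
    obtain ⟨a, t, ha, ht, -, e⟩ := os_comb hr
    rw [e]
    have := mul_pos ha (ho.mem_cell s hs)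
    have := mul_nonneg ht.le (hq s hs)
    nlinarith
  have h2 := closure_mono h1
  rw [closure_openSegment] at h2
  exact h2 (right_mem_segment ℝ o q)

theorem Generic.isMinRegion {o : Pt} (ho : Δ.Generic o) : Δ.IsMinRegion (Δ.closedCell o) := by
  refine ⟨o, ⟨ho.1, ?_⟩, ?_⟩
  · rintro ⟨s, hs, hos⟩
    exact ho.2 s hs (fn_zero hs hos)
  · rw [ho.component_eq, ho.closure_cell]

theorem Generic.mem_interior {o : Pt} (ho : Δ.Generic o) : o ∈ interior (Δ.closedCell o) :=
  interior_maximal (cell_sub o) (cell_isOpen o) ho.mem_cell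

theorem Generic.mem_frontier {o q : Pt} (ho : Δ.Generic o) (hq : q ∈ Δ.closedCell o) {s : Set Pt}
    (hs : s ∈ Δ.Sbar) (hqs : q ∈ s) : q ∈ frontier (Δ.closedCell o) := by
  refine ⟨subset_closure hq, fun hi => ?_⟩
  have hcont : Continuous (fun t : ℝ => AffineMap.lineMap q o t) :=
    AffineMap.lineMap_continuous
  have h0 : (AffineMap.lineMap q o (0 : ℝ) : Pt) ∈ interior (Δ.closedCell o) := by simpa using hi
  have hev := (hcont.tendsto 0).eventually (isOpen_interior.mem_nhds h0)
  obtain ⟨ε, hε, hball⟩ := Metric.eventually_nhds_iff.mp hev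
  have hm := hball (y := -(ε / 2)) (by simp [abs_of_pos hε]; linarith)
  have h1 := interior_subset hm s hs
  rw [AffineMap.apply_lineMap, fn_zero hs hqs, AffineMap.lineMap_apply] at h1
  simp at h1
  nlinarith [mul_self_pos.mpr (ho.2 s hs)]

/-- Moving along the boundary of a closed cell. -/
theorem mem_closedCell_of_noSep {o p v : Pt} (hp : p ∈ Δ.closedCell o) {s₁ s₂ : Set Pt}
    (ho : Δ.Generic o)
    (h₁ : s₁ ∈ Δ.Sbar) (h₂ : s₂ ∈ Δ.Sbar) (hne : s₁ ≠ s₂) (hp₁ : p ∈ s₁) (hp₂ : p ∈ s₂)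
    (hv : v ∈ s₁) (hns : Δ.NoSep p v) (hs : 0 < Δ.fn s₂ v * Δ.fn s₂ o) : v ∈ Δ.closedCell o := by
  intro s hs'
  by_cases h0 : Δ.fn s p = 0
  · rcases three h₁ h₂ hs' hne hp₁ hp₂ ((mem_iff hs' (sub_tri h₁ hp₁)).mpr h0) with rfl | rfl
    · rw [fn_zero h₁ hv]; simp
    · exact hs.le
  · have h1 : 0 < Δ.fn s o * Δ.fn s p := by
      rw [mul_comm]
      exact lt_of_le_of_ne (hp s hs') (mul_ne_zero h0 (ho.2 s hs')).symm
    have h2 := hns s hs'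
    by_contra hc
    push Not at hc
    have := neg_pos_trans hc (c := Δ.fn s p) (by linarith)
    linarith

theorem Generic.isRegionVertex {o p : Pt} (ho : Δ.Generic o) (hp : p ∈ Δ.closedCell o)
    {s₁ s₂ : Set Pt} (h₁ : s₁ ∈ Δ.Sbar) (h₂ : s₂ ∈ Δ.Sbar) (hne : s₁ ≠ s₂) (hp₁ : p ∈ s₁)
    (hp₂ : p ∈ s₂) : Δ.IsRegionVertex (Δ.closedCell o) p := by
  have aux : ∀ s ∈ Δ.Sbar, ∀ l ∈ Δ.Sbar, s ≠ l → p ∈ s → p ∈ l →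
      Δ.ContainsEdgeOf s (Δ.closedCell o) := by
    intro s hs l hl hsl hps hpl
    obtain ⟨v, hv, -, -, -, -, hns, hvl⟩ := next_vertex hs hl hsl hps hpl ho.1 (ho.2 l hl)
    have hvc := mem_closedCell_of_noSep hp ho hs hl hsl hps hpl hv hns hvl
    refine ⟨p, v, ?_, fun q hq => ?_⟩
    · rintro rfl
      rw [fn_zero hl hpl] at hvl; simp at hvl
    · have hqc := (closedCell_convex o).segment_subset hp hvc hq
      have hqs : q ∈ s := by
        rw [mem_iff hs (ho.closedCell_sub hqc)]
        obtain ⟨a, b, -, -, hab, rfl⟩ := hq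
        rw [aff_comb _ hab, fn_zero hs hps, fn_zero hs hv]; ring
      exact ⟨hqs, ho.mem_frontier hqc hs hqs⟩
  exact ⟨hp, s₁, h₁, s₂, h₂, hne, hp₁, hp₂, aux s₁ h₁ s₂ h₂ hne hp₁ hp₂,
    aux s₂ h₂ s₁ h₁ hne.symm hp₂ hp₁⟩

theorem Generic.consec {o p q : Pt} (ho : Δ.Generic o) (hp : p ∈ Δ.closedCell o)
    (hq : q ∈ Δ.closedCell o) {s s₁ s₂ : Set Pt} (hs : s ∈ Δ.Sbar) (h₁ : s₁ ∈ Δ.Sbar)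
    (h₂ : s₂ ∈ Δ.Sbar) (hne₁ : s₁ ≠ s) (hne₂ : s₂ ≠ s) (hp₁ : p ∈ s₁) (hps : p ∈ s)
    (hq₂ : q ∈ s₂) (hqs : q ∈ s) (hpq : p ≠ q) : Δ.Consec (Δ.closedCell o) p q := by
  refine ⟨hpq, ho.isRegionVertex hp hs h₁ hne₁.symm hps hp₁,
    ho.isRegionVertex hq hs h₂ hne₂.symm hqs hq₂, fun r hr => ?_⟩
  have hrc := (closedCell_convex o).segment_subset hp hq hr
  refine ho.mem_frontier hrc hs ?_
  rw [mem_iff hs (ho.closedCell_sub hrc)]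
  obtain ⟨a, b, -, -, hab, rfl⟩ := hr
  rw [aff_comb _ hab, fn_zero hs hps, fn_zero hs hqs]; ring

theorem mem_affineSpan_iff {s : Set Pt} (hs : s ∈ Δ.Sbar) {p q r : Pt} (hp : p ∈ s) (hq : q ∈ s)
    (hpq : p ≠ q) (hr : r ∈ Δ.tri) : r ∈ affineSpan ℝ ({p, q} : Set Pt) ↔ r ∈ s := by
  constructor
  · intro h
    obtain ⟨t, rfl⟩ := mem_affineSpan_pair_iff_exists_lineMap_eq.mp h
    rw [mem_iff hs hr, AffineMap.apply_lineMap, fn_zero hs hp, fn_zero hs hq]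
    simp
  · intro h
    obtain ⟨k, hk⟩ := aff_eq_area hpq (fn_zero hs hp) (fn_zero hs hq)
    obtain ⟨z, hz⟩ := fn_ne' (Or.inl hs)
    have hk0 : k ≠ 0 := by rintro rfl; exact hz (by rw [hk]; simp)
    have := fn_zero hs h
    rw [hk] at this
    obtain ⟨t, rfl⟩ := area_eq_zero hpq ((mul_eq_zero.mp this).resolve_left hk0)
    have := AffineMap.lineMap_mem_affineSpan_pair (k := ℝ) t p q
    rwa [AffineMap.lineMap_apply_module] at this

/-- A generic point of the blocking segment close to the vertex `v`. -/
theorem exists_generic {s₁ s₂ b : Set Pt} (h₁ : s₁ ∈ Δ.Sbar) (h₂ : s₂ ∈ Δ.Sbar) (hne : s₁ ≠ s₂)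
    (hb : b ∈ Δ.B) {v y : Pt} (hv₁ : v ∈ s₁) (hv₂ : v ∈ s₂) (hvb : v ∈ b) (hyb : y ∈ b)
    (hy₁ : Δ.fn s₁ y ≠ 0) (hy₂ : Δ.fn s₂ y ≠ 0) :
    ∃ o ∈ b, Δ.Generic o ∧ v ∈ Δ.closedCell o ∧ 0 < Δ.fn s₁ o * Δ.fn s₁ y ∧
      0 < Δ.fn s₂ o * Δ.fn s₂ y := by
  have hvt := sub_tri h₁ hv₁
  have hyt := sub_tri' (Or.inr hb) hyb
  have ev : ∀ s ∈ Δ.Sbar, ∀ᶠ t : ℝ in nhds 0, Δ.fn s v ≠ 0 →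
      0 < Δ.fn s v * Δ.fn s (AffineMap.lineMap v y t) := by
    intro s _
    by_cases h0 : Δ.fn s v = 0
    · exact Filter.Eventually.of_forall fun t h => absurd h0 h
    · have hcont : Continuous fun t : ℝ => Δ.fn s v * Δ.fn s (AffineMap.lineMap v y t) :=
        continuous_const.mul ((fn_continuous s).comp AffineMap.lineMap_continuous)
      have h1 : 0 < (fun t : ℝ => Δ.fn s v * Δ.fn s (AffineMap.lineMap v y t)) 0 := by
        simpa using mul_self_pos.mpr h0
      filter_upwards [hcont.continuousAt.eventually (lt_mem_nhds h1)] with t ht _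
      exact ht
  have ev' := (Filter.eventually_all_finite Δ.finSbar).mpr ev
  obtain ⟨ε, hε, hball⟩ := Metric.eventually_nhds_iff.mp ev'
  set t := min (ε / 2) (1 / 2) with ht
  have ht0 : 0 < t := lt_min (by linarith) (by norm_num)
  have ht1 : t < 1 := lt_of_le_of_lt (min_le_right _ _) (by norm_num)
  have htε : t < ε := lt_of_le_of_lt (min_le_left _ _) (by linarith)
  set o : Pt := AffineMap.lineMap v y t with ho
  have hv := hball (y := t) (by simpa [abs_of_pos ht0] using htε)
  have hos : o ∈ openSegment ℝ v y := by
    rw [openSegment_eq_image_lineMap]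
    exact ⟨t, ⟨ht0, ht1⟩, rfl⟩
  have hot : o ∈ Δ.tri := tri_of_os hvt hyt hos
  have hob : o ∈ b := by
    rw [mem_iff' (Or.inr hb) hot]
    exact os_zero hos ((mem_iff' (Or.inr hb) hvt).mp hvb) ((mem_iff' (Or.inr hb) hyt).mp hyb)
  have hso : ∀ s ∈ Δ.Sbar, v ∈ s → Δ.fn s o = t * Δ.fn s y := by
    intro s hs hvs
    rw [ho, AffineMap.apply_lineMap, fn_zero hs hvs, AffineMap.lineMap_apply]
    simp
  have p1 : 0 < Δ.fn s₁ o * Δ.fn s₁ y := by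
    rw [hso s₁ h₁ hv₁, mul_assoc]; exact mul_pos ht0 (mul_self_pos.mpr hy₁)
  have p2 : 0 < Δ.fn s₂ o * Δ.fn s₂ y := by
    rw [hso s₂ h₂ hv₂, mul_assoc]; exact mul_pos ht0 (mul_self_pos.mpr hy₂)
  refine ⟨o, hob, ⟨hot, fun s hs h0 => ?_⟩, fun s hs => ?_, p1, p2⟩
  · by_cases hsv : Δ.fn s v = 0
    · rcases three h₁ h₂ hs hne hv₁ hv₂ ((mem_iff hs hvt).mpr hsv) with rfl | rfl
      · rw [h0] at p1; simp at p1
      · rw [h0] at p2; simp at p2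
    · have := hv s hs hsv
      rw [← ho, h0] at this; simp at this
  · by_cases hsv : Δ.fn s v = 0
    · rw [hsv]; simp
    · exact (hv s hs hsv).le

/-- The consequence of condition (A) that drives the argument: a blocking segment entering a
cell at `v` passes through the intersection of the continuations of the cell boundary. -/
theorem concurrent_of_strong (hstrong : Δ.Strong) {s₁ s₂ b m₁ m₂ : Set Pt} (h₁ : s₁ ∈ Δ.Sbar)
    (h₂ : s₂ ∈ Δ.Sbar) (hne : s₁ ≠ s₂) (hb : b ∈ Δ.B) (hm₁ : m₁ ∈ Δ.Sbar) (hm₂ : m₂ ∈ Δ.Sbar)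
    (hms₁ : m₁ ≠ s₁) (hms₂ : m₂ ≠ s₂) {v p₁ p₂ y w : Pt} (hv₁ : v ∈ s₁) (hv₂ : v ∈ s₂)
    (hvb : v ∈ b) (hyb : y ∈ b) (hp₁ : p₁ ∈ s₁) (hp₂ : p₂ ∈ s₂) (hpm₁ : p₁ ∈ m₁) (hpm₂ : p₂ ∈ m₂)
    (hn₁ : Δ.NoSep v p₁) (hn₂ : Δ.NoSep v p₂) (hsec : Δ.InSec s₁ s₂ p₁ p₂ y) (hwb : w ∈ b)
    (hwm : w ∈ m₁) : w ∈ m₂ := by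
  by_cases hmm : m₁ = m₂
  · exact hmm ▸ hwm
  have hpos : ∀ {a c : ℝ}, 0 < a * c → a ≠ 0 := fun h h0 => by rw [h0] at h; simp at h
  obtain ⟨o, hob, ho, hvo, ho₁, ho₂⟩ := exists_generic h₁ h₂ hne hb hv₁ hv₂ hvb hyb
    (hpos hsec.1) (hpos hsec.2)
  have f2p1 : 0 < Δ.fn s₂ p₁ * Δ.fn s₂ o :=
    pos_pos_trans (b := Δ.fn s₂ y) (by linarith [hsec.2]) ho₂
  have f1p2 : 0 < Δ.fn s₁ p₂ * Δ.fn s₁ o :=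
    pos_pos_trans (b := Δ.fn s₁ y) (by linarith [hsec.1]) ho₁
  have c1 := mem_closedCell_of_noSep hvo ho h₁ h₂ hne hv₁ hv₂ hp₁ hn₁ f2p1
  have c2 := mem_closedCell_of_noSep hvo ho h₂ h₁ hne.symm hv₂ hv₁ hp₂ hn₂ f1p2
  have hp1v : p₁ ≠ v := by rintro rfl; exact hpos f2p1 (fn_zero h₂ hv₂)
  have hp2v : p₂ ≠ v := by rintro rfl; exact hpos f1p2 (fn_zero h₁ hv₁)
  have hp12 : p₁ ≠ p₂ := hsec.ne h₁ hp₁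
  obtain ⟨v1, hv1, t1, ht1, htm1, hvt1, hns1, hs1⟩ :=
    next_vertex hm₁ h₁ hms₁ hpm₁ hp₁ ho.1 (ho.2 s₁ h₁)
  obtain ⟨v5, hv5, t5, ht5, htm5, hvt5, hns5, hs5⟩ :=
    next_vertex hm₂ h₂ hms₂ hpm₂ hp₂ ho.1 (ho.2 s₂ h₂)
  have k1 := mem_closedCell_of_noSep c1 ho hm₁ h₁ hms₁ hpm₁ hp₁ hv1 hns1 hs1
  have k5 := mem_closedCell_of_noSep c2 ho hm₂ h₂ hms₂ hpm₂ hp₂ hv5 hns5 hs5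
  have v1p1 : v1 ≠ p₁ := by rintro rfl; exact hpos hs1 (fn_zero h₁ hp₁)
  have v1v : v1 ≠ v := by rintro rfl; exact hpos hs1 (fn_zero h₁ hv₁)
  have v5p2 : v5 ≠ p₂ := by rintro rfl; exact hpos hs5 (fn_zero h₂ hp₂)
  have v5v : v5 ≠ v := by rintro rfl; exact hpos hs5 (fn_zero h₂ hv₂)
  have hm1s2 : m₁ ≠ s₂ := by
    rintro rfl; exact hp1v (inter_eq h₁ h₂ hne hp₁ hpm₁ hv₁ hv₂)
  have hm2s1 : m₂ ≠ s₁ := by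
    rintro rfl; exact hp2v (inter_eq h₁ h₂ hne hpm₂ hp₂ hv₁ hv₂)
  have v1p2 : v1 ≠ p₂ := by
    rintro rfl
    rcases three hm₂ h₂ hm₁ hms₂ hpm₂ hp₂ hv1 with h | h
    exacts [hmm h, hm1s2 h]
  have v5p1 : v5 ≠ p₁ := by
    rintro rfl
    rcases three hm₁ h₁ hm₂ hms₁ hpm₁ hp₁ hv5 with h | h
    exacts [hmm h.symm, hm2s1 h]
  by_cases h15 : v1 = v5
  · subst h15
    have hz := quad_exit h₁ h₂ hb hm₁ hm₂ hv₁ hv₂ hp₁ hp₂ hvb hyb hpm₁ hv1 hpm₂ hv5 v1p1.symm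
      v1p2.symm hns1 hns5 hsec
    rw [inter_eq_B hm₁ hb hwm hwb hv1 hz]
    exact hv5
  · have cA := ho.consec k1 c1 hm₁ ht1 h₁ htm1 hms₁.symm hvt1 hv1 hp₁ hpm₁ v1p1
    have cB := ho.consec c1 hvo h₁ hm₁ h₂ hms₁ hne.symm hpm₁ hp₁ hv₂ hv₁ hp1v
    have cC := ho.consec hvo c2 h₂ h₁ hm₂ hne hms₂ hv₁ hv₂ hpm₂ hp₂ hp2v.symm
    have cD := ho.consec c2 k5 hm₂ h₂ ht5 hms₂.symm htm5 hp₂ hpm₂ hvt5 hv5 v5p2.symm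
    have hwt := sub_tri hm₁ hwm
    obtain ⟨q, hqb, hq1, hq5⟩ := hstrong _ ho.isMinRegion v1 p₁ v p₂ v5
      (by simp [v1p1, v1v, v1p2, h15, hp1v, hp12, v5p1.symm, hp2v.symm, v5v.symm, v5p2.symm])
      cA cB cC cD b hb hvb ⟨o, hob, ho.mem_interior⟩
      ⟨w, hwt, (mem_affineSpan_iff hm₁ hv1 hpm₁ v1p1 hwt).mpr hwm, hwb⟩
    have hqt := sub_tri' (Or.inr hb) hqb
    have hqm1 := (mem_affineSpan_iff hm₁ hv1 hpm₁ v1p1 hqt).mp hq1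
    have hqm2 := (mem_affineSpan_iff hm₂ hpm₂ hv5 v5p2.symm hqt).mp hq5
    rw [inter_eq_B hm₁ hb hwm hwb hqm1 hqb]
    exact hqm2

end TBA

namespace TBA

theorem os_same_of_zero_right {f : Pt →ᵃ[ℝ] ℝ} {p q r : Pt} (h : r ∈ openSegment ℝ p q)
    (hq : f q = 0) (hp : f p ≠ 0) : 0 < f p * f r := by
  obtain ⟨s, t, hs, ht, -, e⟩ := os_comb h
  rw [e, hq]
  have := mul_pos hs (mul_self_pos.mpr hp)
  linarith

theorem os_same_of_zero_left {f : Pt →ᵃ[ℝ] ℝ} {p q r : Pt} (h : r ∈ openSegment ℝ p q)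
    (hp : f p = 0) (hq : f q ≠ 0) : 0 < f q * f r :=
  os_same_of_zero_right (os_symm h) hp hq

theorem ne_zero_of_mul_neg {a b : ℝ} (h : a * b < 0) : a ≠ 0 ∧ b ≠ 0 := by
  constructor <;> rintro rfl <;> simp at h

variable {Δ : TBA}

theorem fn_ne_of_ne {s s' : Set Pt} (hs : s ∈ Δ.Sbar) (hs' : s' ∈ Δ.Sbar) (hne : s ≠ s') {p q : Pt}
    (hp : p ∈ s) (hp' : p ∈ s') (hq : q ∈ s) (hpq : q ≠ p) : Δ.fn s' q ≠ 0 :=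
  fn_ne_zero hs' (sub_tri hs hq) fun h => hpq (inter_eq hs hs' hne hq h hp hp')

/-- There is no pair of consecutive nested uncrossed triangles at a common apex `a₂`. -/
theorem no_nested_pair (hstrong : Δ.Strong) {a σ d₁ d₂ : Set Pt} (ha : Δ.Proper a)
    (hσ : σ ∈ Δ.Sbar) (hd₁ : Δ.Proper d₁) (hd₂ : Δ.Proper d₂) (haσ : a ≠ σ) (had₁ : a ≠ d₁)
    (had₂ : a ≠ d₂) (hσd₁ : σ ≠ d₁) (hσd₂ : σ ≠ d₂) (hdd : d₁ ≠ d₂) {a₂ e₁ e₂ u₁ u₂ : Pt}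
    (ha₂a : a₂ ∈ a) (ha₂σ : a₂ ∈ σ) (he₁a : e₁ ∈ a) (he₁d : e₁ ∈ d₁) (he₂a : e₂ ∈ a)
    (he₂d : e₂ ∈ d₂) (hu₁σ : u₁ ∈ σ) (hu₁d : u₁ ∈ d₁) (hu₂σ : u₂ ∈ σ) (hu₂d : u₂ ∈ d₂)
    (hoa : e₁ ∈ openSegment ℝ a₂ e₂) (hoσ : u₁ ∈ openSegment ℝ a₂ u₂)
    (n₁ : Δ.NoSep a₂ e₁) (n₂ : Δ.NoSep e₁ e₂) (n₃ : Δ.NoSep a₂ u₁) (n₄ : Δ.NoSep u₁ u₂)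
    (n₅ : Δ.NoSep e₁ u₁) (n₆ : Δ.NoSep e₂ u₂) : False := by
  have a2e2 : a₂ ≠ e₂ := by
    rintro rfl
    rcases three ha.1 hσ hd₂.1 haσ ha₂a ha₂σ he₂d with h | h
    exacts [had₂ h.symm, hσd₂ h.symm]
  have a2u2 : a₂ ≠ u₂ := by
    rintro rfl
    rcases three ha.1 hσ hd₂.1 haσ ha₂a ha₂σ hu₂d with h | h
    exacts [had₂ h.symm, hσd₂ h.symm]
  have e1a2 := os_ne_left a2e2 hoa
  have e1e2 := os_ne_right a2e2 hoa
  have u1a2 := os_ne_left a2u2 hoσ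
  have u1u2 := os_ne_right a2u2 hoσ
  have e1u1 : e₁ ≠ u₁ := by
    rintro rfl; exact e1a2 (inter_eq ha.1 hσ haσ he₁a hu₁σ ha₂a ha₂σ)
  have e2u2 : e₂ ≠ u₂ := by
    rintro rfl; exact a2e2 (inter_eq ha.1 hσ haσ he₂a hu₂σ ha₂a ha₂σ).symm
  have fau2 := fn_ne_of_ne hσ ha.1 haσ.symm ha₂σ ha₂a hu₂σ a2u2.symm
  have fau1 := fn_ne_of_ne hσ ha.1 haσ.symm ha₂σ ha₂a hu₁σ u1a2
  have same := os_same_of_zero_left hoσ (fn_zero ha.1 ha₂a) fau2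
  have fd1a2 := fn_ne_of_ne ha.1 hd₁.1 had₁ he₁a he₁d ha₂a e1a2.symm
  have fd1e2 := fn_ne_of_ne ha.1 hd₁.1 had₁ he₁a he₁d he₂a e1e2.symm
  have sepd1 := os_sep hoa (fn_zero hd₁.1 he₁d) fd1a2
  -- the blocking segment at `e₁`
  obtain ⟨b₁, hb₁, heb₁⟩ := blocker hd₁.1 ha had₁.symm he₁d he₁a
  obtain ⟨q, hqd, l, hl, hld, hql, nq, sq⟩ := next_away hd₁.1 ha had₁.symm he₁d he₁a fau1
  have not₁ : ∀ y ∈ b₁, ¬ Δ.InSec a d₁ a₂ u₁ y := fun y hy =>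
    triangle_blocked ha.1 hd₁.1 hb₁ hσ he₁a he₁d ha₂a hu₁d heb₁ hy ha₂σ hu₁σ n₃
  obtain ⟨y, hy, hys⟩ := enters_adjacent ha hd₁ had₁ hb₁ he₁a he₁d ha₂a hu₁d heb₁ e1a2.symm
    e1u1.symm sq not₁
  obtain ⟨y', hy', hys'⟩ := enters_adjacent hd₁ ha had₁.symm hb₁ he₁d he₁a hu₁d ha₂a heb₁ e1u1.symm
    e1a2.symm (q₂ := e₂) (by linarith) (fun y hy h => not₁ y hy h.swap)
  have hu2b := quad_exit hd₁.1 ha.1 hb₁ hσ hd₂.1 he₁d he₁a hu₁d he₂a heb₁ hy' hu₁σ hu₂σ he₂d hu₂d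
    u1u2 e2u2 n₄ n₆ hys'
  have hu2l := concurrent_of_strong hstrong ha.1 hd₁.1 had₁ hb₁ hσ hl haσ.symm hld he₁a he₁d heb₁ hy
    ha₂a hqd ha₂σ hql n₁.symm nq hys hu2b hu₂σ
  have qu1 : q ≠ u₁ := by
    rintro rfl; nlinarith [mul_self_nonneg (Δ.fn a q)]
  have hl2 : l = d₂ := by
    rcases three hσ hd₂.1 hl hσd₂ hu₂σ hu₂d hu2l with h | h
    · exact absurd (inter_eq hd₁.1 hσ hσd₁.symm hqd (h ▸ hql) hu₁d hu₁σ) qu1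
    · exact h
  rw [hl2] at hql
  -- the blocking segment at `e₂`
  obtain ⟨b₂, hb₂, heb₂⟩ := blocker hd₂.1 ha had₂.symm he₂d he₂a
  have sq2 : Δ.fn a u₂ * Δ.fn a q < 0 := pos_neg_trans same (by linarith)
  have qe2 : q ≠ e₂ := by
    rintro rfl; exact (ne_zero_of_mul_neg sq2).2 (fn_zero ha.1 he₂a)
  have fd2e1 := fn_ne_of_ne ha.1 hd₂.1 had₂ he₂a he₂d he₁a e1e2
  have fd2a2 := fn_ne_of_ne ha.1 hd₂.1 had₂ he₂a he₂d ha₂a a2e2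
  have not₂ : ∀ y ∈ b₂, ¬ Δ.InSec a d₂ e₁ q y := fun y hy =>
    triangle_blocked ha.1 hd₂.1 hb₂ hd₁.1 he₂a he₂d he₁a hql heb₂ hy he₁d hqd nq
  obtain ⟨e₃, he₃a, r, hr, hra, he₃r, ne₃, se₃⟩ := next_away ha.1 hd₂ had₂ he₂a he₂d fd2e1
  obtain ⟨z, hz, hzs⟩ := enters_adjacent ha hd₂ had₂ hb₂ he₂a he₂d he₁a hql heb₂ e1e2 qe2 sq2 not₂
  obtain ⟨z', hz', hzs'⟩ := enters_adjacent hd₂ ha had₂.symm hb₂ he₂d he₂a hql he₁a heb₂ qe2 e1e2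
    se₃ (fun y hy h => not₂ y hy h.swap)
  have hu1b := quad_exit ha.1 hd₂.1 hb₂ hd₁.1 hσ he₂a he₂d he₁a hu₂d heb₂ hz he₁d hu₁d hu₂σ hu₁σ
    e1u1 u1u2.symm n₅ n₄.symm hzs
  have ne2q : Δ.NoSep e₂ q := by
    intro s hs
    by_contra hc
    push Not at hc
    have h1 := n₂ s hs
    have h2 := nq s hs
    have h0 : Δ.fn s e₁ = 0 := by
      by_contra h0
      have := mul_self_pos.mpr h0
      nlinarith [mul_nonneg h1 h2, mul_pos_of_neg_of_neg (show -(Δ.fn s e₁ * Δ.fn s e₁) < 0 by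
        linarith) hc]
    rcases three ha.1 hd₁.1 hs had₁ he₁a he₁d ((mem_iff hs (sub_tri ha.1 he₁a)).mpr h0) with h | h
    · subst h; exact (ne_zero_of_mul_neg hc).1 (fn_zero hs he₂a)
    · subst h; exact (ne_zero_of_mul_neg hc).2 (fn_zero hs hqd)
  have hu1r := concurrent_of_strong hstrong hd₂.1 ha.1 had₂.symm hb₂ hd₁.1 hr hdd hra he₂d he₂a
    heb₂ hz' hql he₃a hqd he₃r ne2q ne₃ hzs' hu1b hu₁d
  rcases three hσ hd₁.1 hr hσd₁ hu₁σ hu₁d hu1r with h | h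
  · have : e₃ = a₂ := inter_eq ha.1 hσ haσ he₃a (h ▸ he₃r) ha₂a ha₂σ
    subst this
    have := os_same_of_zero_right hoa (fn_zero hd₂.1 he₂d) fd2a2
    linarith
  · have : e₃ = e₁ := inter_eq ha.1 hd₁.1 had₁ he₃a (h ▸ he₃r) he₁a he₁d
    subst this
    nlinarith [mul_self_nonneg (Δ.fn d₂ e₃)]

end TBA

namespace TBA
variable {Δ : TBA}

section OpenSegment
variable {f : Pt →ᵃ[ℝ] ℝ} {p q r : Pt}

theorem os_neg_left (h : r ∈ openSegment ℝ p q) (hp : f p < 0) (hq : f q ≤ 0) : f r < 0 := by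
  obtain ⟨s, t, hs, ht, -, e⟩ := os_comb h
  rw [e]; nlinarith

theorem os_neg_right (h : r ∈ openSegment ℝ p q) (hp : f p ≤ 0) (hq : f q < 0) : f r < 0 :=
  os_neg_left (os_symm h) hq hp

theorem os_ext_pos (h : r ∈ openSegment ℝ p q) (hp : f p ≤ 0) (hr : 0 < f r) : 0 < f q := by
  by_contra! hq
  obtain ⟨s, t, hs, ht, -, e⟩ := os_comb h
  rw [e] at hr; nlinarith

theorem os_ext_neg (h : r ∈ openSegment ℝ p q) (hp : 0 ≤ f p) (hr : f r < 0) : f q < 0 := by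
  by_contra! hq
  obtain ⟨s, t, hs, ht, -, e⟩ := os_comb h
  rw [e] at hr; nlinarith

end OpenSegment

/-- A point of the line `pq` on the `q`-side of a line through `p` and on the `p`-side of a line
through `q` lies between `p` and `q`. -/
theorem os_of_between {m k l : Pt →ᵃ[ℝ] ℝ} {p q y : Pt} (hm : ∃ z, m z ≠ 0) (mp : m p = 0)
    (mq : m q = 0) (my : m y = 0) (kp : k p = 0) (lq : l q = 0) (hk : 0 < k y * k q)
    (hl : 0 < l y * l p) : y ∈ openSegment ℝ p q := by
  have hpq : p ≠ q := by
    rintro rfl; rw [kp] at hk; simp at hk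
  obtain ⟨z, hz⟩ := hm
  have ha : area p q y = 0 := by
    obtain ⟨κ, hκ⟩ := aff_eq_area hpq mp mq
    have h1 := hκ y
    have h2 := hκ z
    have : κ ≠ 0 := by rintro rfl; simp at h2; exact hz h2
    rw [my] at h1
    simpa [this] using h1.symm
  obtain ⟨t, rfl⟩ := area_eq_zero hpq ha
  rw [aff_comb _ (by ring), kp] at hk
  rw [aff_comb _ (by ring), lq] at hl
  refine ⟨1 - t, t, ?_, ?_, by ring, rfl⟩
  · by_contra! h
    nlinarith [mul_self_nonneg (l p)]
  · by_contra! h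
    nlinarith [mul_self_nonneg (k q)]

theorem os_of_sep {m d : Set Pt} (hm : m ∈ Δ.Sbar) (hd : d ∈ Δ.Sbar) {p q r : Pt} (hp : p ∈ m)
    (hq : q ∈ m) (hr : r ∈ m) (hrd : r ∈ d) (h : Δ.fn d p * Δ.fn d q < 0) :
    r ∈ openSegment ℝ p q := by
  obtain ⟨z, hz, h0⟩ := os_exists_zero h
  have hzm := os_mem hm hp hq hz
  have hzd := (mem_iff hd (sub_tri hm hzm)).mpr h0
  have hne : m ≠ d := by
    rintro rfl; rw [fn_zero hm hp] at h; simp at h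
  rwa [inter_eq hm hd hne hr hrd hzm hzd]

variable (Δ) in
/-- `f` is an affine functional cutting out the initial segment `s`, equal to `Δ.fn s` up to
sign. -/
structure Rep (s : Set Pt) (f : Pt →ᵃ[ℝ] ℝ) : Prop where
  mem : s ∈ Δ.Sbar
  iff : ∀ p ∈ Δ.tri, p ∈ s ↔ f p = 0
  mul : ∀ p q, Δ.fn s p * Δ.fn s q = f p * f q

theorem exists_rep_pos {s : Set Pt} (hs : s ∈ Δ.Sbar) {p : Pt} (hp : Δ.fn s p ≠ 0) :
    ∃ f, Δ.Rep s f ∧ 0 < f p := by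
  rcases lt_or_gt_of_ne hp with h | h
  · refine ⟨-Δ.fn s, ⟨hs, fun p hp => ?_, fun p q => ?_⟩, ?_⟩
    · rw [mem_iff hs hp]; simp
    · simp
    · simpa using h
  · exact ⟨Δ.fn s, ⟨hs, fun p hp => mem_iff hs hp, fun _ _ => rfl⟩, h⟩

theorem Rep.zero {s : Set Pt} {f : Pt →ᵃ[ℝ] ℝ} (h : Δ.Rep s f) {p : Pt} (hp : p ∈ s) : f p = 0 :=
  (h.iff p (sub_tri h.mem hp)).mp hp

theorem Rep.neg {s : Set Pt} {f : Pt →ᵃ[ℝ] ℝ} (h : Δ.Rep s f) {p q : Pt}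
    (hs : Δ.fn s p * Δ.fn s q < 0) (hp : 0 < f p) : f q < 0 := by
  rw [h.mul] at hs
  by_contra! hq
  nlinarith

variable (Δ) in
/-- Two initial segments `a = a₁a₂` and `b = b₁b₂` cutting off the corner `x₂` between `σ₀` and
`σ₁`, crossing at `c`. -/
structure CrossPair (σ₀ σ₁ a b : Set Pt) (x₁ x₂ x₃ a₁ a₂ b₁ b₂ c : Pt) : Prop where
  hσ₀ : σ₀ ∈ Δ.Sbar
  hσ₁ : σ₁ ∈ Δ.Sbar
  hσ : σ₀ ≠ σ₁
  x₁σ : x₁ ∈ σ₀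
  x₂σ₀ : x₂ ∈ σ₀
  x₂σ₁ : x₂ ∈ σ₁
  x₃σ : x₃ ∈ σ₁
  ha : a ∈ Δ.Sbar
  hb : b ∈ Δ.Sbar
  a₁a : a₁ ∈ a
  a₂a : a₂ ∈ a
  b₁b : b₁ ∈ b
  b₂b : b₂ ∈ b
  a₁σ : a₁ ∈ σ₀
  a₂σ : a₂ ∈ σ₁
  b₁σ : b₁ ∈ σ₀
  b₂σ : b₂ ∈ σ₁
  x₂a : x₂ ∉ a
  x₂b : x₂ ∉ b
  o₁ : a₁ ∈ openSegment ℝ x₂ b₁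
  o₂ : b₁ ∈ openSegment ℝ a₁ x₁
  o₃ : b₂ ∈ openSegment ℝ x₂ a₂
  o₄ : a₂ ∈ openSegment ℝ b₂ x₃
  oa : c ∈ openSegment ℝ a₁ a₂
  ob : c ∈ openSegment ℝ b₁ b₂

namespace CrossPair

variable {σ₀ σ₁ a b : Set Pt} {x₁ x₂ x₃ a₁ a₂ b₁ b₂ c : Pt}

theorem reflect (P : Δ.CrossPair σ₀ σ₁ a b x₁ x₂ x₃ a₁ a₂ b₁ b₂ c) :
    Δ.CrossPair σ₁ σ₀ b a x₃ x₂ x₁ b₂ b₁ a₂ a₁ c :=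
  ⟨P.hσ₁, P.hσ₀, P.hσ.symm, P.x₃σ, P.x₂σ₁, P.x₂σ₀, P.x₁σ, P.hb, P.ha, P.b₂b, P.b₁b, P.a₂a,
    P.a₁a, P.b₂σ, P.b₁σ,
    P.a₂σ, P.a₁σ, P.x₂b, P.x₂a, P.o₃, P.o₄, P.o₁, P.o₂, os_symm P.ob, os_symm P.oa⟩

theorem x₂_tri
    (P : Δ.CrossPair σ₀ σ₁ a b x₁ x₂ x₃ a₁ a₂ b₁ b₂ c) : x₂ ∈ Δ.tri := sub_tri P.hσ₀ P.x₂σ₀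

/-- Signs with respect to the first segment. -/
theorem signs_a
    (P : Δ.CrossPair σ₀ σ₁ a b x₁ x₂ x₃ a₁ a₂ b₁ b₂ c)
    : ∃ f, Δ.Rep a f ∧ f a₁ = 0 ∧ f a₂ = 0 ∧ f c = 0 ∧ 0 < f x₂ ∧ 0 < f b₂ ∧
    f x₁ < 0 ∧ f x₃ < 0 ∧ f b₁ < 0 := by
  obtain ⟨f, hf, h2⟩ := exists_rep_pos P.ha (fn_ne_zero P.ha P.x₂_tri P.x₂a)
  have h1 := hf.zero P.a₁a
  have h3 := hf.zero P.a₂a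
  have hb1 : f b₁ < 0 := by
    by_contra! h
    linarith [os_pos_left P.o₁ h2 h]
  have hb2 := os_pos_left P.o₃ h2 h3.ge
  have hx3 : f x₃ < 0 := by
    by_contra! h
    linarith [os_pos_left P.o₄ hb2 h]
  exact ⟨f, hf, h1, h3, os_zero P.oa h1 h3, h2, hb2, os_ext_neg P.o₂ h1.ge hb1, hx3, hb1⟩

/-- Signs with respect to the second segment. -/
theorem signs_b
    (P : Δ.CrossPair σ₀ σ₁ a b x₁ x₂ x₃ a₁ a₂ b₁ b₂ c)
    : ∃ f, Δ.Rep b f ∧ f b₁ = 0 ∧ f b₂ = 0 ∧ f c = 0 ∧ 0 < f x₂ ∧ 0 < f a₁ ∧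
    f x₁ < 0 ∧ f x₃ < 0 ∧ f a₂ < 0 := by
  obtain ⟨f, h1, h2, h3, h4, h5, h6, h7, h8, h9⟩ := P.reflect.signs_a
  exact ⟨f, h1, h3, h2, h4, h5, h6, h8, h7, h9⟩

theorem a₁_mem (P : Δ.CrossPair σ₀ σ₁ a b x₁ x₂ x₃ a₁ a₂ b₁ b₂ c) : a₁ ∈ openSegment ℝ x₂ x₁ := by
  obtain ⟨f, hf, -, -, -, h1, -, h2, -⟩ := P.signs_a
  exact os_of_sep P.hσ₀ P.ha P.x₂σ₀ P.x₁σ P.a₁σ P.a₁a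
      (by rw [hf.mul]; exact mul_neg_of_pos_of_neg h1 h2)

theorem a₂_mem (P : Δ.CrossPair σ₀ σ₁ a b x₁ x₂ x₃ a₁ a₂ b₁ b₂ c) : a₂ ∈ openSegment ℝ x₂ x₃ := by
  obtain ⟨f, hf, -, -, -, h1, -, -, h2, -⟩ := P.signs_a
  exact os_of_sep P.hσ₁ P.ha P.x₂σ₁ P.x₃σ P.a₂σ P.a₂a
      (by rw [hf.mul]; exact mul_neg_of_pos_of_neg h1 h2)

theorem b₂_mem
    (P : Δ.CrossPair σ₀ σ₁ a b x₁ x₂ x₃ a₁ a₂ b₁ b₂ c)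
    : b₂ ∈ openSegment ℝ x₂ x₃ := P.reflect.a₁_mem

/-- Signs with respect to the first side. -/
theorem signs_σ₀
    (P : Δ.CrossPair σ₀ σ₁ a b x₁ x₂ x₃ a₁ a₂ b₁ b₂ c)
    : ∃ f, Δ.Rep σ₀ f ∧ f x₁ = 0 ∧ f x₂ = 0 ∧ f a₁ = 0 ∧ f b₁ = 0 ∧ 0 < f c ∧
    0 < f a₂ ∧ 0 < f b₂ ∧ 0 < f x₃ := by
  have hx : x₃ ≠ x₂ := by
    obtain ⟨f, -, -, -, -, h1, -, -, h2, -⟩ := P.signs_a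
    rintro rfl; linarith
  obtain ⟨f, hf, h3⟩ := exists_rep_pos P.hσ₀
    (fn_ne_of_ne P.hσ₁ P.hσ₀ P.hσ.symm P.x₂σ₁ P.x₂σ₀ P.x₃σ hx)
  have h2 := hf.zero P.x₂σ₀
  have ha := hf.zero P.a₁σ
  have ha2 := os_pos_right P.a₂_mem h2.ge h3
  exact ⟨f, hf, hf.zero P.x₁σ, h2, ha, hf.zero P.b₁σ, os_pos_right P.oa ha.ge ha2,
    ha2, os_pos_right P.b₂_mem h2.ge h3, h3⟩

/-- Signs with respect to the second side. -/
theorem signs_σ₁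
    (P : Δ.CrossPair σ₀ σ₁ a b x₁ x₂ x₃ a₁ a₂ b₁ b₂ c)
    : ∃ f, Δ.Rep σ₁ f ∧ f x₃ = 0 ∧ f x₂ = 0 ∧ f a₂ = 0 ∧ f b₂ = 0 ∧ 0 < f c ∧
    0 < f a₁ ∧ 0 < f b₁ ∧ 0 < f x₁ := by
  obtain ⟨f, h1, h2, h3, h4, h5, h6, h7, h8, h9⟩ := P.reflect.signs_σ₀
  exact ⟨f, h1, h2, h3, h5, h4, h6, h8, h7, h9⟩

theorem x₁_tri
    (P : Δ.CrossPair σ₀ σ₁ a b x₁ x₂ x₃ a₁ a₂ b₁ b₂ c) : x₁ ∈ Δ.tri := sub_tri P.hσ₀ P.x₁σ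
theorem x₃_tri
    (P : Δ.CrossPair σ₀ σ₁ a b x₁ x₂ x₃ a₁ a₂ b₁ b₂ c) : x₃ ∈ Δ.tri := sub_tri P.hσ₁ P.x₃σ
theorem a₁_tri
    (P : Δ.CrossPair σ₀ σ₁ a b x₁ x₂ x₃ a₁ a₂ b₁ b₂ c) : a₁ ∈ Δ.tri := sub_tri P.hσ₀ P.a₁σ
theorem a₂_tri
    (P : Δ.CrossPair σ₀ σ₁ a b x₁ x₂ x₃ a₁ a₂ b₁ b₂ c) : a₂ ∈ Δ.tri := sub_tri P.hσ₁ P.a₂σ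
theorem b₂_tri
    (P : Δ.CrossPair σ₀ σ₁ a b x₁ x₂ x₃ a₁ a₂ b₁ b₂ c) : b₂ ∈ Δ.tri := sub_tri P.hσ₁ P.b₂σ
theorem ca
    (P : Δ.CrossPair σ₀ σ₁ a b x₁ x₂ x₃ a₁ a₂ b₁ b₂ c) : c ∈ a := os_mem P.ha P.a₁a P.a₂a P.oa
theorem cb
    (P : Δ.CrossPair σ₀ σ₁ a b x₁ x₂ x₃ a₁ a₂ b₁ b₂ c) : c ∈ b := os_mem P.hb P.b₁b P.b₂b P.ob
theorem c_tri (P : Δ.CrossPair σ₀ σ₁ a b x₁ x₂ x₃ a₁ a₂ b₁ b₂ c) : c ∈ Δ.tri := sub_tri P.ha P.ca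

theorem pa (P : Δ.CrossPair σ₀ σ₁ a b x₁ x₂ x₃ a₁ a₂ b₁ b₂ c) : Δ.Proper a := by
  obtain ⟨f, hf, -, -, -, h1, -, h2, -⟩ := P.signs_a
  exact proper_of_sep P.ha P.x₂_tri P.x₁_tri
      (by rw [hf.mul]; exact mul_neg_of_pos_of_neg h1 h2)

theorem pb (P : Δ.CrossPair σ₀ σ₁ a b x₁ x₂ x₃ a₁ a₂ b₁ b₂ c) : Δ.Proper b := P.reflect.pa

theorem a_ne_σ₀
    (P : Δ.CrossPair σ₀ σ₁ a b x₁ x₂ x₃ a₁ a₂ b₁ b₂ c) : a ≠ σ₀ := fun h => P.x₂a (h ▸ P.x₂σ₀)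
theorem a_ne_σ₁
    (P : Δ.CrossPair σ₀ σ₁ a b x₁ x₂ x₃ a₁ a₂ b₁ b₂ c) : a ≠ σ₁ := fun h => P.x₂a (h ▸ P.x₂σ₁)
theorem b_ne_σ₀
    (P : Δ.CrossPair σ₀ σ₁ a b x₁ x₂ x₃ a₁ a₂ b₁ b₂ c) : b ≠ σ₀ := fun h => P.x₂b (h ▸ P.x₂σ₀)
theorem b_ne_σ₁
    (P : Δ.CrossPair σ₀ σ₁ a b x₁ x₂ x₃ a₁ a₂ b₁ b₂ c) : b ≠ σ₁ := fun h => P.x₂b (h ▸ P.x₂σ₁)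

theorem a_ne_b (P : Δ.CrossPair σ₀ σ₁ a b x₁ x₂ x₃ a₁ a₂ b₁ b₂ c) : a ≠ b := by
  obtain ⟨f, hf, -, -, -, -, h1, -⟩ := P.signs_b
  intro h
  have := hf.zero (h ▸ P.a₁a)
  linarith

end CrossPair

variable (Δ) in
/-- Two initial segments `g`, `g'` cutting off the corner `x₂` between `σ₀` and `σ₁`, crossing at
`z` inside the corner. -/
structure Crossing (σ₀ σ₁ g g' : Set Pt) (x₁ x₂ x₃ z : Pt) : Prop where
  hσ₀ : σ₀ ∈ Δ.Sbar
  hσ₁ : σ₁ ∈ Δ.Sbar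
  hσ : σ₀ ≠ σ₁
  x₁σ : x₁ ∈ σ₀
  x₂σ₀ : x₂ ∈ σ₀
  x₂σ₁ : x₂ ∈ σ₁
  x₃σ : x₃ ∈ σ₁
  hg : g ∈ Δ.Sbar
  hg' : g' ∈ Δ.Sbar
  hgg : g ≠ g'
  g₁ : Δ.fn g x₂ * Δ.fn g x₁ < 0
  g₃ : Δ.fn g x₂ * Δ.fn g x₃ < 0
  g'₁ : Δ.fn g' x₂ * Δ.fn g' x₁ < 0
  g'₃ : Δ.fn g' x₂ * Δ.fn g' x₃ < 0
  zg : z ∈ g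
  zg' : z ∈ g'
  sec : Δ.InSec σ₀ σ₁ x₁ x₃ z

namespace Crossing

variable {σ₀ σ₁ g g' : Set Pt} {x₁ x₂ x₃ z : Pt}

theorem swap (C : Δ.Crossing σ₀ σ₁ g g' x₁ x₂ x₃ z) : Δ.Crossing σ₀ σ₁ g' g x₁ x₂ x₃ z :=
  ⟨C.hσ₀, C.hσ₁, C.hσ, C.x₁σ, C.x₂σ₀, C.x₂σ₁, C.x₃σ, C.hg', C.hg, C.hgg.symm, C.g'₁, C.g'₃, C.g₁,
    C.g₃, C.zg', C.zg, C.sec⟩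

theorem mem_os (C : Δ.Crossing σ₀ σ₁ g g' x₁ x₂ x₃ z) {a₁ a₂ : Pt} (h₁ : a₁ ∈ σ₀) (h₂ : a₂ ∈ σ₁)
    (k₁ : a₁ ∈ g) (k₂ : a₂ ∈ g) : z ∈ openSegment ℝ a₁ a₂ := by
  have o₁ := os_of_sep C.hσ₀ C.hg C.x₂σ₀ C.x₁σ h₁ k₁ C.g₁
  have o₂ := os_of_sep C.hσ₁ C.hg C.x₂σ₁ C.x₃σ h₂ k₂ C.g₃
  have e₁ := C.sec.1
  have e₂ := C.sec.2
  refine os_of_between (fn_ne' (Or.inl C.hg)) (fn_zero C.hg k₁) (fn_zero C.hg k₂)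
    (fn_zero C.hg C.zg) (fn_zero C.hσ₀ h₁) (fn_zero C.hσ₁ h₂) ?_ ?_
  · exact pos_pos_trans e₁ (by
      rw [mul_comm]
      exact os_same_of_zero_left o₂ (fn_zero C.hσ₀ C.x₂σ₀) (by rintro h; simp [h] at e₁))
  · exact pos_pos_trans e₂ (by
      rw [mul_comm]
      exact os_same_of_zero_left o₁ (fn_zero C.hσ₁ C.x₂σ₁) (by rintro h; simp [h] at e₂))

theorem pair_of_lt (C : Δ.Crossing σ₀ σ₁ g g' x₁ x₂ x₃ z) {a₁ : Pt}
    (o : a₁ ∈ openSegment ℝ x₂ x₁) (k₁ : a₁ ∈ g) (h : 0 < Δ.fn g' a₁ * Δ.fn g' x₂) :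
    ∃ a₁ a₂ b₁ b₂, Δ.CrossPair σ₀ σ₁ g g' x₁ x₂ x₃ a₁ a₂ b₁ b₂ z := by
  have h₁ := os_mem C.hσ₀ C.x₂σ₀ C.x₁σ o
  have mem : ∀ {s m : Set Pt} {p q r : Pt}, s ∈ Δ.Sbar → m ∈ Δ.Sbar → p ∈ m → q ∈ m →
      r ∈ openSegment ℝ p q → Δ.fn s r = 0 → r ∈ m ∧ r ∈ s := fun hs hm hp hq hr h0 =>
    ⟨os_mem hm hp hq hr, (mem_iff hs (sub_tri hm (os_mem hm hp hq hr))).mpr h0⟩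
  obtain ⟨b₁, p₁, z₁⟩ := os_exists_zero
      (pos_neg_trans h (by linarith [C.g'₁] : Δ.fn g' x₁ * Δ.fn g' x₂ < 0))
  obtain ⟨mb₁, nb₁⟩ := mem C.hg' C.hσ₀ h₁ C.x₁σ p₁ z₁
  obtain ⟨a₂, p₂, z₂⟩ := os_exists_zero C.g₃
  obtain ⟨ma₂, na₂⟩ := mem C.hg C.hσ₁ C.x₂σ₁ C.x₃σ p₂ z₂
  have oa := C.mem_os h₁ ma₂ k₁ na₂
  have s2 : Δ.fn g' a₁ * Δ.fn g' a₂ < 0 :=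
    os_sep oa (fn_zero C.hg' C.zg') (by rintro h0; simp [h0] at h)
  have s3 : Δ.fn g' x₂ * Δ.fn g' a₂ < 0 :=
      pos_neg_trans (by linarith : 0 < Δ.fn g' x₂ * Δ.fn g' a₁) (by linarith)
  obtain ⟨b₂, p₃, z₃⟩ := os_exists_zero s3
  obtain ⟨mb₂, nb₂⟩ := mem C.hg' C.hσ₁ C.x₂σ₁ ma₂ p₃ z₃
  have ob := C.swap.mem_os mb₁ mb₂ nb₁ nb₂
  have zg' := fn_zero C.hg' nb₂
  refine ⟨a₁, a₂, b₁, b₂, C.hσ₀, C.hσ₁, C.hσ, C.x₁σ, C.x₂σ₀, C.x₂σ₁, C.x₃σ, C.hg, C.hg', k₁, na₂,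
    nb₁, nb₂, h₁, ma₂, mb₁, mb₂, ?_, ?_, ?_, p₁, p₃, ?_, oa, ob⟩
  · intro h
    have := C.g₁
    rw [fn_zero C.hg h] at this
    simp at this
  · intro h
    have := C.g'₁
    rw [fn_zero C.hg' h] at this
    simp at this
  · have := os_same_of_zero_left p₁ (fn_zero C.hg k₁) (ne_zero_of_mul_neg C.g₁).2
    exact os_of_sep C.hσ₀ C.hg C.x₂σ₀ mb₁ h₁ k₁
      (neg_pos_trans C.g₁ (by linarith))
  · have := os_same_of_zero_right p₃ (fn_zero C.hg na₂) (ne_zero_of_mul_neg C.g₃).1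
    exact os_of_sep C.hσ₁ C.hg mb₂ C.x₃σ ma₂ na₂
      (pos_neg_trans (by linarith : 0 < Δ.fn g b₂ * Δ.fn g x₂) (by linarith [C.g₃]))

theorem exists_pair (C : Δ.Crossing σ₀ σ₁ g g' x₁ x₂ x₃ z) :
    ∃ a b, ((a = g ∧ b = g') ∨ (a = g' ∧ b = g)) ∧
      ∃ a₁ a₂ b₁ b₂, Δ.CrossPair σ₀ σ₁ a b x₁ x₂ x₃ a₁ a₂ b₁ b₂ z := by
  have pt : ∀ {s : Set Pt}, s ∈ Δ.Sbar → Δ.fn s x₂ * Δ.fn s x₁ < 0 →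
      ∃ r ∈ openSegment ℝ x₂ x₁, r ∈ s ∧ r ∈ σ₀ ∧ s ≠ σ₀ := fun hs h => by
    obtain ⟨r, o, h0⟩ := os_exists_zero h
    have hr := os_mem C.hσ₀ C.x₂σ₀ C.x₁σ o
    refine ⟨r, o, (mem_iff hs (sub_tri C.hσ₀ hr)).mpr h0, hr, ?_⟩
    rintro rfl
    exact (ne_zero_of_mul_neg h).1 (fn_zero hs C.x₂σ₀)
  obtain ⟨a₁, o, k, l, ne⟩ := pt C.hg C.g₁
  obtain ⟨b₁, o', k', l', ne'⟩ := pt C.hg' C.g'₁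
  have hne : Δ.fn g' a₁ ≠ 0 := fn_ne_zero C.hg' (sub_tri C.hσ₀ l) fun h => by
    rcases three C.hg C.hσ₀ C.hg' ne k l h with e | e
    · exact C.hgg e.symm
    · exact ne' e
  rcases lt_or_gt_of_ne (mul_ne_zero hne (ne_zero_of_mul_neg C.g'₁).1) with h | h
  · obtain ⟨r, q, h0⟩ := os_exists_zero h
    have hr := os_mem C.hσ₀ l C.x₂σ₀ q
    have e := inter_eq C.hσ₀ C.hg' ne'.symm hr ((mem_iff C.hg' (sub_tri C.hσ₀ hr)).mpr h0) l' k'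
    subst e
    have := os_same_of_zero_left q (fn_zero C.hg k) (ne_zero_of_mul_neg C.g₁).1
    exact ⟨g', g, Or.inr ⟨rfl, rfl⟩, C.swap.pair_of_lt o' k' (by linarith)⟩
  · exact ⟨g, g', Or.inl ⟨rfl, rfl⟩, C.pair_of_lt o k h⟩

end Crossing

/-! Counting segments that cut a triangle or separate two points. -/

variable (Δ) in
/-- The initial segments strictly separating two of three given points. -/
def cutting (x y z : Pt) : Set (Set Pt) :=
  {s ∈ Δ.Sbar | ¬ (0 ≤ Δ.fn s x ∧ 0 ≤ Δ.fn s y ∧ 0 ≤ Δ.fn s z) ∧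
    ¬ (Δ.fn s x ≤ 0 ∧ Δ.fn s y ≤ 0 ∧ Δ.fn s z ≤ 0)}

variable (Δ) in
/-- The initial segments strictly separating two given points. -/
def separating (x y : Pt) : Set (Set Pt) := {s ∈ Δ.Sbar | Δ.fn s x * Δ.fn s y < 0}

theorem cutting_swap (x y z : Pt) : Δ.cutting z y x = Δ.cutting x y z := by
  ext s; simp only [cutting, mem_ofPred_eq]; tauto

theorem cutting_ncard_lt {x y z p q r : Pt} {s : Set Pt} (hs : s ∈ Δ.Sbar)
    (h : ∀ f : Pt →ᵃ[ℝ] ℝ, 0 ≤ f x → 0 ≤ f y → 0 ≤ f z → 0 ≤ f p ∧ 0 ≤ f q ∧ 0 ≤ f r)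
    (hc : Δ.fn s x * Δ.fn s y < 0)
    (hp : p ∈ s) (hq : q ∈ s) :
    (Δ.cutting p q r).ncard < (Δ.cutting x y z).ncard := by
  refine ncard_lt_ncard ⟨fun t ht => ⟨ht.1, fun e => ht.2.1 (h _ e.1 e.2.1 e.2.2), fun e =>
    ht.2.2 ?_⟩, fun hsub => ?_⟩ (Δ.finSbar.subset fun _ h => h.1)
  · have := h (-Δ.fn t) (by simpa using e.1) (by simpa using e.2.1) (by simpa using e.2.2)
    simpa using this
  · have := (hsub (a := s) ⟨hs, fun e => by nlinarith [e.1, e.2.1], fun e => by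
      nlinarith [e.1, e.2.1]⟩).2
    rw [fn_zero hs hp, fn_zero hs hq] at this
    rcases le_total 0 (Δ.fn s r) with h0 | h0 <;> simp [h0] at this

theorem separating_subset {x p q : Pt} (h : p ∈ openSegment ℝ x q) :
    Δ.separating x p ⊆ Δ.separating x q := fun t ht => ⟨ht.1, by
  obtain ⟨α, β, hα, hβ, -, e⟩ := os_comb h
  have := ht.2
  rw [e] at this
  by_contra! hn
  nlinarith [mul_self_nonneg (Δ.fn t x)]⟩

theorem separating_ncard_lt {x p q : Pt} {s : Set Pt} (hs : s ∈ Δ.Sbar)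
    (h : p ∈ openSegment ℝ x q) (hp : p ∈ s) (hc : Δ.fn s x * Δ.fn s q < 0) :
    (Δ.separating x p).ncard < (Δ.separating x q).ncard := by
  refine ncard_lt_ncard ⟨separating_subset h, fun hsub => ?_⟩ (Δ.finSbar.subset fun _ h => h.1)
  have := (hsub (a := s) ⟨hs, hc⟩).2
  rw [fn_zero hs hp] at this
  simp at this

theorem separating_ncard_le {x p q : Pt} (h : p ∈ openSegment ℝ x q) :
    (Δ.separating x p).ncard ≤ (Δ.separating x q).ncard :=
  ncard_le_ncard (separating_subset h) (Δ.finSbar.subset fun _ h => h.1)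

end TBA

namespace TBA
variable {Δ : TBA}

variable (Δ) in
/-- Every corner cut by fewer than `n` segments in which two segments cross is bounded by edges of
the triangle. -/
def CornersEdges (n : ℕ) : Prop :=
  ∀ {σ₀ σ₁ a b : Set Pt} {x₁ x₂ x₃ a₁ a₂ b₁ b₂ c : Pt},
    Δ.CrossPair σ₀ σ₁ a b x₁ x₂ x₃ a₁ a₂ b₁ b₂ c → (Δ.cutting x₁ x₂ x₃).ncard < n →
    σ₀ ∈ triEdges Δ.x1 Δ.x2 Δ.x3 ∧ σ₁ ∈ triEdges Δ.x1 Δ.x2 Δ.x3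

theorem CornersEdges.of_crossing {n : ℕ} (h : Δ.CornersEdges n) {σ₀ σ₁ g g' : Set Pt}
    {x₁ x₂ x₃ z : Pt} (C : Δ.Crossing σ₀ σ₁ g g' x₁ x₂ x₃ z)
    (hn : (Δ.cutting x₁ x₂ x₃).ncard < n) :
    σ₀ ∈ triEdges Δ.x1 Δ.x2 Δ.x3 ∧ σ₁ ∈ triEdges Δ.x1 Δ.x2 Δ.x3 := by
  obtain ⟨a, b, -, a₁, a₂, b₁, b₂, P⟩ := C.exists_pair
  exact h P hn

theorem Rep.mul_neg {s : Set Pt} {f : Pt →ᵃ[ℝ] ℝ} (h : Δ.Rep s f) {p q : Pt} (hp : 0 < f p)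
    (hq : f q < 0) : Δ.fn s p * Δ.fn s q < 0 := by
  rw [h.mul]; exact mul_neg_of_pos_of_neg hp hq

theorem Rep.mul_neg' {s : Set Pt} {f : Pt →ᵃ[ℝ] ℝ} (h : Δ.Rep s f) {p q : Pt} (hp : f p < 0)
    (hq : 0 < f q) : Δ.fn s p * Δ.fn s q < 0 := by
  rw [h.mul]; exact mul_neg_of_neg_of_pos hp hq

theorem Rep.mul_pos {s : Set Pt} {f : Pt →ᵃ[ℝ] ℝ} (h : Δ.Rep s f) {p q : Pt} (hp : 0 < f p)
    (hq : 0 < f q) : 0 < Δ.fn s p * Δ.fn s q := by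
  rw [h.mul]; exact _root_.mul_pos hp hq

namespace CrossPair

variable {σ₀ σ₁ a b d : Set Pt} {x₁ x₂ x₃ a₁ a₂ b₁ b₂ c : Pt} {n : ℕ}

/-- No segment crosses `b` between `c` and `b₂` while cutting off `a₂` in the triangle
`a₁a₂x₂`. -/
theorem not_cut_off
    (P : Δ.CrossPair σ₀ σ₁ a b x₁ x₂ x₃ a₁ a₂ b₁ b₂ c)
    (hN : Δ.CornersEdges n) (hn : (Δ.cutting x₁ x₂ x₃).ncard ≤ n)
    (hd : d ∈ Δ.Sbar) (h₁ : Δ.fn d a₂ * Δ.fn d a₁ < 0) (h₂ : Δ.fn d a₂ * Δ.fn d x₂ < 0)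
    (h₃ : Δ.fn d c * Δ.fn d b₂ < 0) : False := by
  obtain ⟨z, oz, h0⟩ := os_exists_zero h₃
  have zb := os_mem P.hb P.cb P.b₂b oz
  have zt := sub_tri P.hb zb
  obtain ⟨fa, ra, aa₁, aa₂, ac, ax₂, ab₂, ax₁, -⟩ := P.signs_a
  obtain ⟨fb, rb, -, -, -, bx₂, ba₁, -, -, ba₂⟩ := P.signs_b
  obtain ⟨f1, r1, -, -, -, f1b₂, f1c, f1a₁, -⟩ := P.signs_σ₁
  have C : Δ.Crossing a σ₁ b d a₁ a₂ x₂ z :=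
    { hσ₀ := P.ha, hσ₁ := P.hσ₁, hσ := P.a_ne_σ₁, x₁σ := P.a₁a, x₂σ₀ := P.a₂a, x₂σ₁ := P.a₂σ
      x₃σ := P.x₂σ₁, hg := P.hb, hg' := hd
      hgg := by rintro rfl; exact (ne_zero_of_mul_neg h₃).1 (fn_zero hd P.cb)
      g₁ := rb.mul_neg' ba₂ ba₁, g₃ := rb.mul_neg' ba₂ bx₂, g'₁ := h₁, g'₃ := h₂, zg := zb
      zg' := (mem_iff hd zt).mpr h0
      sec := ⟨ra.mul_pos (os_pos_right oz ac.ge ab₂) ax₂,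
        r1.mul_pos (os_pos_left oz f1c f1b₂.ge) f1a₁⟩ }
  refine P.pa.2 (hN.of_crossing C (lt_of_lt_of_le (cutting_ncard_lt P.ha (fun f h1 h2 h3 =>
    ⟨os_nonneg P.a₁_mem h2 h1, os_nonneg P.a₂_mem h2 h3, h2⟩)
      (ra.mul_neg' ax₁ ax₂) P.a₁a P.a₂a) hn)).1

/-- No segment separates `x₂` and `x₃` from `c`, `a₁`. -/
theorem not_cut_side
    (P : Δ.CrossPair σ₀ σ₁ a b x₁ x₂ x₃ a₁ a₂ b₁ b₂ c)
    (hN : Δ.CornersEdges n) (hn : (Δ.cutting x₁ x₂ x₃).ncard ≤ n) {f : Pt →ᵃ[ℝ] ℝ}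
    (hf : Δ.Rep d f) (h₁ : f x₂ < 0) (h₂ : 0 < f a₁) (h₃ : f x₃ ≤ 0) (h₄ : 0 < f c) : False := by
  have hx₁ := os_ext_pos P.a₁_mem h₁.le h₂
  obtain ⟨fa, ra, aa₁, aa₂, ac, ax₂, ab₂, ax₁, ax₃, -⟩ := P.signs_a
  obtain ⟨fb, rb, -, -, bc, bx₂, ba₁, bx₁, bx₃, ba₂⟩ := P.signs_b
  obtain ⟨f0, r0, s0x₁, -, -, -, s0c, -, -, s0x₃⟩ := P.signs_σ₀
  obtain ⟨d₀, o₀, z₀⟩ := os_exists_zero (mul_neg_of_neg_of_pos h₁ h₂)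
  have d₀σ := os_mem P.hσ₀ P.x₂σ₀ P.a₁σ o₀
  have d₀d := (hf.iff d₀ (sub_tri P.hσ₀ d₀σ)).mpr z₀
  obtain ⟨e, ed, en, e₁, e₂⟩ : ∃ e ∈ d, (∀ g : Pt →ᵃ[ℝ] ℝ, 0 ≤ g x₁ → 0 ≤ g x₃ → 0 ≤ g e) ∧
      (∀ g : Pt →ᵃ[ℝ] ℝ, g x₁ < 0 → g x₃ < 0 → g e < 0) ∧ 0 < f0 e := by
    rcases h₃.lt_or_eq with h | h
    · obtain ⟨e, oe, ze⟩ := os_exists_zero (mul_neg_of_pos_of_neg hx₁ h)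
      exact ⟨e, (hf.iff e (tri_of_os P.x₁_tri P.x₃_tri oe)).mpr ze, fun g => os_nonneg oe,
        fun g h h' => os_neg_left oe h h'.le, os_pos_right oe s0x₁.ge s0x₃⟩
    · exact ⟨x₃, (hf.iff x₃ P.x₃_tri).mpr h, fun g _ h => h, fun g _ h => h, s0x₃⟩
  have C : Δ.Crossing σ₀ d a b x₁ d₀ e c :=
    { hσ₀ := P.hσ₀, hσ₁ := hf.mem
      hσ := by rintro rfl; exact h₁.ne (hf.zero P.x₂σ₀)
      x₁σ := P.x₁σ, x₂σ₀ := d₀σ, x₂σ₁ := d₀d, x₃σ := ed, hg := P.ha, hg' := P.hb, hgg := P.a_ne_b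
      g₁ := ra.mul_neg (os_pos_left o₀ ax₂ aa₁.ge) ax₁
      g₃ := ra.mul_neg (os_pos_left o₀ ax₂ aa₁.ge) (e₁ _ ax₁ ax₃)
      g'₁ := rb.mul_neg (os_pos_left o₀ bx₂ ba₁.le) bx₁
      g'₃ := rb.mul_neg (os_pos_left o₀ bx₂ ba₁.le) (e₁ _ bx₁ bx₃)
      zg := P.ca, zg' := P.cb, sec := ⟨r0.mul_pos s0c e₂, hf.mul_pos h₄ hx₁⟩ }
  refine (proper_of_sep hf.mem P.x₂_tri P.a₁_tri (hf.mul_neg' h₁ h₂)).2 (hN.of_crossing C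
    (lt_of_lt_of_le ?_ hn)).2
  rw [← cutting_swap]
  exact cutting_ncard_lt hf.mem (fun g k₁ k₂ k₃ => ⟨en g k₁ k₃, os_nonneg o₀ k₂
    (os_nonneg P.a₁_mem k₂ k₁), k₁⟩) (hf.mul_neg hx₁ h₁) ed d₀d

/-- A segment separating `x₂` from `x₁`, `x₃` and crossing `b` between `c` and `b₂` forms with `b` a
pair that is closer to `x₂`. -/
theorem exists_closer
    (P : Δ.CrossPair σ₀ σ₁ a b x₁ x₂ x₃ a₁ a₂ b₁ b₂ c)
    {f : Pt →ᵃ[ℝ] ℝ} (hf : Δ.Rep d f) (h₁ : f x₂ < 0) (h₂ : 0 < f a₁)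
    (h₃ : 0 < f x₃) (h₄ : 0 < f c) (h₅ : f b₂ < 0) :
    ∃ d₁ d₂ c', Δ.CrossPair σ₀ σ₁ d b x₁ x₂ x₃ d₁ d₂ b₁ b₂ c' ∧ ¬ Δ.NoSep d₁ b₁ ∧
      (Δ.separating x₂ d₁).ncard < (Δ.separating x₂ a₁).ncard := by
  have hx₁ := os_ext_pos P.a₁_mem h₁.le h₂
  obtain ⟨fa, ra, aa₁, aa₂, ac, ax₂, ab₂, ax₁, ax₃, ab₁⟩ := P.signs_a
  obtain ⟨d₁, o₁, z₁⟩ := os_exists_zero (mul_neg_of_neg_of_pos h₁ h₂)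
  obtain ⟨d₂, o₂, z₂⟩ := os_exists_zero (mul_neg_of_neg_of_pos h₅ h₃)
  obtain ⟨z, o, z₀⟩ := os_exists_zero (mul_neg_of_pos_of_neg h₄ h₅)
  have m₁ := os_mem P.hσ₀ P.x₂σ₀ P.a₁σ o₁
  have m₂ := os_mem P.hσ₁ P.b₂σ P.x₃σ o₂
  have m := os_mem P.hb P.cb P.b₂b o
  have k₁ := (hf.iff _ (sub_tri P.hσ₀ m₁)).mpr z₁
  have k₂ := (hf.iff _ (sub_tri P.hσ₁ m₂)).mpr z₂
  have k := (hf.iff _ (sub_tri P.hb m)).mpr z₀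
  obtain ⟨fb, rb, bb₁, bb₂, bc, bx₂, ba₁, bx₁, bx₃, ba₂⟩ := P.signs_b
  obtain ⟨f0, r0, -, -, -, -, s0c, -, s0b₂, s0x₃⟩ := P.signs_σ₀
  obtain ⟨f1, r1, -, -, -, s1b₂, s1c, -, -, s1x₁⟩ := P.signs_σ₁
  have bd₁ := os_pos_left o₁ bx₂ ba₁.le
  have C : Δ.Crossing σ₀ σ₁ d b x₁ x₂ x₃ z :=
    { hσ₀ := P.hσ₀, hσ₁ := P.hσ₁, hσ := P.hσ, x₁σ := P.x₁σ, x₂σ₀ := P.x₂σ₀, x₂σ₁ := P.x₂σ₁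
      x₃σ := P.x₃σ, hg := hf.mem, hg' := P.hb
      hgg := by rintro rfl; exact h₄.ne' (hf.zero P.cb)
      g₁ := hf.mul_neg' h₁ hx₁, g₃ := hf.mul_neg' h₁ h₃, g'₁ := rb.mul_neg bx₂ bx₁
      g'₃ := rb.mul_neg bx₂ bx₃, zg := k, zg' := m
      sec := ⟨r0.mul_pos (os_pos_left o s0c s0b₂.le) s0x₃,
        r1.mul_pos (os_pos_left o s1c s1b₂.ge) s1x₁⟩ }
  have Q : Δ.CrossPair σ₀ σ₁ d b x₁ x₂ x₃ d₁ d₂ b₁ b₂ z :=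
    { P with
      ha := hf.mem, a₁a := k₁, a₂a := k₂, a₁σ := m₁, a₂σ := m₂
      x₂a := fun h => h₁.ne (hf.zero h)
      o₁ := os_of_sep P.hσ₀ hf.mem P.x₂σ₀ P.b₁σ m₁ k₁ (hf.mul_neg' h₁ (os_pos_left P.o₂ h₂ hx₁.le))
      o₂ := os_of_sep P.hσ₀ P.hb m₁ P.x₁σ P.b₁σ P.b₁b (rb.mul_neg bd₁ bx₁)
      o₃ := os_of_sep P.hσ₁ P.hb P.x₂σ₁ m₂ P.b₂σ P.b₂b
        (rb.mul_neg bx₂ (os_neg_right o₂ bb₂.le bx₃))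
      o₄ := o₂
      oa := C.mem_os m₁ m₂ k₁ k₂
      ob := C.swap.mem_os P.b₁σ P.b₂σ P.b₁b P.b₂b }
  exact ⟨d₁, d₂, z, Q, fun h => absurd (h a P.ha)
    (not_le.mpr (ra.mul_neg (os_pos_left o₁ ax₂ aa₁.ge) ab₁)),
    separating_ncard_lt hf.mem o₁ k₁ (hf.mul_neg' h₁ h₂)⟩

theorem noSep_c_b₂
    (P : Δ.CrossPair σ₀ σ₁ a b x₁ x₂ x₃ a₁ a₂ b₁ b₂ c)
    (hN : Δ.CornersEdges n) (hn : (Δ.cutting x₁ x₂ x₃).ncard ≤ n)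
    (ih : ∀ {d : Set Pt} {d₁ d₂ c' : Pt}, Δ.CrossPair σ₀ σ₁ d b x₁ x₂ x₃ d₁ d₂ b₁ b₂ c' →
      (Δ.separating x₂ d₁).ncard < (Δ.separating x₂ a₁).ncard → Δ.NoSep d₁ b₁) :
    Δ.NoSep c b₂ := by
  intro d hd
  by_contra! h
  obtain ⟨f, hf, hc⟩ := exists_rep_pos hd (ne_zero_of_mul_neg h).1
  have hb₂ := hf.neg h hc
  have hb₁ : 0 < f b₁ := os_ext_pos (os_symm P.ob) hb₂.le hc
  have hda : d ≠ a := by rintro rfl; exact hc.ne' (hf.zero P.ca)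
  have nz : ∀ {p : Pt} {m : Set Pt}, m ∈ Δ.Sbar → a ≠ m → p ∈ a → p ∈ m → d ≠ m → f p ≠ 0 :=
    fun hm hne h1 h2 hdm h0 => by
      rcases three P.ha hm hd hne h1 h2 ((hf.iff _ (sub_tri P.ha h1)).mpr h0) with e | e
      exacts [hda e, hdm e]
  have hdσ₁ : d ≠ σ₁ := by rintro rfl; exact hb₂.ne (hf.zero P.b₂σ)
  have hdσ₀ : d ≠ σ₀ := by
    rintro rfl
    have h0 := hf.zero P.x₂σ₀
    have := os_pos_right P.oa (hf.zero P.a₁σ).ge (os_ext_pos (f := f) P.oa (hf.zero P.a₁σ).le hc)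
    linarith [os_pos_right P.o₃ h0.ge (os_ext_pos (f := f) P.oa (hf.zero P.a₁σ).le hc)]
  have na₁ := nz P.hσ₀ P.a_ne_σ₀ P.a₁a P.a₁σ hdσ₀
  have na₂ := nz P.hσ₁ P.a_ne_σ₁ P.a₂a P.a₂σ hdσ₁
  have closer : f x₂ < 0 → 0 < f a₁ → False := fun h₁ h₂ => by
    rcases le_or_gt (f x₃) 0 with h₃ | h₃
    · exact P.not_cut_side hN hn hf h₁ h₂ h₃ hc
    · obtain ⟨d₁, d₂, c', Q, hq, hlt⟩ := P.exists_closer hf h₁ h₂ h₃ hc hb₂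
      exact hq (ih Q hlt)
  rcases lt_or_gt_of_ne na₂ with h₂ | h₂
  · have ha₁ : 0 < f a₁ := os_ext_pos (os_symm P.oa) h₂.le hc
    rcases lt_trichotomy (f x₂) 0 with h₀ | h₀ | h₀
    · exact closer h₀ ha₁
    · rcases three P.hσ₀ P.hσ₁ hd P.hσ P.x₂σ₀ P.x₂σ₁ ((hf.iff _ P.x₂_tri).mpr h₀) with e | e
      exacts [hdσ₀ e, hdσ₁ e]
    · exact P.not_cut_off hN hn hd (hf.mul_neg' h₂ ha₁) (hf.mul_neg' h₂ h₀) h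
  · have hx₂ : f x₂ < 0 := os_ext_neg (os_symm P.o₃) h₂.le hb₂
    rcases lt_or_gt_of_ne na₁ with ha₁ | ha₁
    · exact P.not_cut_off hN hn hd (hf.mul_neg h₂ ha₁) (hf.mul_neg h₂ hx₂) h
    · exact closer hx₂ ha₁

end CrossPair
end TBA

namespace TBA
variable {Δ : TBA}

theorem NoSep.neg_of_neg {p q r : Pt} {s : Set Pt} (h : Δ.NoSep p q) (hs : s ∈ Δ.Sbar)
    (hp : p ∈ Δ.tri) (hps : p ∉ s) (hr : Δ.fn s r * Δ.fn s q < 0) : Δ.fn s r * Δ.fn s p < 0 := by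
  have h1 := h s hs
  have h2 := mul_self_pos.mpr (fn_ne_zero hs hp hps)
  have h3 := mul_self_pos.mpr (ne_zero_of_mul_neg hr).2
  have h4 : 0 < Δ.fn s p * Δ.fn s q := lt_of_le_of_ne h1 (by
    rintro h; nlinarith [mul_pos h2 h3])
  exact neg_pos_trans hr h4

theorem not_mem_of_ne {s m m' : Set Pt} (hs : s ∈ Δ.Sbar) (hm : m ∈ Δ.Sbar) (hm' : m' ∈ Δ.Sbar)
    (hne : m ≠ m') {p : Pt} (hp : p ∈ m) (hp' : p ∈ m') (h : s ≠ m) (h' : s ≠ m') : p ∉ s :=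
  fun hps => (three hm hm' hs hne hp hp' hps).elim h h'

theorem ne_of_left {s m : Set Pt} {p q : Pt} (hm : m ∈ Δ.Sbar) (hp : p ∈ m)
    (h : Δ.fn s p * Δ.fn s q < 0) : s ≠ m := by
  rintro rfl; exact (ne_zero_of_mul_neg h).1 (fn_zero hm hp)

theorem ne_of_right {s m : Set Pt} {p q : Pt} (hm : m ∈ Δ.Sbar) (hq : q ∈ m)
    (h : Δ.fn s p * Δ.fn s q < 0) : s ≠ m := by
  rintro rfl; exact (ne_zero_of_mul_neg h).2 (fn_zero hm hq)

/-- The next vertex on `a` from `p` towards the intersection `c` with `b` is `c` or comes before. -/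
theorem next_vertex_before {a b l : Set Pt} (ha : a ∈ Δ.Sbar) (hb : b ∈ Δ.Sbar) (hab : a ≠ b)
    (hl : l ∈ Δ.Sbar) (hal : a ≠ l) {c p : Pt} (hca : c ∈ a) (hcb : c ∈ b) (hpa : p ∈ a)
    (hpl : p ∈ l) (hcp : c ≠ p) :
    ∃ e ∈ a, ∃ d ∈ Δ.Sbar, d ≠ a ∧ e ∈ d ∧ Δ.NoSep p e ∧ 0 < Δ.fn l e * Δ.fn l c ∧
      ((e = c ∧ d = b) ∨ e ∈ openSegment ℝ p c) := by
  obtain ⟨e, ea, d, hd, hda, ed, hn, hs⟩ := next_vertex ha hl hal hpa hpl (sub_tri ha hca)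
    (fn_ne_of_ne ha hl hal hpa hpl hca hcp)
  refine ⟨e, ea, d, hd, hda, ed, hn, hs, ?_⟩
  by_cases h : e ∈ b
  · left
    obtain rfl := inter_eq ha hb hab ea h hca hcb
    exact ⟨rfl, (three ha hb hd hab hca hcb ed).resolve_left hda⟩
  · right
    have h1 := fn_ne_zero hb (sub_tri ha ea) h
    have h2 := fn_ne_of_ne ha hb hab hca hcb hpa hcp.symm
    refine os_of_between (fn_ne' (Or.inl ha)) (fn_zero ha hpa) (fn_zero ha hca) (fn_zero ha ea)
      (fn_zero hl hpl) (fn_zero hb hcb) hs (lt_of_le_of_ne (hn.symm b hb) ?_)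
    exact (mul_ne_zero h1 h2).symm

namespace CrossPair

variable {σ₀ σ₁ a b d : Set Pt} {x₁ x₂ x₃ a₁ a₂ b₁ b₂ c : Pt} {n : ℕ}

theorem sep_c
    (P : Δ.CrossPair σ₀ σ₁ a b x₁ x₂ x₃ a₁ a₂ b₁ b₂ c)
    (hcb : Δ.NoSep c b₂) {s : Set Pt} (hs : s ∈ Δ.Sbar)
    (h : Δ.fn s a₂ * Δ.fn s b₂ < 0) : Δ.fn s a₂ * Δ.fn s c < 0 :=
  hcb.neg_of_neg hs P.c_tri (not_mem_of_ne hs P.ha P.hb P.a_ne_b P.ca P.cb (ne_of_left P.ha P.a₂a h)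
    (ne_of_right P.hb P.b₂b h)) h

theorem sep_b₂
    (P : Δ.CrossPair σ₀ σ₁ a b x₁ x₂ x₃ a₁ a₂ b₁ b₂ c)
    (hcb : Δ.NoSep c b₂) {s : Set Pt} (hs : s ∈ Δ.Sbar)
    (h : Δ.fn s a₂ * Δ.fn s c < 0) : Δ.fn s a₂ * Δ.fn s b₂ < 0 :=
  hcb.symm.neg_of_neg hs P.b₂_tri (not_mem_of_ne hs P.hσ₁ P.hb P.b_ne_σ₁.symm P.b₂σ P.b₂b
    (ne_of_left P.hσ₁ P.a₂σ h) (ne_of_right P.hb P.cb h)) h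

/-- Segments cutting off `a₂` from the triangle `c a₂ b₂` do not cross in it. -/
theorem not_crossed
    (P : Δ.CrossPair σ₀ σ₁ a b x₁ x₂ x₃ a₁ a₂ b₁ b₂ c)
    (hN : Δ.CornersEdges n) (hn : (Δ.cutting x₁ x₂ x₃).ncard ≤ n)
    (hcb : Δ.NoSep c b₂) (hd : d ∈ Δ.Sbar) (h : Δ.fn d a₂ * Δ.fn d b₂ < 0) {e u : Pt}
    (ea : e ∈ a) (ed : e ∈ d) (uσ : u ∈ σ₁) (ud : u ∈ d) {s : Set Pt} (hs : s ∈ Δ.Sbar)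
    (h' : Δ.fn s a₂ * Δ.fn s b₂ < 0) : 0 ≤ Δ.fn s e * Δ.fn s u := by
  by_contra! hlt
  obtain ⟨z, oz, h0⟩ := os_exists_zero hlt
  have zd := os_mem hd ed ud oz
  obtain ⟨fa, ra, aa₁, aa₂, ac, ax₂, ab₂, ax₁, -⟩ := P.signs_a
  obtain ⟨f1, r1, -, -, s1a₂, s1b₂, s1c, -⟩ := P.signs_σ₁
  have hc := P.sep_c hcb hd h
  have oe := os_of_sep P.ha hd P.a₂a P.ca ea ed hc
  have ou := os_of_sep P.hσ₁ hd P.a₂σ P.b₂σ uσ ud h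
  have C : Δ.Crossing a σ₁ d s c a₂ b₂ z :=
    { hσ₀ := P.ha, hσ₁ := P.hσ₁, hσ := P.a_ne_σ₁, x₁σ := P.ca, x₂σ₀ := P.a₂a, x₂σ₁ := P.a₂σ
      x₃σ := P.b₂σ, hg := hd, hg' := hs, hgg := (ne_of_left hd ed hlt).symm, g₁ := hc, g₃ := h
      g'₁ := P.sep_c hcb hs h', g'₃ := h', zg := zd
      zg' := (mem_iff hs (sub_tri hd zd)).mpr h0
      sec := ⟨ra.mul_pos (os_pos_right oz (ra.zero ea).ge (os_pos_right ou aa₂.ge ab₂)) ab₂,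
        r1.mul_pos (os_pos_left oz (os_pos_right oe s1a₂.ge s1c) (r1.zero uσ).ge) s1c⟩ }
  exact P.pa.2 (hN.of_crossing C (lt_of_lt_of_le (cutting_ncard_lt P.ha (fun f h1 h2 h3 =>
    have h4 := os_nonneg P.a₂_mem h2 h3
    ⟨os_nonneg P.oa (os_nonneg P.a₁_mem h2 h1) h4, h4, os_nonneg P.b₂_mem h2 h3⟩)
    (ra.mul_neg' ax₁ ax₂) P.ca P.a₂a) hn)).1

/-- A segment through two points of `a` and `σ₁` which is not crossed by segments cutting off
`a₂` is not crossed in between. -/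
theorem noSep_of_not_crossed
    (P : Δ.CrossPair σ₀ σ₁ a b x₁ x₂ x₃ a₁ a₂ b₁ b₂ c)
    (hcb : Δ.NoSep c b₂) {e u : Pt} (ea : e ∈ a) (uσ : u ∈ σ₁)
    (oe : ∀ s ∈ Δ.Sbar, Δ.fn s a₂ * Δ.fn s e < 0 → Δ.fn s a₂ * Δ.fn s c < 0)
    (ou : ∀ s ∈ Δ.Sbar, Δ.fn s a₂ * Δ.fn s u < 0 → Δ.fn s a₂ * Δ.fn s b₂ < 0)
    (h : ∀ s ∈ Δ.Sbar, Δ.fn s a₂ * Δ.fn s b₂ < 0 → 0 ≤ Δ.fn s e * Δ.fn s u) : Δ.NoSep e u := by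
  intro s hs
  by_contra! hlt
  have hne := fn_ne_zero hs P.a₂_tri (not_mem_of_ne hs P.ha P.hσ₁ P.a_ne_σ₁ P.a₂a P.a₂σ
    (ne_of_left P.ha ea hlt) (ne_of_right P.hσ₁ uσ hlt))
  refine absurd (h s hs ?_) (not_le.mpr hlt)
  rcases lt_or_gt_of_ne (mul_ne_zero hne (ne_zero_of_mul_neg hlt).1) with k | k
  · exact P.sep_b₂ hcb hs (oe s hs k)
  · exact ou s hs (pos_neg_trans k (by linarith))

/-- No segment cuts off `a₂` from the triangle `c a₂ b₂`. -/
theorem noSep_a₂_c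
    (P : Δ.CrossPair σ₀ σ₁ a b x₁ x₂ x₃ a₁ a₂ b₁ b₂ c) (hstrong : Δ.Strong) (hN : Δ.CornersEdges n)
    (hn : (Δ.cutting x₁ x₂ x₃).ncard ≤ n) (hcb : Δ.NoSep c b₂) : Δ.NoSep a₂ c := by
  intro s₀ hs₀
  by_contra! h₀
  obtain ⟨fa, ra, aa₁, aa₂, ac, ax₂, ab₂, ax₁, -⟩ := P.signs_a
  have ca₂ : c ≠ a₂ := by rintro rfl; nlinarith [mul_self_nonneg (Δ.fn s₀ c)]
  have point : ∀ {d : Set Pt}, d ∈ Δ.Sbar → Δ.fn d a₂ * Δ.fn d b₂ < 0 →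
      ∃ u ∈ σ₁, u ∈ d ∧ u ∈ openSegment ℝ a₂ b₂ := fun hd h => by
    obtain ⟨u, ou, h0⟩ := os_exists_zero h
    have hu := os_mem P.hσ₁ P.a₂σ P.b₂σ ou
    exact ⟨u, hu, (mem_iff hd (sub_tri P.hσ₁ hu)).mpr h0, ou⟩
  -- the first segment
  obtain ⟨e₁, e₁a, d₁, hd₁, hda₁, e₁d, n₁, -, oe₁⟩ := next_vertex_before P.ha P.hb P.a_ne_b P.hσ₁
    P.a_ne_σ₁ P.ca P.cb P.a₂a P.a₂σ ca₂
  replace oe₁ : e₁ ∈ openSegment ℝ a₂ c := by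
    rcases oe₁ with ⟨rfl, -⟩ | h
    · exact absurd (n₁ s₀ hs₀) (not_le.mpr h₀)
    · exact h
  have c₁ : Δ.fn d₁ a₂ * Δ.fn d₁ c < 0 := os_sep oe₁ (fn_zero hd₁ e₁d)
    (fn_ne_of_ne P.ha hd₁ hda₁.symm e₁a e₁d P.a₂a (os_ne_left ca₂.symm oe₁).symm)
  have s₁ := P.sep_b₂ hcb hd₁ c₁
  obtain ⟨u₁, u₁σ, u₁d, ou₁⟩ := point hd₁ s₁
  have H₁ := fun s hs h => P.not_crossed hN hn hcb hd₁ s₁ e₁a e₁d u₁σ u₁d (s := s) hs h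
  have n₅ : Δ.NoSep e₁ u₁ := P.noSep_of_not_crossed hcb e₁a u₁σ
    (fun s hs h => (separating_subset oe₁ ⟨hs, h⟩).2)
    (fun s hs h => (separating_subset ou₁ ⟨hs, h⟩).2) H₁
  have n₃ : Δ.NoSep a₂ u₁ := by
    intro s hs
    by_contra! h
    have h1 := H₁ s hs (separating_subset ou₁ ⟨hs, h⟩).2
    have h2 := n₁.symm.neg_of_neg hs (sub_tri P.ha e₁a) (not_mem_of_ne hs P.ha hd₁ hda₁.symm e₁a e₁d
      (ne_of_left P.ha P.a₂a h) (ne_of_right hd₁ u₁d h)) (r := u₁) (by linarith)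
    linarith
  -- the second segment
  obtain ⟨e₂, e₂a, d₂, hd₂, hda₂, e₂d, n₂, p₂, oe₂⟩ := next_vertex_before P.ha P.hb P.a_ne_b hd₁
    hda₁.symm P.ca P.cb e₁a e₁d (os_ne_right ca₂.symm oe₁).symm
  have k₁ : Δ.fn d₁ a₂ * Δ.fn d₁ e₂ < 0 := neg_pos_trans c₁ p₂
  have oe₁₂ := os_of_sep P.ha hd₁ P.a₂a e₂a e₁a e₁d k₁
  have hdd : d₁ ≠ d₂ := by rintro rfl; rw [fn_zero hd₁ e₂d] at k₁; simp at k₁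
  have a₂e₂ : a₂ ≠ e₂ := by rintro rfl; nlinarith [mul_self_nonneg (Δ.fn d₁ a₂)]
  have fd₂ := fn_ne_of_ne P.ha hd₂ hda₂.symm e₂a e₂d P.a₂a a₂e₂
  have hσd₂ : σ₁ ≠ d₂ := by rintro rfl; exact fd₂ (fn_zero hd₂ P.a₂σ)
  obtain ⟨pd₂, u₂, u₂σ, u₂d, au₂, we, wu, H₂⟩ : Δ.Proper d₂ ∧ ∃ u₂ ∈ σ₁, u₂ ∈ d₂ ∧ 0 < fa u₂ ∧
      (∀ s ∈ Δ.Sbar, Δ.fn s a₂ * Δ.fn s e₂ < 0 → Δ.fn s a₂ * Δ.fn s c < 0) ∧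
      (∀ s ∈ Δ.Sbar, Δ.fn s a₂ * Δ.fn s u₂ < 0 → Δ.fn s a₂ * Δ.fn s b₂ < 0) ∧
      ∀ s ∈ Δ.Sbar, Δ.fn s a₂ * Δ.fn s b₂ < 0 → 0 ≤ Δ.fn s e₂ * Δ.fn s u₂ := by
    rcases oe₂ with ⟨rfl, rfl⟩ | oe₂
    · exact ⟨P.pb, b₂, P.b₂σ, P.b₂b, ab₂, fun s hs h => h, fun s hs h => h, fun s hs _ => hcb s hs⟩
    · have h1 : Δ.fn d₂ e₁ * Δ.fn d₂ c < 0 := os_sep oe₂ (fn_zero hd₂ e₂d)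
        (fn_ne_of_ne P.ha hd₂ hda₂.symm e₂a e₂d e₁a (os_ne_right a₂e₂ oe₁₂))
      have h2 := n₁.neg_of_neg hd₂ P.a₂_tri (fun h => fd₂ (fn_zero hd₂ h)) (r := c) (by linarith)
      have c₂ : Δ.fn d₂ a₂ * Δ.fn d₂ c < 0 := by linarith
      have s₂ := P.sep_b₂ hcb hd₂ c₂
      obtain ⟨u₂, u₂σ, u₂d, ou₂⟩ := point hd₂ s₂
      exact ⟨proper_of_sep hd₂ P.a₂_tri P.c_tri c₂, u₂, u₂σ, u₂d, os_pos_right ou₂ aa₂.ge ab₂,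
        fun s hs h => (separating_subset (os_of_sep P.ha hd₂ P.a₂a P.ca e₂a e₂d c₂) ⟨hs, h⟩).2,
        fun s hs h => (separating_subset ou₂ ⟨hs, h⟩).2,
        fun s hs h => P.not_crossed hN hn hcb hd₂ s₂ e₂a e₂d u₂σ u₂d hs h⟩
  have hσd₁ : σ₁ ≠ d₁ := (ne_of_left P.hσ₁ P.a₂σ k₁).symm
  have n₆ : Δ.NoSep e₂ u₂ := P.noSep_of_not_crossed hcb e₂a u₂σ we wu H₂
  have ou₁₂ : u₁ ∈ openSegment ℝ a₂ u₂ := by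
    have h1 := H₂ d₁ hd₁ s₁
    have h2 := fn_ne_zero hd₁ (sub_tri P.hσ₁ u₂σ)
      (not_mem_of_ne hd₁ P.hσ₁ hd₂ hσd₂ u₂σ u₂d hσd₁.symm hdd)
    have h3 := lt_of_le_of_ne h1 (mul_ne_zero (ne_zero_of_mul_neg k₁).2 h2).symm
    exact os_of_sep P.hσ₁ hd₁ P.a₂σ u₂σ u₁σ u₁d (neg_pos_trans k₁ (by linarith))
  have au₁ : 0 < fa u₁ := os_pos_right ou₁ aa₂.ge ab₂
  have n₄ : Δ.NoSep u₁ u₂ := by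
    intro s hs
    by_contra! h
    have sa : s ≠ a := by
      rintro rfl; exact absurd (ra.mul_pos au₁ au₂) (by linarith)
    have sσ := ne_of_left P.hσ₁ u₁σ h
    have h' : Δ.fn s u₂ * Δ.fn s u₁ < 0 := by linarith
    have h1 := n₃.neg_of_neg hs P.a₂_tri
      (not_mem_of_ne hs P.ha P.hσ₁ P.a_ne_σ₁ P.a₂a P.a₂σ sa sσ) h'
    have h2 := H₂ s hs (wu s hs (by linarith))
    have h3 := n₅.neg_of_neg hs (sub_tri P.ha e₁a)
      (not_mem_of_ne hs P.ha hd₁ hda₁.symm e₁a e₁d sa (ne_of_left hd₁ u₁d h)) h'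
    have h4 := n₂.symm.neg_of_neg hs (sub_tri P.ha e₂a)
      (not_mem_of_ne hs P.ha hd₂ hda₂.symm e₂a e₂d sa (ne_of_right hd₂ u₂d h)) h3
    linarith
  exact no_nested_pair hstrong P.pa P.hσ₁ (proper_of_sep hd₁ P.a₂_tri P.c_tri c₁) pd₂ P.a_ne_σ₁
    hda₁.symm hda₂.symm hσd₁ hσd₂ hdd P.a₂a P.a₂σ e₁a e₁d e₂a e₂d u₁σ u₁d u₂σ u₂d oe₁₂ ou₁₂ n₁ n₂ n₃
    n₄ n₅ n₆

/-- Main step: in a minimal configuration the triangle `c a₂ b₂` is not cut. -/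
theorem uncut (hstrong : Δ.Strong) (hN : Δ.CornersEdges n) :
    ∀ {σ₀ σ₁ a b : Set Pt} {x₁ x₂ x₃ a₁ a₂ b₁ b₂ c : Pt},
      Δ.CrossPair σ₀ σ₁ a b x₁ x₂ x₃ a₁ a₂ b₁ b₂ c → (Δ.cutting x₁ x₂ x₃).ncard ≤ n →
      Δ.NoSep c b₂ ∧ Δ.NoSep a₂ c ∧ Δ.NoSep a₂ b₂ := by
  suffices H : ∀ k : ℕ, ∀ {σ₀ σ₁ a b : Set Pt} {x₁ x₂ x₃ a₁ a₂ b₁ b₂ c : Pt},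
      Δ.CrossPair σ₀ σ₁ a b x₁ x₂ x₃ a₁ a₂ b₁ b₂ c → (Δ.cutting x₁ x₂ x₃).ncard ≤ n →
      (Δ.separating x₂ a₁).ncard + (Δ.separating x₂ b₂).ncard < k →
      Δ.NoSep c b₂ ∧ Δ.NoSep a₂ c ∧ Δ.NoSep a₂ b₂ from
    fun {_ _ _ _ _ _ _ _ _ _ _ _} P hn => H _ P hn (Nat.lt_succ_self _)
  intro k
  induction k with
  | zero => intro _ _ _ _ _ _ _ _ _ _ _ _ _ _ h; simp at h
  | succ k ih =>
    intro σ₀ σ₁ a b x₁ x₂ x₃ a₁ a₂ b₁ b₂ c P hn hk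
    have h1 := P.noSep_c_b₂ hN hn fun Q hlt =>
      (ih Q.reflect (by rwa [cutting_swap]) (by omega)).2.2.symm
    have h2 := P.noSep_a₂_c hstrong hN hn h1
    refine ⟨h1, h2, fun s hs => ?_⟩
    by_contra! h
    exact absurd (h2 s hs) (not_le.mpr (P.sep_c h1 hs h))

end CrossPair
end TBA

namespace TBA
variable {Δ : TBA}

theorem os_neg_ext {f : Pt →ᵃ[ℝ] ℝ} {p q r : Pt} (h : r ∈ openSegment ℝ p q) (hr : f p * f r < 0) :
    f p * f q < 0 := by
  obtain ⟨s, t, hs, ht, -, e⟩ := os_comb h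
  by_contra! hq
  rw [e f] at hr
  nlinarith [mul_nonneg hs.le (mul_self_nonneg (f p)), mul_nonneg ht.le hq]

namespace CrossPair

variable {σ₀ σ₁ a b : Set Pt} {x₁ x₂ x₃ a₁ a₂ b₁ b₂ c : Pt} {n : ℕ}

/-- The blocking segment through `c` ends in the corner `x₂`. -/
theorem exists_blocker_corner
    (P : Δ.CrossPair σ₀ σ₁ a b x₁ x₂ x₃ a₁ a₂ b₁ b₂ c) (hstrong : Δ.Strong)
    (hN : Δ.CornersEdges n) (hn : (Δ.cutting x₁ x₂ x₃).ncard ≤ n) :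
    ∃ d ∈ Δ.B, c ∈ d ∧ x₂ ∈ d := by
  obtain ⟨n₁, -, n₃⟩ := uncut hstrong hN P hn
  obtain ⟨n₄, -, -⟩ := uncut hstrong hN P.reflect (by rwa [cutting_swap])
  obtain ⟨fb, rb, bb₁, bb₂, bc, bx₂, ba₁, -, -, ba₂⟩ := P.signs_b
  obtain ⟨fa, ra, aa₁, aa₂, ac, ax₂, ab₂, -⟩ := P.signs_a
  obtain ⟨d, hd, hcd⟩ := blocker P.ha P.pb P.a_ne_b P.ca P.cb
  refine ⟨d, hd, hcd, ?_⟩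
  have hb₂c : b₂ ≠ c := by rintro rfl; linarith
  have ha₂c : a₂ ≠ c := by rintro rfl; linarith
  obtain ⟨y, hyd, hy⟩ := enters_adjacent P.pb P.pa P.a_ne_b.symm hd P.cb P.ca P.b₂b P.a₂a hcd hb₂c
    ha₂c (rb.mul_neg ba₁ ba₂) fun y hy => triangle_blocked P.hb P.ha hd P.hσ₁ P.cb P.ca P.b₂b P.a₂a
      hcd hy P.b₂σ P.a₂σ n₃.symm
  have hs := hy.blocker_sep P.hb P.ha hd P.cb P.ca P.b₂b P.a₁a hcd hyd
  rw [mem_iff' (Or.inr hd) P.x₂_tri]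
  by_contra hx
  rcases lt_or_gt_of_ne (mul_ne_zero hx (ne_zero_of_mul_neg hs).1) with h | h
  · obtain ⟨w, ow, hw⟩ := os_exists_zero h
    have wσ := os_mem P.hσ₁ P.x₂σ₁ P.b₂σ ow
    have wd : w ∈ d := (mem_iff' (Or.inr hd) (sub_tri P.hσ₁ wσ)).mpr hw
    have := concurrent_of_strong hstrong P.hb P.ha P.a_ne_b.symm hd P.hσ₁ P.hσ₀ P.b_ne_σ₁.symm
      P.a_ne_σ₀.symm P.cb P.ca hcd hyd P.b₂b P.a₁a P.b₂σ P.a₁σ n₁ n₄ hy wd wσ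
    rw [inter_eq P.hσ₀ P.hσ₁ P.hσ this wσ P.x₂σ₀ P.x₂σ₁] at hw
    exact hx hw
  · obtain ⟨w, ow, hw⟩ := os_exists_zero (pos_neg_trans h (mul_comm (Δ.fn d b₂) _ ▸ hs))
    have wσ := os_mem P.hσ₀ P.x₂σ₀ P.a₁σ ow
    have wd : w ∈ d := (mem_iff' (Or.inr hd) (sub_tri P.hσ₀ wσ)).mpr hw
    have := concurrent_of_strong hstrong P.ha P.hb P.a_ne_b hd P.hσ₀ P.hσ₁ P.a_ne_σ₀.symm
      P.b_ne_σ₁.symm P.ca P.cb hcd hyd P.a₁a P.b₂b P.a₁σ P.b₂σ n₄ n₁ hy.swap wd wσ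
    rw [inter_eq P.hσ₀ P.hσ₁ P.hσ wσ this P.x₂σ₀ P.x₂σ₁] at hw
    exact hx hw

/-- A segment separating `x₂` and `a₁` yields a second crossing pair, closer to `x₂`. -/
theorem exists_pair_of_sep (P : Δ.CrossPair σ₀ σ₁ a b x₁ x₂ x₃ a₁ a₂ b₁ b₂ c) (hstrong : Δ.Strong)
    (hN : Δ.CornersEdges n) (hn : (Δ.cutting x₁ x₂ x₃).ncard ≤ n) {g : Set Pt} (hg : g ∈ Δ.Sbar)
    (h : Δ.fn g x₂ * Δ.fn g a₁ < 0) :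
    ∃ a' b' a₁' a₂' b₁' b₂' c', Δ.CrossPair σ₀ σ₁ a' b' x₁ x₂ x₃ a₁' a₂' b₁' b₂' c' ∧
      (Δ.separating x₂ a₁').ncard + (Δ.separating x₂ b₂').ncard <
        (Δ.separating x₂ a₁).ncard + (Δ.separating x₂ b₂).ncard := by
  obtain ⟨d, hd, hcd, hxd⟩ := P.exists_blocker_corner hstrong hN hn
  obtain ⟨n₁, -, -⟩ := uncut hstrong hN P hn
  obtain ⟨n₄, -, -⟩ := uncut hstrong hN P.reflect (by rwa [cutting_swap])
  obtain ⟨fb, rb, bb₁, bb₂, bc, bx₂, ba₁, -⟩ := P.signs_b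
  obtain ⟨f0, r0, -, s0x₂, -, -, s0c, -, -, s0x₃⟩ := P.signs_σ₀
  obtain ⟨f1, r1, -, s1x₂, -, -, s1c, -, -, s1x₁⟩ := P.signs_σ₁
  have hgb : g ≠ b := by rintro rfl; exact absurd h (not_lt.mpr (rb.mul_pos bx₂ ba₁).le)
  have hgc := n₄.neg_of_neg hg P.c_tri
    (not_mem_of_ne hg P.ha P.hb P.a_ne_b P.ca P.cb (ne_of_right P.ha P.a₁a h) hgb) h
  have hgb₂ := n₁.symm.neg_of_neg hg P.b₂_tri (not_mem_of_ne hg P.hσ₁ P.hb P.b_ne_σ₁.symm P.b₂σ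
    P.b₂b (ne_of_left P.hσ₁ P.x₂σ₁ h) hgb) hgc
  obtain ⟨y, oy, hy⟩ := os_exists_zero hgc
  have yt : y ∈ Δ.tri := tri_of_os P.x₂_tri P.c_tri oy
  have yg : y ∈ g := (mem_iff hg yt).mpr hy
  have yd : y ∈ d := (mem_iff' (Or.inr hd) yt).mpr
    (os_zero oy ((mem_iff' (Or.inr hd) P.x₂_tri).mp hxd) ((mem_iff' (Or.inr hd) P.c_tri).mp hcd))
  obtain ⟨g', hg', hgg, yg'⟩ := second hg hd yg yd
  have hx : Δ.fn g' x₂ ≠ 0 := fun h0 => by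
    rw [inter_eq_B hg' hd yg' yd ((mem_iff hg' P.x₂_tri).mpr h0) hxd] at hy
    exact (ne_zero_of_mul_neg hgc).1 hy
  have hgc' := os_sep oy (fn_zero hg' yg') hx
  have hga' := n₄.symm.neg_of_neg hg' P.a₁_tri (not_mem_of_ne hg' P.ha P.hσ₀ P.a_ne_σ₀ P.a₁a P.a₁σ
    (ne_of_right P.ha P.ca hgc') (ne_of_left P.hσ₀ P.x₂σ₀ hgc')) hgc'
  have hgb' := n₁.symm.neg_of_neg hg' P.b₂_tri (not_mem_of_ne hg' P.hσ₁ P.hb P.b_ne_σ₁.symm P.b₂σ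
    P.b₂b (ne_of_left P.hσ₁ P.x₂σ₁ hgc') (ne_of_right P.hb P.cb hgc')) hgc'
  have C : Δ.Crossing σ₀ σ₁ g g' x₁ x₂ x₃ y :=
    { hσ₀ := P.hσ₀, hσ₁ := P.hσ₁, hσ := P.hσ, x₁σ := P.x₁σ, x₂σ₀ := P.x₂σ₀, x₂σ₁ := P.x₂σ₁
      x₃σ := P.x₃σ, hg := hg, hg' := hg', hgg := hgg.symm, g₁ := os_neg_ext P.a₁_mem h
      g₃ := os_neg_ext P.b₂_mem hgb₂, g'₁ := os_neg_ext P.a₁_mem hga'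
      g'₃ := os_neg_ext P.b₂_mem hgb', zg := yg, zg' := yg'
      sec := ⟨r0.mul_pos (os_pos_right oy s0x₂.ge s0c) s0x₃,
        r1.mul_pos (os_pos_right oy s1x₂.ge s1c) s1x₁⟩ }
  obtain ⟨a', b', hab, a₁', a₂', b₁', b₂', Q⟩ := C.exists_pair
  refine ⟨a', b', a₁', a₂', b₁', b₂', y, Q, ?_⟩
  have ha' : Δ.fn a' x₂ * Δ.fn a' a₁ < 0 := by
    rcases hab with ⟨rfl, -⟩ | ⟨rfl, -⟩ <;> assumption
  have hb' : Δ.fn b' x₂ * Δ.fn b' b₂ < 0 := by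
    rcases hab with ⟨-, rfl⟩ | ⟨-, rfl⟩ <;> assumption
  exact add_lt_add_of_lt_of_le
    (separating_ncard_lt Q.ha (os_of_sep P.hσ₀ Q.ha P.x₂σ₀ P.a₁σ Q.a₁σ Q.a₁a ha') Q.a₁a ha')
    (separating_ncard_le (os_of_sep P.hσ₁ Q.hb P.x₂σ₁ P.b₂σ Q.b₂σ Q.b₂b hb'))

/-- The triangle `x₂a₁c` cannot be uncut along `x₂a₁` if `σ₁` is not an edge. -/
theorem not_noSep (P : Δ.CrossPair σ₀ σ₁ a b x₁ x₂ x₃ a₁ a₂ b₁ b₂ c) (hstrong : Δ.Strong)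
    (hN : Δ.CornersEdges n) (hn : (Δ.cutting x₁ x₂ x₃).ncard ≤ n) (hσ : Δ.Proper σ₁) :
    ¬ Δ.NoSep x₂ a₁ := by
  intro n₀
  obtain ⟨n₁, n₂, n₃⟩ := uncut hstrong hN P hn
  obtain ⟨n₄, -, -⟩ := uncut hstrong hN P.reflect (by rwa [cutting_swap])
  obtain ⟨fb, rb, bb₁, bb₂, bc, bx₂, ba₁, -, -, ba₂⟩ := P.signs_b
  obtain ⟨f1, r1, -, s1x₂, s1a₂, s1b₂, s1c, s1a₁, s1b₁, -⟩ := P.signs_σ₁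
  obtain ⟨d, hd, hbd⟩ := blocker P.hb hσ P.b_ne_σ₁ P.b₂b P.b₂σ
  have hcb₂ : c ≠ b₂ := by rintro rfl; linarith
  have ha₂b₂ : a₂ ≠ b₂ := by rintro rfl; linarith
  have hca₁ : c ≠ a₁ := by rintro rfl; linarith
  have hxa₁ : x₂ ≠ a₁ := by rintro rfl; linarith
  have hno : ∀ y ∈ d, ¬ Δ.InSec b σ₁ c a₂ y := fun y hy => triangle_blocked P.hb P.hσ₁ hd P.ha P.b₂b
    P.b₂σ P.cb P.a₂σ hbd hy P.ca P.a₂a n₂.symm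
  obtain ⟨y, hyd, hy⟩ := enters_adjacent P.pb hσ P.b_ne_σ₁ hd P.b₂b P.b₂σ P.cb P.a₂σ hbd hcb₂ ha₂b₂
    (rb.mul_neg bx₂ ba₂) hno
  have had : a₁ ∈ d := quad_exit P.hb P.hσ₁ hd P.ha P.hσ₀ P.b₂b P.b₂σ P.cb P.x₂σ₁ hbd hyd P.ca P.a₁a
    P.x₂σ₀ P.a₁σ hca₁ hxa₁ n₄ n₀ hy
  obtain ⟨v, vb, κ, hκ, hκb, vκ, nv, hv⟩ := next_away P.hb hσ P.b_ne_σ₁ (u := c) P.b₂b P.b₂σ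
    (by exact fn_ne_zero P.hσ₁ P.c_tri fun h => s1c.ne' (r1.zero h))
  obtain ⟨y', hyd', hy'⟩ := enters_adjacent hσ P.pb P.b_ne_σ₁.symm hd P.b₂σ P.b₂b P.a₂σ P.cb hbd
    ha₂b₂ hcb₂ hv fun y hy h => hno y hy h.swap
  have haκ : a₁ ∈ κ :=
    concurrent_of_strong hstrong P.hσ₁ P.hb P.b_ne_σ₁.symm hd P.ha hκ P.a_ne_σ₁ hκb
    P.b₂σ P.b₂b hbd hyd' P.a₂σ vb P.a₂a vκ n₃.symm nv hy' had P.a₁a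
  rcases three P.ha P.hσ₀ hκ P.a_ne_σ₀ P.a₁a P.a₁σ haκ with rfl | rfl
  · rw [inter_eq P.ha P.hb P.a_ne_b vκ vb P.ca P.cb] at hv
    nlinarith [mul_self_nonneg (Δ.fn σ₁ c)]
  · rw [inter_eq P.hσ₀ P.hb P.b_ne_σ₀.symm vκ vb P.b₁σ P.b₁b] at hv
    exact absurd hv (not_lt.mpr (r1.mul_pos s1b₁ s1c).le)

/-- Two segments can only cross in a corner if its second side is an edge of the triangle. -/
theorem not_proper (hstrong : Δ.Strong) (hN : Δ.CornersEdges n)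
    (hn : (Δ.cutting x₁ x₂ x₃).ncard ≤ n) (hσ : Δ.Proper σ₁) :
    ∀ {a b : Set Pt} {a₁ a₂ b₁ b₂ c : Pt}, ¬ Δ.CrossPair σ₀ σ₁ a b x₁ x₂ x₃ a₁ a₂ b₁ b₂ c := by
  suffices H : ∀ k : ℕ, ∀ {a b : Set Pt} {a₁ a₂ b₁ b₂ c : Pt},
      Δ.CrossPair σ₀ σ₁ a b x₁ x₂ x₃ a₁ a₂ b₁ b₂ c →
      ¬ (Δ.separating x₂ a₁).ncard + (Δ.separating x₂ b₂).ncard < k from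
    fun {_ _ _ _ _ _ _} P => H _ P (Nat.lt_succ_self _)
  intro k
  induction k with
  | zero => intro _ _ _ _ _ _ _ _ h; simp at h
  | succ k ih =>
    intro a b a₁ a₂ b₁ b₂ c P hk
    refine P.not_noSep hstrong hN hn hσ fun g hg => ?_
    by_contra! h
    obtain ⟨a', b', a₁', a₂', b₁', b₂', c', Q, hQ⟩ := P.exists_pair_of_sep hstrong hN hn hg h
    exact ih Q (by omega)

end CrossPair

theorem cornersEdges (hstrong : Δ.Strong) (n : ℕ) : Δ.CornersEdges n := by
  induction n using Nat.strong_induction_on with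
  | _ n ih =>
    intro σ₀ σ₁ a b x₁ x₂ x₃ a₁ a₂ b₁ b₂ c P hn
    constructor <;> by_contra h
    · exact CrossPair.not_proper hstrong (ih _ hn) (by rw [cutting_swap]) ⟨P.hσ₀, h⟩ P.reflect
    · exact CrossPair.not_proper hstrong (ih _ hn) le_rfl ⟨P.hσ₁, h⟩ P

theorem NoSep.minimalSeg {m : Set Pt} {p q : Pt} (h : Δ.NoSep p q) (hm : m ∈ Δ.Sbar) (hp : p ∈ m)
    (hq : q ∈ m) (hpq : p ≠ q) : Δ.MinimalSeg p q := by
  rintro r hr ⟨s₁, h₁, s₂, h₂, hne, hr₁, hr₂⟩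
  exact hne ((h.eq_of_mem hm h₁ hpq hp hq hr hr₁).trans (h.eq_of_mem hm h₂ hpq hp hq hr hr₂).symm)

/-- In a strong arrangement the part `a₂c` of a crossing pair is minimal. -/
theorem CrossPair.minimalSeg {σ₀ σ₁ a b : Set Pt} {x₁ x₂ x₃ a₁ a₂ b₁ b₂ c : Pt}
    (P : Δ.CrossPair σ₀ σ₁ a b x₁ x₂ x₃ a₁ a₂ b₁ b₂ c)
    (hstrong : Δ.Strong) : Δ.MinimalSeg a₂ c := by
  refine (uncut hstrong (cornersEdges hstrong _) P le_rfl).2.1.minimalSeg P.ha P.a₂a P.ca ?_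
  rintro rfl
  obtain ⟨f, -, -, -, h, -, -, -, -, h'⟩ := P.signs_b
  exact h'.ne h

theorem os_of_sbtw {p q r : Pt} (h : Sbtw ℝ p r q) : r ∈ openSegment ℝ p q := by
  obtain ⟨⟨t, ⟨h0, h1⟩, rfl⟩, hp, hq⟩ := h
  rw [openSegment_eq_image_lineMap]
  refine ⟨t, ⟨lt_of_le_of_ne h0 ?_, lt_of_le_of_ne h1 ?_⟩, rfl⟩
  · rintro rfl; simp at hp
  · rintro rfl; simp at hq

theorem edges_ne (Δ : TBA) : segment ℝ Δ.x1 Δ.x2 ≠ segment ℝ Δ.x2 Δ.x3 := by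
  intro h
  have h3 : Δ.x3 ∈ segment ℝ Δ.x1 Δ.x2 := h ▸ right_mem_segment ℝ _ _
  have hw : Wbtw ℝ Δ.x1 Δ.x3 Δ.x2 := by rwa [← mem_segment_iff_wbtw]
  have hi := Δ.indep
  rw [affineIndependent_iff_not_collinear_set] at hi
  have := hw.collinear
  rw [Set.pair_comm Δ.x3] at this
  exact hi this

theorem crossPair_of_sbtw {a₁ b₁ a₂ b₂ c : Pt}
    (hord₁ : Sbtw ℝ Δ.x1 b₁ a₁ ∧ Sbtw ℝ b₁ a₁ Δ.x2) (hord₂ : Sbtw ℝ Δ.x3 a₂ b₂ ∧ Sbtw ℝ a₂ b₂ Δ.x2)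
    (ha₁ : a₁ ∈ segment ℝ Δ.x1 Δ.x2) (hb₁ : b₁ ∈ segment ℝ Δ.x1 Δ.x2)
    (ha₂ : a₂ ∈ segment ℝ Δ.x2 Δ.x3) (hb₂ : b₂ ∈ segment ℝ Δ.x2 Δ.x3)
    (hA : segment ℝ a₁ a₂ ∈ Δ.S) (hB : segment ℝ b₁ b₂ ∈ Δ.S)
    (hc : c ∈ segment ℝ a₁ a₂ ∩ segment ℝ b₁ b₂) :
    Δ.CrossPair (segment ℝ Δ.x1 Δ.x2) (segment ℝ Δ.x2 Δ.x3) (segment ℝ a₁ a₂) (segment ℝ b₁ b₂)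
      Δ.x1 Δ.x2 Δ.x3 a₁ a₂ b₁ b₂ c := by
  have hσ₀ : segment ℝ Δ.x1 Δ.x2 ∈ Δ.Sbar := edge_mem (by simp [triEdges])
  have hσ₁ : segment ℝ Δ.x2 Δ.x3 ∈ Δ.Sbar := edge_mem (by simp [triEdges])
  have pa := proper_of_mem_S hA
  have pb := proper_of_mem_S hB
  have a_ne_σ₀ : segment ℝ a₁ a₂ ≠ segment ℝ Δ.x1 Δ.x2 := fun h => pa.2 (by simp [h, triEdges])
  have b_ne_σ₀ : segment ℝ b₁ b₂ ≠ segment ℝ Δ.x1 Δ.x2 := fun h => pb.2 (by simp [h, triEdges])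
  have b_ne_σ₁ : segment ℝ b₁ b₂ ≠ segment ℝ Δ.x2 Δ.x3 := fun h => pb.2 (by simp [h, triEdges])
  have a₁a := left_mem_segment ℝ a₁ a₂
  have a₂a := right_mem_segment ℝ a₁ a₂
  have b₁b := left_mem_segment ℝ b₁ b₂
  have b₂b := right_mem_segment ℝ b₁ b₂
  have x₂σ₀ := right_mem_segment ℝ Δ.x1 Δ.x2
  have x₂σ₁ := left_mem_segment ℝ Δ.x2 Δ.x3
  have o₁ := os_symm (os_of_sbtw hord₁.2)
  have o₂ := os_symm (os_of_sbtw hord₁.1)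
  have o₃ := os_symm (os_of_sbtw hord₂.2)
  have o₄ := os_symm (os_of_sbtw hord₂.1)
  have x₂a : Δ.x2 ∉ segment ℝ a₁ a₂ := fun h =>
    hord₁.2.ne_right (inter_eq pa.1 hσ₀ a_ne_σ₀ a₁a ha₁ h x₂σ₀)
  have x₂b : Δ.x2 ∉ segment ℝ b₁ b₂ := fun h =>
    hord₂.2.ne_right (inter_eq pb.1 hσ₁ b_ne_σ₁ b₂b hb₂ h x₂σ₁)
  have a_ne_b : segment ℝ a₁ a₂ ≠ segment ℝ b₁ b₂ := fun h => by
    have := inter_eq pb.1 hσ₀ b_ne_σ₀ b₁b hb₁ (h ▸ a₁a) ha₁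
    exact hord₁.2.ne_left this.symm
  have ba₁ := os_sep o₁ (f := Δ.fn (segment ℝ a₁ a₂)) (fn_zero pa.1 a₁a)
    (fn_ne_zero pa.1 (sub_tri hσ₀ x₂σ₀) x₂a)
  have ab₁ := os_same_of_zero_right o₁ (f := Δ.fn (segment ℝ b₁ b₂)) (fn_zero pb.1 b₁b)
    (fn_ne_zero pb.1 (sub_tri hσ₀ x₂σ₀) x₂b)
  have ab₂ := os_sep o₃ (f := Δ.fn (segment ℝ b₁ b₂)) (fn_zero pb.1 b₂b)
    (fn_ne_zero pb.1 (sub_tri hσ₀ x₂σ₀) x₂b)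
  have ba₂ := os_same_of_zero_right o₃ (f := Δ.fn (segment ℝ a₁ a₂)) (fn_zero pa.1 a₂a)
    (fn_ne_zero pa.1 (sub_tri hσ₀ x₂σ₀) x₂a)
  exact
    { hσ₀ := hσ₀, hσ₁ := hσ₁, hσ := edges_ne Δ, x₁σ := left_mem_segment ℝ _ _, x₂σ₀ := x₂σ₀
      x₂σ₁ := x₂σ₁, x₃σ := right_mem_segment ℝ _ _, ha := pa.1, hb := pb.1, a₁a := a₁a, a₂a := a₂a
      b₁b := b₁b, b₂b := b₂b, a₁σ := ha₁, a₂σ := ha₂, b₁σ := hb₁, b₂σ := hb₂, x₂a := x₂a, x₂b := x₂b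
      o₁ := o₁, o₂ := o₂, o₃ := o₃, o₄ := o₄
      oa := os_of_sep pa.1 pb.1 a₁a a₂a hc.1 hc.2 (pos_neg_trans (mul_comm (Δ.fn _ Δ.x2) _ ▸ ab₁)
        (mul_comm (Δ.fn _ Δ.x2) _ ▸ ab₂))
      ob := os_of_sep pb.1 pa.1 b₁b b₂b hc.2 hc.1 (neg_pos_trans (mul_comm (Δ.fn _ Δ.x2) _ ▸ ba₁)
        (mul_comm (Δ.fn _ Δ.x2) _ ▸ ba₂)) }

end TBA

/-- Lemma 15: under the hypotheses of Lemma 12, the subsegments `a₂c` and `b₁c` are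
minimal. -/
theorem TBA.S12_final_minimal (Δ : TBA) (hstrong : Δ.Strong)
    (a₁ b₁ a₂ b₂ c : Pt)
    (hord₁ : Sbtw ℝ Δ.x1 b₁ a₁ ∧ Sbtw ℝ b₁ a₁ Δ.x2)
    (hord₂ : Sbtw ℝ Δ.x3 a₂ b₂ ∧ Sbtw ℝ a₂ b₂ Δ.x2)
    (ha₁ : a₁ ∈ segment ℝ Δ.x1 Δ.x2) (hb₁ : b₁ ∈ segment ℝ Δ.x1 Δ.x2)
    (ha₂ : a₂ ∈ segment ℝ Δ.x2 Δ.x3) (hb₂ : b₂ ∈ segment ℝ Δ.x2 Δ.x3)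
    (hA : segment ℝ a₁ a₂ ∈ Δ.S) (hB : segment ℝ b₁ b₂ ∈ Δ.S)
    (hc : c ∈ segment ℝ a₁ a₂ ∩ segment ℝ b₁ b₂) :
    Δ.MinimalSeg a₂ c ∧ Δ.MinimalSeg b₁ c := by
  have P := crossPair_of_sbtw hord₁ hord₂ ha₁ hb₁ ha₂ hb₂ hA hB hc
  exact ⟨P.minimalSeg hstrong, P.reflect.minimalSeg hstrong⟩
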